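/- arXiv:0812.0540 — 4 statements merged into one kernel-verified Lean document; each statement's English description precedes it below -/
import Mathlib

section
/- Every positive integer n that is not of the form 4^k(8m+7) for some natural numbers k and m can be written as a sum of three squares of integers, i.e., there exist integers x, y, z with n = x² + y² + z² (where zero values are allowed, so n is a sum of three or fewer positive squares). -/
/-- The shift `b + k * a` of `b` of least absolute value. -/
theorem Int.exists_two_mul_abs_add_mul_le (a b : ℤ) (ha : 0 < a) :
    ∃ k : ℤ, 4 * (b + k * a) ^ 2 ≤ a ^ 2 := by
  refine ⟨-((2 * b + a) / (2 * a)), ?_⟩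
  have h1 := Int.emod_add_mul_ediv (2 * b + a) (2 * a)
  have h2 := Int.emod_nonneg (2 * b + a) (b := 2 * a) (by lia)
  have h3 := Int.emod_lt_of_pos (2 * b + a) (b := 2 * a) (by lia)
  generalize (2 * b + a) / (2 * a) = k at *
  generalize (2 * b + a) % (2 * a) = r at *
  have h4 : 2 * (b + -k * a) = r - a := by linear_combination -h1
  nlinarith

/-- A positive definite binary form `a x² + 2 b x y + c y²` of determinant `D` is properly
equivalent to one whose leading coefficient `g` satisfies `3 g² ≤ 4 D`. -/
theorem exists_unimodular_three_mul_sq_le (D a b c : ℤ) (ha : 0 < a) (hD : a * c - b ^ 2 = D)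
    (hD0 : 0 < D) :
    ∃ p q r s : ℤ, p * s - q * r = 1 ∧ 0 < a * p ^ 2 + 2 * b * p * r + c * r ^ 2 ∧
      3 * (a * p ^ 2 + 2 * b * p * r + c * r ^ 2) ^ 2 ≤ 4 * D := by
  induction hN : a.toNat using Nat.strong_induction_on generalizing a b c with
  | _ N ih =>
  by_cases hle : 3 * a ^ 2 ≤ 4 * D
  · exact ⟨1, 0, 0, 1, by norm_num, by simpa using ha, by simpa using hle⟩
  obtain ⟨k, hk⟩ := Int.exists_two_mul_abs_add_mul_le a b ha
  obtain ⟨c', hc'⟩ : ∃ c', c' = c + 2 * k * b + k ^ 2 * a := ⟨_, rfl⟩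
  have hdet : a * c' - (b + k * a) ^ 2 = D := by rw [hc', ← hD]; ring
  have hpos : 0 < c' := by
    by_contra! hneg
    nlinarith [sq_nonneg (b + k * a)]
  have hlt : c' < a := by
    by_contra! hge
    nlinarith
  obtain ⟨p, q, r, s, h1, h2, h3⟩ := ih c'.toNat (by lia) c' (-(b + k * a)) a hpos
    (by linear_combination hdet) rfl
  have he : a * (k * p - r) ^ 2 + 2 * b * (k * p - r) * p + c * p ^ 2 =
      c' * p ^ 2 + 2 * (-(b + k * a)) * p * r + a * r ^ 2 := by
    rw [hc']; ring
  refine ⟨k * p - r, k * q - s, p, q, by linear_combination h1, ?_, ?_⟩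
  · rwa [he]
  · rwa [he]

/-- The size estimate behind the reduction of ternary forms of determinant `1`. -/
theorem reduced_leading_coeff_bounds (a B F : ℤ) (ha : 0 < a) (h2 : 0 < a * B - F ^ 2)
    (h3 : 3 * (a * B - F ^ 2) ^ 2 ≤ 4 * a) (hk : 4 * F ^ 2 ≤ a ^ 2) :
    0 < B ∧ (B < a ∨ a = 1 ∧ F = 0 ∧ B = 1) := by
  have hBpos : 0 < B := by
    by_contra! hneg
    linarith [sq_nonneg F, mul_nonpos_of_nonneg_of_nonpos ha.le hneg]
  refine ⟨hBpos, ?_⟩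
  by_cases ha1 : a = 1
  · subst ha1
    have hF0 : F = 0 := by
      have : F ^ 2 = 0 := by have := sq_nonneg F; lia
      exact pow_eq_zero_iff (two_ne_zero) |>.1 this
    subst hF0
    exact Or.inr ⟨rfl, rfl, by nlinarith⟩
  · left
    have ha2 : 2 ≤ a := by lia
    by_contra! hge
    have h0 : a * a ≤ a * B := mul_le_mul_of_nonneg_left hge ha.le
    have h4 : 3 * a ^ 2 ≤ 4 * (a * B - F ^ 2) := by linarith
    generalize a * B - F ^ 2 = g at *
    have h5 : 6 * a ≤ 4 * g := by nlinarith
    nlinarith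

/-- A positive definite ternary integral form of determinant `1` takes only values that are sums
of three squares. -/
theorem ternary_form_det_one_eq_sum_three_sq (a b c d e f : ℤ) (ha : 0 < a)
    (hab : 0 < a * b - f ^ 2)
    (hdet : a * b * c + 2 * d * e * f - a * d ^ 2 - b * e ^ 2 - c * f ^ 2 = 1) (x y z : ℤ) :
    ∃ u v w : ℤ, a * x ^ 2 + b * y ^ 2 + c * z ^ 2 + 2 * d * y * z + 2 * e * x * z +
      2 * f * x * y = u ^ 2 + v ^ 2 + w ^ 2 := by
  induction hN : a.toNat using Nat.strong_induction_on generalizing a b c d e f x y z with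
  | _ N ih =>
  obtain ⟨p, q, r, s, h1, h2, h3⟩ := exists_unimodular_three_mul_sq_le a (a * b - f ^ 2)
    (a * d - e * f) (a * c - e ^ 2) hab (by linear_combination a * hdet) ha
  obtain ⟨k, hk⟩ := Int.exists_two_mul_abs_add_mul_le a (f * p + e * r) ha
  -- the coefficients after the substitution `(y, z) ↦ (p y + q z, r y + s z)`, `x ↦ x + k y`
  obtain ⟨F, hF⟩ : ∃ F, F = f * p + e * r + k * a := ⟨_, rfl⟩
  obtain ⟨E, hE⟩ : ∃ E, E = f * q + e * s := ⟨_, rfl⟩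
  obtain ⟨B, hB⟩ : ∃ B, B = b * p ^ 2 + 2 * d * p * r + c * r ^ 2 +
    2 * k * (f * p + e * r) + k ^ 2 * a := ⟨_, rfl⟩
  obtain ⟨C, hC⟩ : ∃ C, C = b * q ^ 2 + 2 * d * q * s + c * s ^ 2 := ⟨_, rfl⟩
  obtain ⟨G, hG⟩ : ∃ G, G = b * p * q + d * (p * s + q * r) + c * r * s + k * E := ⟨_, rfl⟩
  have hg : (a * b - f ^ 2) * p ^ 2 + 2 * (a * d - e * f) * p * r + (a * c - e ^ 2) * r ^ 2 =
      a * B - F ^ 2 := by rw [hB, hF]; ring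
  rw [hg] at h2 h3
  rw [← hF] at hk
  have hdet_new : a * B * C + 2 * G * E * F - a * G ^ 2 - B * E ^ 2 - C * F ^ 2 = 1 := by
    have : a * B * C + 2 * G * E * F - a * G ^ 2 - B * E ^ 2 - C * F ^ 2 = (p * s - q * r) ^ 2 *
        (a * b * c + 2 * d * e * f - a * d ^ 2 - b * e ^ 2 - c * f ^ 2) := by
      rw [hB, hC, hG, hE, hF]; ring
    rw [this, h1, hdet]; norm_num
  obtain ⟨Y, hY⟩ : ∃ Y, Y = s * y - q * z := ⟨_, rfl⟩
  obtain ⟨Z, hZ⟩ : ∃ Z, Z = p * z - r * y := ⟨_, rfl⟩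
  obtain ⟨X, hX⟩ : ∃ X, X = x - k * Y := ⟨_, rfl⟩
  have hy : y = p * Y + q * Z := by rw [hY, hZ]; linear_combination -y * h1
  have hz : z = r * Y + s * Z := by rw [hY, hZ]; linear_combination -z * h1
  have hx : x = X + k * Y := by rw [hX]; ring
  have hval : a * x ^ 2 + b * y ^ 2 + c * z ^ 2 + 2 * d * y * z + 2 * e * x * z +
      2 * f * x * y = a * X ^ 2 + B * Y ^ 2 + C * Z ^ 2 + 2 * G * Y * Z + 2 * E * X * Z +
      2 * F * X * Y := by
    rw [hx, hy, hz, hB, hC, hG, hE, hF]; ring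
  rw [hval]
  obtain ⟨hBpos, hlt | ⟨rfl, rfl, rfl⟩⟩ := reduced_leading_coeff_bounds a B F ha h2 h3 hk
  · obtain ⟨u, v, w, h⟩ := ih B.toNat (by lia) B a C (-E) G (-F) hBpos
      (by linear_combination h2) (by linear_combination hdet_new) Y (-X) Z rfl
    exact ⟨u, v, w, by linear_combination h⟩
  · exact ⟨X + E * Z, Y + G * Z, Z, by linear_combination Z ^ 2 * hdet_new⟩

/-- If `-d` is a square modulo `d * n - 1`, then `n` is a sum of three squares. -/
theorem sum_three_sq_of_dvd_sq_add (n d t : ℤ) (hd : 0 < d) (hm : 0 < d * n - 1)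
    (ht : d * n - 1 ∣ t ^ 2 + d) : ∃ x y z : ℤ, n = x ^ 2 + y ^ 2 + z ^ 2 := by
  obtain ⟨a, ha⟩ := ht
  have ha0 : 0 < a := by nlinarith [sq_nonneg t]
  obtain ⟨u, v, w, h⟩ := ternary_form_det_one_eq_sum_three_sq a (d * n - 1) n 0 1 t ha0
    (by linarith) (by linear_combination -n * ha) 0 0 1
  exact ⟨u, v, w, by linear_combination h⟩

open scoped NumberTheorySymbols in
theorem jacobiSym_neg_eq_one_of_mul_eq_add_one (d n p : ℕ) (hd : d % 4 = 1) (hp : p % 4 = 1)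
    (h : d * n = p + 1) : J(-d | p) = 1 := by
  have hdo : Odd d := Nat.odd_iff.2 (by lia)
  have hpo : Odd p := Nat.odd_iff.2 (by lia)
  have hmod : J((p : ℤ) | d) = J(-1 | d) :=
    jacobiSym.mod_left' (Int.ModEq.symm <| (Int.modEq_iff_dvd).2 ⟨n, by grind⟩)
  rw [neg_eq_neg_one_mul, jacobiSym.mul_left, jacobiSym.at_neg_one hpo,
    ZMod.χ₄_nat_one_mod_four hp, jacobiSym.quadratic_reciprocity_one_mod_four hd hpo, hmod,
    jacobiSym.at_neg_one hdo, ZMod.χ₄_nat_one_mod_four hd, one_mul]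

open scoped NumberTheorySymbols in
theorem jacobiSym_neg_eq_one_of_mul_eq_two_mul_add_one (d n p : ℕ)
    (hdp : d % 8 = 1 ∧ p % 4 = 1 ∨ d % 8 = 3 ∧ p % 2 = 1)
    (h : d * n = 2 * p + 1) : J(-d | p) = 1 := by
  have hdo : Odd d := Nat.odd_iff.2 (by lia)
  have hpo : Odd p := Nat.odd_iff.2 (by lia)
  have h2 : J(-2 | d) = 1 := by
    rw [jacobiSym.at_neg_two hdo, ZMod.χ₈'_nat_eq_if_mod_eight]
    have : d % 2 = 1 := Nat.odd_iff.1 hdo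
    rcases hdp with hdp | hdp <;> simp [hdp.1, this]
  have hmod : J(-2 * p | d) = J(1 | d) :=
    jacobiSym.mod_left' ((Int.modEq_iff_dvd).2 ⟨n, by zify at h; linarith⟩)
  rw [jacobiSym.mul_left, h2, one_mul, jacobiSym.one_left] at hmod
  rw [neg_eq_neg_one_mul, jacobiSym.mul_left, jacobiSym.at_neg_one hpo]
  rcases Nat.odd_mod_four_iff.1 (Nat.odd_iff.1 hpo) with hp | hp
  · rw [ZMod.χ₄_nat_one_mod_four hp, jacobiSym.quadratic_reciprocity_one_mod_four' hdo hp, hmod,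
      one_mul]
  · rw [ZMod.χ₄_nat_three_mod_four hp,
      jacobiSym.quadratic_reciprocity_three_mod_four (by lia) hp, hmod]
    norm_num

open scoped NumberTheorySymbols in
theorem exists_dvd_sq_add_of_jacobiSym_neg_eq_one (d p : ℕ) (hp : p.Prime) (h : J(-d | p) = 1) :
    ∃ t : ℤ, (p : ℤ) ∣ t ^ 2 + d := by
  have := Fact.mk hp
  obtain ⟨r, hr⟩ := ZMod.isSquare_of_jacobiSym_eq_one h
  refine ⟨r.valMinAbs, (ZMod.intCast_zmod_eq_zero_iff_dvd _ p).1 ?_⟩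
  push_cast at hr ⊢
  simp [sq, ← hr]

theorem exists_two_mul_dvd_sq_add (d p : ℤ) (hd : Odd d) (hp : Odd p)
    (h : ∃ t : ℤ, p ∣ t ^ 2 + d) : ∃ t : ℤ, 2 * p ∣ t ^ 2 + d := by
  obtain ⟨t, ht⟩ := h
  have hcop : IsCoprime (2 : ℤ) p := Int.isCoprime_two_left.2 hp
  rcases Int.even_or_odd t with he | ho
  · refine ⟨t + p, hcop.mul_dvd ?_ ?_⟩
    · exact even_iff_two_dvd.1 (((he.add_odd hp).pow).add_odd hd)
    · have : (t + p) ^ 2 + d = (t ^ 2 + d) + p * (2 * t + p) := by ring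
      exact this ▸ dvd_add ht (dvd_mul_right _ _)
  · exact ⟨t, hcop.mul_dvd (even_iff_two_dvd.1 (ho.pow.add_odd hd)) ht⟩

theorem sum_three_sq_of_mod_four_eq_two (n : ℕ) (hn : n % 4 = 2) :
    ∃ x y z : ℤ, (n : ℤ) = x ^ 2 + y ^ 2 + z ^ 2 := by
  have hcop : (n - 1).Coprime (4 * n) := by
    refine Nat.Coprime.mul_right (Nat.Coprime.pow_right 2 (k := n - 1) (m := 2) ?_) ?_
    · exact Nat.coprime_two_right.2 (Nat.odd_iff.2 (by lia))
    · exact (Nat.coprime_self_sub_left (by lia)).2 (Nat.coprime_one_left n)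
  obtain ⟨p, hpn, hp, hmod⟩ := Nat.forall_exists_prime_gt_and_modEq (n - 1)
    (q := 4 * n) (by lia) hcop
  obtain ⟨j, hj⟩ := (Nat.modEq_iff_dvd' hpn.le).1 hmod.symm
  have hpj : p = 4 * (n * j) + (n - 1) := by rw [← mul_assoc]; lia
  have hdn : (4 * j + 1) * n = p + 1 := by
    rw [hpj, add_assoc, Nat.sub_add_cancel (by lia)]; ring
  obtain ⟨t, ht⟩ := exists_dvd_sq_add_of_jacobiSym_neg_eq_one (4 * j + 1) p hp
    (jacobiSym_neg_eq_one_of_mul_eq_add_one _ n p (by lia) (by lia) hdn)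
  have hm : ((4 * j + 1 : ℕ) : ℤ) * n - 1 = p := by
    rw [← Nat.cast_mul, hdn]; push_cast; ring
  exact sum_three_sq_of_dvd_sq_add n (4 * j + 1 : ℕ) t (by positivity)
    (by rw [hm]; exact_mod_cast hp.pos) (by rwa [hm])

theorem sum_three_sq_of_odd (n : ℕ) (hn : n % 8 = 1 ∨ n % 8 = 3 ∨ n % 8 = 5) :
    ∃ x y z : ℤ, (n : ℤ) = x ^ 2 + y ^ 2 + z ^ 2 := by
  obtain ⟨c, r, hr, hc⟩ : ∃ c r, c * n = 2 * r + 1 ∧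
      (c = 1 ∧ r % 4 = 1 ∨ c = 3 ∧ r % 2 = 1) := by
    rcases hn with hn | hn | hn
    · exact ⟨3, (3 * n - 1) / 2, by lia, by lia⟩
    · exact ⟨1, (1 * n - 1) / 2, by lia, by lia⟩
    · exact ⟨3, (3 * n - 1) / 2, by lia, by lia⟩
  have hcop : r.Coprime (4 * n) := by
    refine Nat.Coprime.mul_right (Nat.Coprime.pow_right 2 (k := r) (m := 2) ?_) ?_
    · exact Nat.coprime_two_right.2 (Nat.odd_iff.2 (by lia))
    · refine Nat.Coprime.coprime_mul_left_right (k := c) (hr ▸ ?_)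
      simp
  obtain ⟨p, hpn, hp, hmod⟩ := Nat.forall_exists_prime_gt_and_modEq r (q := 4 * n) (by lia) hcop
  obtain ⟨j, hj⟩ := (Nat.modEq_iff_dvd' hpn.le).1 hmod.symm
  have hpj : p = 4 * (n * j) + r := by rw [← mul_assoc]; lia
  have hdn : (8 * j + c) * n = 2 * p + 1 := by
    rw [hpj, add_mul, hr]; ring
  obtain ⟨t, ht⟩ := exists_two_mul_dvd_sq_add (8 * j + c : ℕ) p
    (by rw [Int.odd_coe_nat, Nat.odd_iff]; lia) (by rw [Int.odd_coe_nat, Nat.odd_iff]; lia)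
    (exists_dvd_sq_add_of_jacobiSym_neg_eq_one (8 * j + c) p hp
      (jacobiSym_neg_eq_one_of_mul_eq_two_mul_add_one _ n p (by lia) hdn))
  have hm : ((8 * j + c : ℕ) : ℤ) * n - 1 = 2 * p := by
    rw [← Nat.cast_mul, hdn]; push_cast; ring
  exact sum_three_sq_of_dvd_sq_add n (8 * j + c : ℕ) t (by exact_mod_cast (by lia))
    (by rw [hm]; have := hp.pos; lia) (by rwa [hm])

/-- Every positive integer not of the form `4^k * (8m+7)` is a sum of three
integer squares. -/
theorem sum_of_three_squares_of_not_forbidden (n : ℕ) (hn : 0 < n)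
    (h : ¬ ∃ k m : ℕ, n = 4 ^ k * (8 * m + 7)) :
    ∃ x y z : ℤ, (n : ℤ) = x ^ 2 + y ^ 2 + z ^ 2 := by
  induction n using Nat.strong_induction_on with
  | _ n ih =>
  by_cases h4 : n % 4 = 0
  · obtain ⟨m, rfl⟩ := Nat.dvd_of_mod_eq_zero h4
    obtain ⟨x, y, z, hxyz⟩ := ih m (by lia) (by lia) fun ⟨k, l, hkl⟩ =>
      h ⟨k + 1, l, by rw [hkl]; ring⟩
    exact ⟨2 * x, 2 * y, 2 * z, by push_cast; rw [hxyz]; ring⟩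
  by_cases h2 : n % 4 = 2
  · exact sum_three_sq_of_mod_four_eq_two n h2
  have h7 : n % 8 ≠ 7 := fun h7 => h ⟨0, n / 8, by lia⟩
  exact sum_three_sq_of_odd n (by lia)
end

section
/- Every natural number n can be written as a sum of an even square and two triangular numbers: there exist natural numbers x, y, z with n = (2x)² + t_y + t_z. -/
/-- The `k`-th triangular number. -/
def triangular (k : ℕ) : ℕ := k * (k + 1) / 2

open scoped Quaternion NumberTheorySymbols

theorem exists_two_mul_add_mul_abs_le (A B : ℤ) (hA : 0 < A) :
    ∃ t : ℤ, |2 * (B + t * A)| ≤ A := by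
  refine ⟨-((2 * B + A) / (2 * A)), ?_⟩
  have h1 := Int.mul_ediv_add_emod (2 * B + A) (2 * A)
  have h2 := Int.emod_nonneg (2 * B + A) (show 2 * A ≠ 0 by omega)
  have h3 := Int.emod_lt_of_pos (2 * B + A) (show 0 < 2 * A by omega)
  rw [abs_le]
  constructor <;> linarith

/-- Every positive binary quadratic form of determinant `D` is equivalent to one whose leading
coefficient is at most `√(4 D / 3)`. -/
theorem binary_form_reduction (n : ℕ) : ∀ A B C D : ℤ, A.toNat = n → 0 < A → 0 < D →
    A * C - B ^ 2 = D → ∃ p q r s : ℤ, p * s - q * r = 1 ∧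
      3 * (A * p ^ 2 + 2 * B * p * r + C * r ^ 2) ^ 2 ≤ 4 * D := by
  induction n using Nat.strong_induction_on with
  | _ n ih =>
    intro A B C D hn hA hD hdet
    obtain ⟨t, ht⟩ := exists_two_mul_add_mul_abs_le A B hA
    have hsq : (2 * (B + t * A)) ^ 2 ≤ A ^ 2 := sq_le_sq' (abs_le.1 ht).1 (abs_le.1 ht).2
    have hdet' : (C + 2 * t * B + t ^ 2 * A) * A - (-(B + t * A)) ^ 2 = D := by
      rw [← hdet]; ring
    rcases lt_or_ge (C + 2 * t * B + t ^ 2 * A) A with hlt | hge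
    · have hpos : 0 < C + 2 * t * B + t ^ 2 * A := by
        by_contra! h
        nlinarith [sq_nonneg (B + t * A)]
      obtain ⟨p, q, r, s, hps, hle⟩ := ih (C + 2 * t * B + t ^ 2 * A).toNat (by omega) _ _ _ D
        rfl hpos hD hdet'
      refine ⟨t * p - r, t * q - s, p, q, by linarith, ?_⟩
      convert hle using 3
      ring
    · refine ⟨1, 0, 0, 1, by norm_num, ?_⟩
      nlinarith

theorem eq_one_of_three_mul_sq_le {a b : ℤ} (ha : 0 < a) (hb : 0 < b) (hab : 3 * a ^ 2 ≤ 4 * b)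
    (hba : 3 * b ^ 2 ≤ 4 * a) : a = 1 ∧ b = 1 := by
  have ha' : a < 2 := by nlinarith [sq_nonneg (3 * b - 2)]
  have hb' : b < 2 := by nlinarith [sq_nonneg (3 * a - 2)]
  omega

/-- Values of a positive ternary quadratic form of determinant one are sums of three squares. -/
theorem ternary_form_det_one (n : ℕ) : ∀ a b c d e f : ℤ, a.toNat = n → 0 < a →
    0 < a * b - f ^ 2 →
    a * b * c + 2 * d * e * f - a * d ^ 2 - b * e ^ 2 - c * f ^ 2 = 1 → ∀ x y z : ℤ,
    ∃ p q r : ℤ, a * x ^ 2 + b * y ^ 2 + c * z ^ 2 + 2 * d * y * z + 2 * e * x * z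
      + 2 * f * x * y = p ^ 2 + q ^ 2 + r ^ 2 := by
  induction n using Nat.strong_induction_on with
  | _ n ih =>
    intro a b c d e f hn ha hab hdet x y z
    obtain ⟨p, q, r, s, hps, hle⟩ := binary_form_reduction _ (a * b - f ^ 2) (a * d - e * f)
      (a * c - e ^ 2) a rfl hab ha (by linear_combination a * hdet)
    obtain ⟨t, ht⟩ := exists_two_mul_add_mul_abs_le a (f * p + e * r) ha
    have hsq := sq_le_sq' (abs_le.1 ht).1 (abs_le.1 ht).2
    obtain ⟨f₁, hf₁⟩ : ∃ f₁, f₁ = f * p + e * r + t * a := ⟨_, rfl⟩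
    obtain ⟨b₁, hb₁⟩ : ∃ b₁, b₁ = b * p ^ 2 + 2 * d * p * r + c * r ^ 2
      + 2 * t * (f * p + e * r) + t ^ 2 * a := ⟨_, rfl⟩
    obtain ⟨c₁, hc₁⟩ : ∃ c₁, c₁ = b * q ^ 2 + 2 * d * q * s + c * s ^ 2 := ⟨_, rfl⟩
    obtain ⟨e₁, he₁⟩ : ∃ e₁, e₁ = f * q + e * s := ⟨_, rfl⟩
    obtain ⟨d₁, hd₁⟩ : ∃ d₁, d₁ = b * p * q + d * (p * s + q * r) + c * r * s + t * e₁ :=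
      ⟨_, rfl⟩
    obtain ⟨y₁, hy₁⟩ : ∃ y₁, y₁ = s * y - q * z := ⟨_, rfl⟩
    obtain ⟨z₁, hz₁⟩ : ∃ z₁, z₁ = p * z - r * y := ⟨_, rfl⟩
    obtain ⟨x₁, hx₁⟩ : ∃ x₁, x₁ = x - t * y₁ := ⟨_, rfl⟩
    have hy : y = p * y₁ + q * z₁ := by
      rw [hy₁, hz₁]; linear_combination -y * hps
    have hz : z = r * y₁ + s * z₁ := by
      rw [hy₁, hz₁]; linear_combination -z * hps
    have hx : x = x₁ + t * y₁ := by rw [hx₁]; ring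
    have hval : a * x ^ 2 + b * y ^ 2 + c * z ^ 2 + 2 * d * y * z + 2 * e * x * z
        + 2 * f * x * y = b₁ * y₁ ^ 2 + a * x₁ ^ 2 + c₁ * z₁ ^ 2 + 2 * e₁ * x₁ * z₁
        + 2 * d₁ * y₁ * z₁ + 2 * f₁ * y₁ * x₁ := by
      rw [hx, hy, hz, hb₁, hc₁, hd₁, he₁, hf₁]; ring
    have hdet₁ : b₁ * a * c₁ + 2 * e₁ * d₁ * f₁ - b₁ * e₁ ^ 2 - a * d₁ ^ 2 - c₁ * f₁ ^ 2
        = 1 := by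
      have h : b₁ * a * c₁ + 2 * e₁ * d₁ * f₁ - b₁ * e₁ ^ 2 - a * d₁ ^ 2 - c₁ * f₁ ^ 2
          = (p * s - q * r) ^ 2 *
            (a * b * c + 2 * d * e * f - a * d ^ 2 - b * e ^ 2 - c * f ^ 2) := by
        rw [hb₁, hc₁, hd₁, he₁, hf₁]; ring
      rw [h, hps, hdet]; norm_num
    obtain ⟨G, hG⟩ : ∃ G, G = b₁ * a - f₁ ^ 2 := ⟨_, rfl⟩
    have hGeq : G = (a * b - f ^ 2) * p ^ 2 + 2 * (a * d - e * f) * p * r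
        + (a * c - e ^ 2) * r ^ 2 := by
      rw [hG, hb₁, hf₁]; ring
    have hGpos : 0 < G := by
      have h1 : (a * b - f ^ 2) * G = ((a * b - f ^ 2) * p + (a * d - e * f) * r) ^ 2
          + a * r ^ 2 := by
        rw [hGeq]; linear_combination (a * r ^ 2) * hdet
      by_contra! hneg
      have h2 : (a * b - f ^ 2) * G ≤ 0 := mul_nonpos_of_nonneg_of_nonpos hab.le hneg
      have h3 : 0 ≤ a * r ^ 2 := by positivity
      have h4 := sq_nonneg ((a * b - f ^ 2) * p + (a * d - e * f) * r)
      have h5 : a * r ^ 2 = 0 := by linarith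
      have hr : r = 0 := by simpa [ha.ne'] using h5
      subst hr
      have h6 : ((a * b - f ^ 2) * p) ^ 2 = 0 := by
        have : ((a * b - f ^ 2) * p + (a * d - e * f) * 0) ^ 2 = 0 := by linarith
        simpa using this
      have h7 : p = 0 := by simpa [hab.ne'] using h6
      subst h7
      norm_num at hps
    rw [← hGeq] at hle
    rw [← hf₁] at hsq ht
    have hb₁pos : 0 < b₁ := by
      by_contra! h
      have h1 := mul_nonpos_of_nonpos_of_nonneg h ha.le
      linarith [sq_nonneg f₁]
    rw [hval]
    rcases lt_or_ge b₁ a with hlt | hge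
    · exact ih b₁.toNat (by omega) b₁ a c₁ e₁ d₁ f₁ rfl hb₁pos (by linarith) hdet₁ y₁ x₁ z₁
    · have h3 : 3 * a ^ 2 ≤ 4 * G := by
        have h1 := mul_le_mul_of_nonneg_right hge ha.le
        linarith
      obtain ⟨ha1, hG1⟩ := eq_one_of_three_mul_sq_le ha hGpos h3 hle
      subst ha1
      have hf0 : f₁ = 0 := by
        have := abs_le.1 ht
        omega
      subst hf0
      have hb1 : b₁ = 1 := by linarith
      refine ⟨y₁ + d₁ * z₁, x₁ + e₁ * z₁, z₁, ?_⟩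
      rw [hb1] at hdet₁ ⊢
      linear_combination z₁ ^ 2 * hdet₁

theorem jacobiSym_neg_eq_one {d p : ℕ} (hd : d % 8 = 3) (hp : p % 2 = 1)
    (h : d ∣ 2 * p + 1) : J(-(d : ℤ) | p) = 1 := by
  have hd_odd : Odd d := Nat.odd_iff.2 (by omega)
  have hp_odd : Odd p := Nat.odd_iff.2 hp
  have h2 : J(2 | d) = -1 := by
    rw [jacobiSym.at_two hd_odd, ZMod.χ₈_nat_mod_eight, hd]; decide
  have h1 : J(-1 | d) = -1 := by
    rw [jacobiSym.at_neg_one hd_odd, ZMod.χ₄_nat_three_mod_four (by omega)]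
  have hpd : J(p | d) = 1 := by
    have h3 : J(2 * (p : ℤ) | d) = J(-1 | d) := by
      apply jacobiSym.mod_left'
      obtain ⟨m, hm⟩ := h
      exact Int.modEq_iff_dvd.2 ⟨-m, by zify at hm; linarith⟩
    rw [jacobiSym.mul_left, h2, h1] at h3
    linarith
  rw [jacobiSym.neg _ hp_odd]
  rcases (by omega : p % 4 = 1 ∨ p % 4 = 3) with h4 | h4
  · rw [ZMod.χ₄_nat_one_mod_four h4, jacobiSym.quadratic_reciprocity_one_mod_four' hd_odd h4, hpd]
    norm_num
  · rw [ZMod.χ₄_nat_three_mod_four h4,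
      jacobiSym.quadratic_reciprocity_three_mod_four (by omega) h4, hpd]
    norm_num

theorem exists_odd_dvd_sq_add {d p : ℕ} (hp : p.Prime) (hp2 : p % 2 = 1) (hd : d % 2 = 1)
    (h : J(-(d : ℤ) | p) = 1) : ∃ x : ℤ, (2 * p : ℤ) ∣ x ^ 2 + d := by
  have := Fact.mk hp
  obtain ⟨y, hy⟩   := ZMod.isSquare_of_jacobiSym_eq_one h
  obtain ⟨y, rfl⟩ := ZMod.intCast_surjective y
  have hdvd : (p : ℤ) ∣ y ^ 2 + d := by
    rw [← ZMod.intCast_zmod_eq_zero_iff_dvd] 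
    push_cast at hy ⊢
    linear_combination -hy
  have hcop : IsCoprime (2 : ℤ) p := by
    rw [Int.isCoprime_iff_gcd_eq_one]
    have : Nat.Coprime 2 p := (Nat.coprime_two_left).2 (Nat.odd_iff.2 hp2)
    exact_mod_cast this
  rcases Int.even_or_odd y with hy2 | hy2
  · refine ⟨y + p, hcop.mul_dvd ?_ ?_⟩
    · apply Even.two_dvd
      have h1 : Odd (p : ℤ) := by exact_mod_cast Nat.odd_iff.2 hp2
      have h2 : Odd (d : ℤ) := by exact_mod_cast Nat.odd_iff.2 hd
      exact ((hy2.add_odd h1).pow).add_odd h2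
    · have : (y + p) ^ 2 + (d : ℤ) = y ^ 2 + d + p * (2 * y + p) := by ring
      rw [this]
      exact dvd_add hdvd (dvd_mul_right _ _)
  · refine ⟨y, hcop.mul_dvd ?_ hdvd⟩
    have h2 : Odd (d : ℤ) := by exact_mod_cast Nat.odd_iff.2 hd
    exact (hy2.pow.add_odd h2).two_dvd

theorem exists_sum_three_squares {N : ℕ} (hN : N % 4 = 1) :
    ∃ a b c : ℤ, (N : ℤ) = a ^ 2 + b ^ 2 + c ^ 2 := by
  obtain ⟨k, hk⟩ : ∃ k, 2 * k + 1 = 3 * N := ⟨(3 * N - 1) / 2, by omega⟩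
  have hcop : k.Coprime (4 * N) := by
    have h1 : k.Coprime 2 := Nat.coprime_two_right.2 (Nat.odd_iff.2 (by omega))
    have h2 : k.Coprime N := by
      have h3 := Nat.gcd_dvd_left k N
      have h4 := Nat.gcd_dvd_right k N
      have h5 : Nat.gcd k N ∣ 2 * k + 1 := hk ▸ h4.mul_left 3
      exact Nat.dvd_one.1 ((Nat.dvd_add_right (h3.mul_left 2)).1 h5)
    have h3 : k.Coprime (2 ^ 2) := h1.pow_right 2
    exact Nat.Coprime.mul_right h3 h2
  obtain ⟨p, hpk, hp, hmod⟩ := Nat.forall_exists_prime_gt_and_modEq k (by omega) hcop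
  obtain ⟨j, hj⟩ := (Nat.modEq_iff_dvd' hpk.le).1 hmod.symm
  have hpj : p = 4 * N * j + k := by omega
  have hdN : (8 * j + 3) * N = 2 * p + 1 := by rw [hpj]; linarith
  have hp2 : p % 2 = 1 := by
    have : 4 * N * j = 2 * (2 * N * j) := by ring
    omega
  have hJ : J(-((8 * j + 3 : ℕ) : ℤ) | p) = 1 :=
    jacobiSym_neg_eq_one (by omega) hp2 ⟨N, hdN.symm⟩
  obtain ⟨x, m, hm⟩ := exists_odd_dvd_sq_add hp hp2 (by omega) hJ
  have hp0 : (0 : ℤ) < p := by exact_mod_cast hp.pos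
  push_cast at hm
  zify at hdN
  have hm0 : 0 < m := by
    by_contra! h
    nlinarith [sq_nonneg x]
  obtain ⟨a, b, c, h⟩ := ternary_form_det_one _ m (2 * p) N 0 1 x rfl hm0 (by linarith)
    (by linear_combination (-(N : ℤ)) * hm + hdN) 0 0 1
  exact ⟨a, b, c, by linarith⟩

/-- The integer quaternion `a + b i + c j + d k`. -/
def intQuaternion (a b c d : ℤ) : ℍ[ℤ] := ⟨a, b, c, d⟩

section
variable (a b c d : ℤ)

@[simp] theorem re_intQuaternion : (intQuaternion a b c d).re = a := rfl
@[simp] theorem imI_intQuaternion : (intQuaternion a b c d).imI = b := rfl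
@[simp] theorem imJ_intQuaternion : (intQuaternion a b c d).imJ = c := rfl
@[simp] theorem imK_intQuaternion : (intQuaternion a b c d).imK = d := rfl

end

theorem exists_even_pairing {a b c d : ℤ} (h : Even (a ^ 2 + b ^ 2 + c ^ 2 + d ^ 2)) :
    (Even (a + b) ∧ Even (c + d)) ∨ (Even (a + c) ∧ Even (b + d)) ∨
      (Even (a + d) ∧ Even (b + c)) := by
  simp only [Int.even_add, Int.even_pow] at *
  tauto

/-- If `normSq w` is even, then `w * u` is divisible by `2` for some `u` of norm `2`. -/
theorem exists_normSq_two_mul_eq {w : ℍ[ℤ]} (h : Even (Quaternion.normSq w)) :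
    ∃ u w' : ℍ[ℤ], Quaternion.normSq u = 2 ∧ w * u = (2 : ℤ) • w' := by
  rw [Quaternion.normSq_def'] at h
  rcases exists_even_pairing h with ⟨⟨s, hs⟩, ⟨t, ht⟩⟩ | ⟨⟨s, hs⟩, ⟨t, ht⟩⟩ | ⟨⟨s, hs⟩, ⟨t, ht⟩⟩
  · refine ⟨intQuaternion 1 1 0 0, intQuaternion (w.re - s) s t (t - w.imJ),
      by simp [Quaternion.normSq_def'], ?_⟩
    ext <;> simp only [Quaternion.re_mul, Quaternion.imI_mul, Quaternion.imJ_mul,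
      Quaternion.imK_mul, Quaternion.re_smul, Quaternion.imI_smul, Quaternion.imJ_smul,
      Quaternion.imK_smul, re_intQuaternion, imI_intQuaternion, imJ_intQuaternion,
      imK_intQuaternion, smul_eq_mul] <;> linarith
  · refine ⟨intQuaternion 1 0 1 0, intQuaternion (w.re - s) (w.imI - t) s t,
      by simp [Quaternion.normSq_def'], ?_⟩
    ext <;> simp only [Quaternion.re_mul, Quaternion.imI_mul, Quaternion.imJ_mul,
      Quaternion.imK_mul, Quaternion.re_smul, Quaternion.imI_smul, Quaternion.imJ_smul,
      Quaternion.imK_smul, re_intQuaternion, imI_intQuaternion, imJ_intQuaternion,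
      imK_intQuaternion, smul_eq_mul] <;> linarith
  · refine ⟨intQuaternion 1 0 0 1, intQuaternion (w.re - s) t (w.imJ - t) s,
      by simp [Quaternion.normSq_def'], ?_⟩
    ext <;> simp only [Quaternion.re_mul, Quaternion.imI_mul, Quaternion.imJ_mul,
      Quaternion.imK_mul, Quaternion.re_smul, Quaternion.imI_smul, Quaternion.imJ_smul,
      Quaternion.imK_smul, re_intQuaternion, imI_intQuaternion, imJ_intQuaternion,
      imK_intQuaternion, smul_eq_mul] <;> linarith

theorem exists_add_mul_two_mul_abs_lt {k : ℤ} (hk : 0 < k) (hodd : Odd k) (x : ℤ) :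
    ∃ y t : ℤ, x = y + k * t ∧ 4 * y ^ 2 < k ^ 2 := by
  obtain ⟨m, rfl⟩ := hodd
  refine ⟨(x + m) % (2 * m + 1) - m, (x + m) / (2 * m + 1), ?_, ?_⟩
  · linarith [Int.mul_ediv_add_emod (x + m) (2 * m + 1)]
  · have h1 := Int.emod_nonneg (x + m) hk.ne'
    have h2 := Int.emod_lt_of_pos (x + m) hk
    nlinarith

theorem exists_normSq_lt {k : ℤ} (hk : 0 < k) (hodd : Odd k) (w : ℍ[ℤ]) :
    ∃ y t : ℍ[ℤ], w = y + k • t ∧ Quaternion.normSq y < k ^ 2 := by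
  obtain ⟨a', s, ha, ha'⟩ := exists_add_mul_two_mul_abs_lt hk hodd w.re
  obtain ⟨b', t, hb, hb'⟩ := exists_add_mul_two_mul_abs_lt hk hodd w.imI
  obtain ⟨c', u, hc, hc'⟩ := exists_add_mul_two_mul_abs_lt hk hodd w.imJ
  obtain ⟨d', v, hd, hd'⟩ := exists_add_mul_two_mul_abs_lt hk hodd w.imK
  refine ⟨intQuaternion a' b' c' d', intQuaternion s t u v, ?_, ?_⟩
  · ext <;> simp only [Quaternion.re_add, Quaternion.imI_add, Quaternion.imJ_add,
      Quaternion.imK_add, Quaternion.re_smul, Quaternion.imI_smul, Quaternion.imJ_smul,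
      Quaternion.imK_smul, re_intQuaternion, imI_intQuaternion, imJ_intQuaternion,
      imK_intQuaternion, smul_eq_mul] <;> assumption
  · rw [Quaternion.normSq_def']
    simp only [re_intQuaternion, imI_intQuaternion, imJ_intQuaternion, imK_intQuaternion]
    linarith

theorem exists_eq_smul_of_smul_eq_smul {p m : ℤ} (h : IsCoprime p m) {x z : ℍ[ℤ]}
    (hx : m • x = p • z) : ∃ z', x = p • z' := by
  obtain ⟨a, b, hab⟩ := h
  refine ⟨a • x + b • z, ?_⟩
  calc x = (a * p + b * m) • x := by rw [hab, one_smul]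
    _ = (p * a) • x + b • (m • x) := by rw [add_smul, mul_smul b m, mul_comm a p]
    _ = p • (a • x + b • z) := by rw [hx, smul_add, mul_smul, smul_comm b p]

/-- If `p` divides `star w * v * w`, this persists on replacing `w` by `w * u / m`, for `m`
coprime to `p`. -/
theorem conj_descend {p m : ℤ} (h : IsCoprime p m) {v w u w' z : ℍ[ℤ]}
    (hw : star w * v * w = p • z) (hu : w * u = m • w') : ∃ z', star w' * v * w' = p • z' := by
  have h1 : (m * m) • (star w' * v * w') = p • (star u * z * u) := by
    have h2 : star (w * u) * v * (w * u) = star u * (star w * v * w) * u := by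
      rw [star_mul]; simp only [mul_assoc]
    rw [hw, hu] at h2
    simpa only [mul_smul, smul_mul_assoc, mul_smul_comm, star_smul, star_trivial] using h2
  exact exists_eq_smul_of_smul_eq_smul (h.mul_right h) h1

/-- Descent in the style of Lagrange: if `p` divides `star w * v * w` for some `w` whose norm is a small multiple
of `p`, then it does so for some `w` of norm `p`. -/
theorem exists_normSq_eq_prime_conj {p : ℕ} (hp : p.Prime) (v : ℍ[ℤ]) (n : ℕ) :
    0 < n → n < p → ∀ w z : ℍ[ℤ], Quaternion.normSq w = n * p → star w * v * w = (p : ℤ) • z →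
    ∃ w z : ℍ[ℤ], Quaternion.normSq w = p ∧ star w * v * w = (p : ℤ) • z := by
  have coprime_of_lt {m : ℕ} (h0 : 0 < m) (hm : m < p) : IsCoprime (p : ℤ) m :=
    Nat.isCoprime_iff_coprime.2 (Nat.coprime_of_lt_prime h0.ne' hm hp)
  induction n using Nat.strong_induction_on with
  | _ n ih =>
    intro hn hnp w z hw hz
    rcases Nat.even_or_odd n with ⟨k, hk⟩ | hodd
    · obtain ⟨u, w', hu, hw'⟩ := exists_normSq_two_mul_eq (w := w) (by
        rw [hw, hk]; exact ⟨k * p, by push_cast; ring⟩)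
      have hcop : IsCoprime (p : ℤ) 2 := by
        have := coprime_of_lt (m := 2) (by norm_num) (by omega)
        exact_mod_cast this
      obtain ⟨z', hz'⟩ := conj_descend hcop hz hw'
      refine ih k (by omega) (by omega) (by omega) w' z' ?_ hz'
      have h1 := congrArg Quaternion.normSq hw'
      rw [map_mul, hu, hw, Quaternion.normSq_smul, hk] at h1
      push_cast at h1
      linarith
    · rcases (by omega : n = 1 ∨ 1 < n) with rfl | hn1
      · exact ⟨w, z, by simpa using hw, hz⟩
      have hn0 : (0 : ℤ) < n := by exact_mod_cast hn
      have hcop := coprime_of_lt hn hnp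
      obtain ⟨y, t, hwy, hy⟩ := exists_normSq_lt hn0 (by exact_mod_cast hodd) w
      obtain ⟨w', hw'⟩ : ∃ w', w * star y = (n : ℤ) • w' := by
        refine ⟨(p : ℤ) • 1 - w * star t, ?_⟩
        have h1 : star y = star w - (n : ℤ) • star t := by
          rw [hwy, star_add, star_smul, star_trivial (n : ℤ), add_sub_cancel_right]
        rw [h1, mul_sub, Quaternion.self_mul_star, hw, smul_sub, mul_smul_comm]
        congr 1
        ext <;> simp
      have hnorm : n * Quaternion.normSq w' = p * Quaternion.normSq y := by
        have h1 := congrArg Quaternion.normSq hw'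
        rw [map_mul, Quaternion.normSq_star, hw, Quaternion.normSq_smul] at h1
        apply mul_left_cancel₀ hn0.ne'
        linarith
      obtain ⟨l, hl⟩ : (n : ℤ) ∣ Quaternion.normSq y :=
        hcop.symm.dvd_of_dvd_mul_left ⟨_, hnorm.symm⟩
      have hl0 : 0 ≤ l := by
        have := Quaternion.normSq_nonneg (a := y)
        rw [hl] at this
        exact nonneg_of_mul_nonneg_right this hn0
      have hln : l < n := by
        rw [hl, sq] at hy
        exact lt_of_mul_lt_mul_left hy hn0.le
      lift l to ℕ using hl0
      have hw'norm : Quaternion.normSq w' = l * p := by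
        apply mul_left_cancel₀ hn0.ne'
        rw [hnorm, hl]; ring
      obtain ⟨z', hz'⟩ := conj_descend hcop hz hw'
      rcases Nat.eq_zero_or_pos l with rfl | hlpos
      · exfalso
        have hy0 : y = 0 := by
          rw [← Quaternion.normSq_eq_zero, hl]; simp
        rw [hy0, zero_add] at hwy
        rw [hwy, Quaternion.normSq_smul] at hw
        have h1 : (n : ℤ) * Quaternion.normSq t = p := by
          apply mul_left_cancel₀ hn0.ne'
          linarith
        have h2 : n ∣ p := by
          zify; exact ⟨_, h1.symm⟩
        rcases (Nat.dvd_prime hp).1 h2 with h | h <;> omega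
      · exact ih l (by omega) hlpos (by omega) w' z' hw'norm hz'

theorem four_dvd_imJ_of_conj {p : ℕ} (hp : p % 4 = 3) {v w z : ℍ[ℤ]} (hv : v.re = 0)
    (hI : Odd v.imI) (hJ : v.imJ % 4 = 2) (hK : Even v.imK) (hw : Quaternion.normSq w = p)
    (hz : star w * v * w = (p : ℤ) • z) : z.re = 0 ∧ 4 ∣ z.imJ := by
  rw [Quaternion.normSq_def'] at hw
  have hre := congrArg (fun q : ℍ[ℤ] => q.re) hz
  have him := congrArg (fun q : ℍ[ℤ] => q.imJ) hz
  simp only [Quaternion.re_mul, Quaternion.imI_mul, Quaternion.imJ_mul, Quaternion.imK_mul,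
    Quaternion.re_star, Quaternion.imI_star, Quaternion.imJ_star, Quaternion.imK_star,
    Quaternion.re_smul, Quaternion.imJ_smul, smul_eq_mul, hv] at hre him
  generalize w.re = s at *
  generalize w.imI = x at *
  generalize w.imJ = y at *
  generalize w.imK = t at *
  constructor
  · have h1 : (p : ℤ) * z.re = 0 := by rw [← hre]; ring
    rcases mul_eq_zero.1 h1 with h | h
    · omega
    · exact h
  · have hsum : (s ^ 2 + x ^ 2 + y ^ 2 + t ^ 2) % 4 = 3 := by rw [hw]; omega
    obtain ⟨b, hb⟩ : ∃ b, v.imJ = 2 * (2 * b + 1) := ⟨(v.imJ - 2) / 4, by omega⟩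
    obtain ⟨c, hc⟩ := hK
    have hodd : Odd (s ^ 2 - x ^ 2 + y ^ 2 - t ^ 2) ∧ Odd (x * y - s * t) := by
      have sq_mod (k : ℤ) : (k % 2 = 0 ∧ k ^ 2 % 4 = 0) ∨ (k % 2 = 1 ∧ k ^ 2 % 4 = 1) := by
        rcases Int.emod_two_eq_zero_or_one k with h | h
        · obtain ⟨m, rfl⟩ := Int.even_iff.2 h
          left; refine ⟨h, ?_⟩; ring_nf; omega
        · obtain ⟨m, rfl⟩ := Int.odd_iff.2 h
          right; refine ⟨h, ?_⟩; ring_nf; omega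
      refine ⟨Int.odd_iff.2 ?_, ?_⟩
      · have := sq_mod s; have := sq_mod x; have := sq_mod y; have := sq_mod t
        omega
      · rw [Int.odd_sub, ← Int.not_even_iff_odd, Int.even_mul, Int.even_mul, Int.even_iff,
          Int.even_iff, Int.even_iff, Int.even_iff]
        have := sq_mod s; have := sq_mod x; have := sq_mod y; have := sq_mod t
        omega
    obtain ⟨m, hm⟩ : Even ((2 * b + 1) * (s ^ 2 - x ^ 2 + y ^ 2 - t ^ 2)
        + v.imI * (x * y - s * t)) :=
      ((odd_two_mul_add_one b).mul hodd.1).add_odd (hI.mul hodd.2)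
    have h1 : (4 : ℤ) ∣ p * z.imJ := by
      refine ⟨m + c * (y * t + s * x), ?_⟩
      rw [← him, hb, hc]
      linear_combination 2 * hm
    have hcop : IsCoprime (4 : ℤ) p := by
      rw [Int.isCoprime_iff_gcd_eq_one]
      have : (4 : ℤ).gcd p = Nat.gcd 4 p := rfl
      rw [this, Nat.gcd_rec, hp]
      norm_num
    exact hcop.dvd_of_dvd_mul_left h1

/-- A sum of three squares `a² + b² + c²` with `b ≡ 2 [ZMOD 4]` is rotated into one with a term
divisible by four. -/
theorem exists_three_squares_four_dvd {p N : ℕ} (hp : p.Prime) (hp4 : p % 4 = 3)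
    (hJ : J(-(N : ℤ) | p) = 1) {a b c : ℤ} (hN : (N : ℤ) = a ^ 2 + b ^ 2 + c ^ 2) (ha : Odd a)
    (hb : b % 4 = 2) (hc : Even c) :
    ∃ a' b' c' : ℤ, (N : ℤ) = a' ^ 2 + b' ^ 2 + c' ^ 2 ∧ 4 ∣ b' := by
  have := Fact.mk hp
  have hp0 : (0 : ℤ) < p := by exact_mod_cast hp.pos
  have hpodd : Odd p := Nat.odd_iff.2 (by omega)
  have hpN : ¬ (p : ℤ) ∣ N := by
    intro h
    have h1 : J(-(N : ℤ) | p) = 0 := by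
      rw [← jacobiSym.legendreSym.to_jacobiSym, legendreSym.eq_zero_iff,
        ZMod.intCast_zmod_eq_zero_iff_dvd]
      exact (dvd_neg).2 h
    omega
  obtain ⟨r, hr⟩ := ZMod.isSquare_of_jacobiSym_eq_one hJ
  obtain ⟨r, rfl⟩ := ZMod.intCast_surjective r
  obtain ⟨m, hm⟩ : (p : ℤ) ∣ N + r ^ 2 := by
    rw [← ZMod.intCast_zmod_eq_zero_iff_dvd]
    push_cast at hr ⊢
    linear_combination -hr
  obtain ⟨v, hv⟩ : ∃ v, v = intQuaternion 0 a b c := ⟨_, rfl⟩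
  obtain ⟨u, hu⟩ : ∃ u, u = intQuaternion (-r) a b c := ⟨_, rfl⟩
  have hvN : Quaternion.normSq v = N := by
    rw [hv, Quaternion.normSq_def', hN]; simp
  have hconj : star u * v * u = (p : ℤ) • (m • v) := by
    rw [← mul_smul, ← hm, hN, hu, hv]
    ext <;> simp only [Quaternion.re_mul, Quaternion.imI_mul, Quaternion.imJ_mul,
      Quaternion.imK_mul, Quaternion.re_star, Quaternion.imI_star, Quaternion.imJ_star,
      Quaternion.imK_star, Quaternion.re_smul, Quaternion.imI_smul, Quaternion.imJ_smul,
      Quaternion.imK_smul, re_intQuaternion, imI_intQuaternion, imJ_intQuaternion,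
      imK_intQuaternion, smul_eq_mul] <;> ring
  obtain ⟨y, t, huy, hy⟩ := exists_normSq_lt hp0 (by exact_mod_cast hpodd) u
  have hyu : y = u - (p : ℤ) • t := by rw [huy, add_sub_cancel_right]
  have hyconj : star y * v * y
      = (p : ℤ) • (m • v - star t * v * u - star u * v * t + (p : ℤ) • (star t * v * t)) := by
    rw [hyu]
    simp only [star_sub, star_smul, star_trivial (p : ℤ), sub_mul, mul_sub, smul_sub, smul_add,
      smul_mul_assoc, mul_smul_comm, hconj]
    abel
  obtain ⟨n, hn⟩ : (p : ℤ) ∣ Quaternion.normSq y := by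
    have h1 : Quaternion.normSq u = p * m := by
      rw [← hm, hN, hu, Quaternion.normSq_def']; simp; ring
    have h2 : Quaternion.normSq y
        = Quaternion.normSq u + p * (p * Quaternion.normSq t - 2 * (u * star t).re) := by
      rw [hyu, sub_eq_add_neg, Quaternion.normSq_add, Quaternion.normSq_neg,
        Quaternion.normSq_smul, star_neg, star_smul, star_trivial (p : ℤ), mul_neg,
        mul_smul_comm, Quaternion.re_neg, Quaternion.re_smul, smul_eq_mul]
      ring
    rw [h2, h1, ← mul_add]
    exact dvd_mul_right _ _
  have hy0 : 0 < Quaternion.normSq y := by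
    refine lt_of_le_of_ne Quaternion.normSq_nonneg fun h => hpN ?_
    rw [Quaternion.normSq_eq_zero.1 h.symm, zero_add] at huy
    have hI := congrArg (fun q : ℍ[ℤ] => q.imI) huy
    have hJ := congrArg (fun q : ℍ[ℤ] => q.imJ) huy
    have hK := congrArg (fun q : ℍ[ℤ] => q.imK) huy
    simp only [hu, Quaternion.imI_smul, Quaternion.imJ_smul, Quaternion.imK_smul,
      imI_intQuaternion, imJ_intQuaternion, imK_intQuaternion, smul_eq_mul] at hI hJ hK
    rw [hN, hI, hJ, hK]
    exact ⟨p * (t.imI ^ 2 + t.imJ ^ 2 + t.imK ^ 2), by ring⟩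
  have hn0 : 0 < n := by
    rw [hn] at hy0
    exact pos_of_mul_pos_right hy0 hp0.le
  have hnp : n < p := by
    rw [hn, sq] at hy
    exact lt_of_mul_lt_mul_left hy hp0.le
  lift n to ℕ using hn0.le
  obtain ⟨w, z, hw, hz⟩ := exists_normSq_eq_prime_conj hp v n (by omega) (by omega) y _
    (by rw [hn, mul_comm]) hyconj
  obtain ⟨hz0, hz4⟩ := four_dvd_imJ_of_conj hp4 (by rw [hv]; rfl) (by rw [hv]; exact ha)
    (by rw [hv]; exact hb) (by rw [hv]; exact hc) hw hz
  refine ⟨z.imI, z.imJ, z.imK, ?_, hz4⟩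
  have h1 := congrArg Quaternion.normSq hz
  rw [map_mul, map_mul, Quaternion.normSq_star, hw, hvN, Quaternion.normSq_smul] at h1
  have h2 : (N : ℤ) = Quaternion.normSq z := by
    apply mul_left_cancel₀ (pow_ne_zero 2 hp0.ne')
    linarith
  rw [h2, Quaternion.normSq_def', hz0]
  ring

theorem exists_jacobiSym_eq_neg_one {M : ℕ} (hM : Squarefree M) (hodd : Odd M) (h1 : M ≠ 1) :
    ∃ a : ℕ, a.Coprime M ∧ J(a | M) = -1 := by
  obtain ⟨l, hl, m, rfl⟩ := Nat.exists_prime_and_dvd h1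
  have := Fact.mk hl
  have hcop : l.Coprime m := (Nat.squarefree_mul_iff.1 hM).1
  have hm0 : m ≠ 0 := by rintro rfl; simp at hodd
  have hl2 : ringChar (ZMod l) ≠ 2 := by
    rw [ZMod.ringChar_zmod_n]
    rintro rfl
    exact Nat.not_even_iff_odd.2 hodd (even_two.mul_right m)
  obtain ⟨g, hg⟩ := FiniteField.exists_nonsquare hl2
  obtain ⟨a, hal, ham⟩ := Nat.chineseRemainder hcop g.val 1
  have hJl : J(a | l) = -1 := by
    rw [ZMod.nonsquare_iff_jacobiSym_eq_neg_one]
    have h2 : ((a : ℤ) : ZMod l) = g := by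
      rw [Int.cast_natCast, (ZMod.natCast_eq_natCast_iff a g.val l).2 hal, ZMod.natCast_zmod_val]
    rwa [h2]
  have hJm : J(a | m) = 1 := by
    rw [jacobiSym.mod_left' (a₂ := 1), jacobiSym.one_left]
    exact_mod_cast ham
  have hJ : J(a | l * m) = -1 := by
    rw [jacobiSym.mul_right' _ hl.ne_zero hm0, hJl, hJm]; norm_num
  refine ⟨a, ?_, hJ⟩
  by_contra h
  have h0 : J(a | l * m) = 0 := jacobiSym.eq_zero_iff.2 ⟨mul_ne_zero hl.ne_zero hm0, h⟩
  omega

theorem exists_prime_jacobiSym_neg_eq_one {M : ℕ} (hM : Squarefree M) (hM4 : M % 4 = 1)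
    (h1 : M ≠ 1) : ∃ p : ℕ, p.Prime ∧ p % 4 = 3 ∧ J(-(M : ℤ) | p) = 1 := by
  have hodd : Odd M := Nat.odd_iff.2 (by omega)
  obtain ⟨a, ha, hJ⟩ := exists_jacobiSym_eq_neg_one hM hodd h1
  have hcop : M.Coprime 4 := (Nat.coprime_two_right.2 hodd).pow_right 2
  obtain ⟨b, hbM, hb4⟩ := Nat.chineseRemainder hcop a 3
  have hb : b.Coprime (M * 4) := by
    apply Nat.Coprime.mul_right
    · exact hbM.gcd_eq.trans ha
    · exact hb4.gcd_eq
  obtain ⟨p, -, hp, hpb⟩ := Nat.forall_exists_prime_gt_and_modEq 0 (by omega) hb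
  have hp4 : p % 4 = 3 := (hpb.of_mul_left M).trans hb4
  have hpM : p ≡ a [MOD M] := (hpb.of_mul_right 4).trans hbM
  have hpodd : Odd p := Nat.odd_iff.2 (by omega)
  refine ⟨p, hp, hp4, ?_⟩
  have h2 : J(p | M) = -1 := by
    rw [← hJ]
    apply jacobiSym.mod_left'
    exact_mod_cast hpM
  rw [jacobiSym.neg _ hpodd, ZMod.χ₄_nat_three_mod_four hp4,
    jacobiSym.quadratic_reciprocity_one_mod_four hM4 hpodd, h2]
  norm_num

theorem Int.emod_four_and_sq_emod_eight (k : ℤ) :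
    (k % 2 = 1 ∧ k ^ 2 % 8 = 1) ∨ (k % 4 = 0 ∧ k ^ 2 % 8 = 0) ∨ (k % 4 = 2 ∧ k ^ 2 % 8 = 4) := by
  rw [sq, Int.mul_emod]
  have h1 := Int.emod_nonneg k (show (8 : ℤ) ≠ 0 by norm_num)
  have h2 := Int.emod_lt_of_pos k (show (0 : ℤ) < 8 by norm_num)
  generalize h : k % 8 = r at *
  interval_cases r <;> omega

theorem exists_sq_add_sq_add_four_mul_sq_of_squarefree {M : ℕ} (hM : Squarefree M)
    (hM4 : M % 4 = 1) : ∃ a b c : ℤ, (M : ℤ) = a ^ 2 + b ^ 2 + c ^ 2 ∧ 4 ∣ b := by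
  rcases eq_or_ne M 1 with rfl | h1
  · exact ⟨1, 0, 0, by norm_num, dvd_zero 4⟩
  obtain ⟨p, hp, hp4, hJ⟩ := exists_prime_jacobiSym_neg_eq_one hM hM4 h1
  obtain ⟨a, b, c, h⟩ := exists_sum_three_squares hM4
  by_cases ha : 4 ∣ a
  · exact ⟨b, a, c, by linarith, ha⟩
  by_cases hb : 4 ∣ b
  · exact ⟨a, b, c, h, hb⟩
  by_cases hc : 4 ∣ c
  · exact ⟨a, c, b, by linarith, hc⟩
  have ha' := Int.emod_four_and_sq_emod_eight a
  have hb' := Int.emod_four_and_sq_emod_eight b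
  have hc' := Int.emod_four_and_sq_emod_eight c
  rcases (by omega : (a % 2 = 1 ∧ b % 4 = 2 ∧ c % 2 = 0) ∨ (b % 2 = 1 ∧ a % 4 = 2 ∧ c % 2 = 0) ∨
    (c % 2 = 1 ∧ a % 4 = 2 ∧ b % 2 = 0)) with ⟨h2, h3, h4⟩ | ⟨h2, h3, h4⟩ | ⟨h2, h3, h4⟩
  · exact exists_three_squares_four_dvd hp hp4 hJ h (Int.odd_iff.2 h2) h3 (Int.even_iff.2 h4)
  · exact exists_three_squares_four_dvd hp hp4 hJ (h.trans (by ring)) (Int.odd_iff.2 h2) h3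
      (Int.even_iff.2 h4)
  · exact exists_three_squares_four_dvd hp hp4 hJ (h.trans (by ring)) (Int.odd_iff.2 h2) h3
      (Int.even_iff.2 h4)

theorem exists_sq_add_sq_add_four_mul_sq {N : ℕ} (hN : N % 4 = 1) :
    ∃ a b c : ℕ, N = a ^ 2 + b ^ 2 + (4 * c) ^ 2 := by
  obtain ⟨M, s, hsM, hM⟩ := Nat.sq_mul_squarefree N
  have hs : s % 2 = 1 := by
    by_contra h
    obtain ⟨k, rfl⟩ : Even s := Nat.even_iff.2 (by omega)
    have : N = 4 * (k ^ 2 * M) := by rw [← hsM]; ring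
    omega
  have hM4 : M % 4 = 1 := by
    obtain ⟨k, rfl⟩ := Nat.odd_iff.2 hs
    have : N = M + 4 * ((k ^ 2 + k) * M) := by rw [← hsM]; ring
    omega
  obtain ⟨a, b, c, h, d, rfl⟩ := exists_sq_add_sq_add_four_mul_sq_of_squarefree hM hM4
  refine ⟨s * a.natAbs, s * c.natAbs, s * d.natAbs, ?_⟩
  rw [← hsM]
  zify
  simp only [mul_pow, sq_abs]
  rw [h]
  ring

theorem eight_mul_triangular_add_one (k : ℕ) : 8 * triangular k + 1 = (2 * k + 1) ^ 2 := by
  have h := Nat.div_mul_cancel (Nat.even_mul_succ_self k).two_dvd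
  unfold triangular
  linarith

theorem exists_triangular_add_triangular {n a b : ℕ} (hab : b < a)
    (h : 4 * n + 1 = a ^ 2 + b ^ 2) :
    ∃ y z : ℕ, n = triangular y + triangular z := by
  obtain ⟨d, rfl⟩ := Nat.exists_eq_add_of_lt hab
  have hd : Even d := by
    have h1 : Odd (4 * n + 1) := ⟨2 * n, by ring⟩
    rw [h, ← Nat.not_even_iff_odd] at h1
    simp only [Nat.even_add, Nat.even_pow, Nat.not_even_one] at h1
    tauto
  obtain ⟨z, rfl⟩ := hd
  have hy := eight_mul_triangular_add_one (b + z)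
  have hz := eight_mul_triangular_add_one z
  exact ⟨b + z, z, by linarith⟩

/-- Every natural number is a sum of an even square and two triangular numbers. -/
theorem sum_even_square_add_two_triangular (n : ℕ) :
    ∃ x y z : ℕ, n = (2 * x) ^ 2 + triangular y + triangular z := by
  obtain ⟨a, b, c, h⟩ := exists_sq_add_sq_add_four_mul_sq (N := 4 * n + 1) (by omega)
  obtain ⟨k, hk⟩ : ∃ k, n = (2 * c) ^ 2 + k := Nat.exists_eq_add_of_le (by
    have : (4 * c) ^ 2 = 4 * (2 * c) ^ 2 := by ring
    omega)
  have hab : 4 * k + 1 = a ^ 2 + b ^ 2 := by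
    rw [hk] at h; linarith
  have hne : a ≠ b := by rintro rfl; omega
  obtain ⟨y, z, hyz⟩ : ∃ y z : ℕ, k = triangular y + triangular z := by
    rcases lt_or_gt_of_ne hne with hlt | hlt
    · exact exists_triangular_add_triangular hlt (hab.trans (add_comm _ _))
    · exact exists_triangular_add_triangular hlt hab
  exact ⟨c, y, z, by rw [hk, hyz, add_assoc]⟩
end

section
/- Every positive integer n can be written as n = t_z + x² + y² for some natural number z and integers x, y such that either x ≢ y (mod 2), or x = y > 0. -/
open scoped NumberTheorySymbols Quaternion

theorem exists_dvd_sq_sub_of_jacobiSym_eq_one {p : ℕ} (hp : p.Prime) {a : ℤ} (h : J(a | p) = 1) :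
    ∃ r : ℤ, (p : ℤ) ∣ r ^ 2 - a := by
  have := Fact.mk hp
  rw [← jacobiSym.legendreSym.to_jacobiSym] at h
  have ha : (a : ZMod p) ≠ 0 := fun h0 => by
    rw [(legendreSym.eq_zero_iff p a).mpr h0] at h
    exact zero_ne_one h
  obtain ⟨s, hs⟩ := (legendreSym.eq_one_iff p ha).mp h
  obtain ⟨r, rfl⟩ := ZMod.intCast_surjective s
  refine ⟨r, (ZMod.intCast_zmod_eq_zero_iff_dvd _ p).mp ?_⟩
  push_cast
  rw [hs]
  ring

theorem Nat.Coprime.four_left_of_odd {m : ℕ} (h : Odd m) : Nat.Coprime 4 m :=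
  (Nat.coprime_pow_left_iff (n := 2) (by norm_num) 2 _).mpr (Nat.coprime_two_left.mpr h)

theorem exists_prime_one_mod_four_legendre {N : ℕ} (hN : N % 8 = 1) :
    ∃ p : ℕ, p.Prime ∧ N < p ∧ p % 4 = 1 ∧ (N : ℤ) ∣ p + 1 ∧ ∃ r : ℤ, (p : ℤ) ∣ r ^ 2 - N := by
  have hodd : Odd N := Nat.odd_iff.mpr (by omega)
  obtain ⟨c, hc4, hcN⟩ := Nat.chineseRemainder (Nat.Coprime.four_left_of_odd hodd) 1 (N - 1)
  have hcop : c.Coprime (4 * N) := by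
    refine Nat.Coprime.mul_right ?_ ?_
    · rw [Nat.Coprime, hc4.gcd_eq]; norm_num
    · rw [Nat.Coprime, hcN.gcd_eq]
      exact (Nat.coprime_self_sub_left (by omega)).mpr (Nat.coprime_one_left N)
  obtain ⟨p, hpN, hp, hpc⟩ := Nat.forall_exists_prime_gt_and_modEq N (by omega) hcop
  have hp4 : p % 4 = 1 := (hpc.of_mul_right N).trans hc4
  have hpN1 : p ≡ N - 1 [MOD N] := (hpc.of_mul_left 4).trans hcN
  have hdvd : (N : ℤ) ∣ p + 1 := by
    have := (Nat.modEq_iff_dvd.mp hpN1)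
    rw [Nat.cast_sub (by omega)] at this
    obtain ⟨k, hk⟩ := this
    exact ⟨1 - k, by push_cast at hk; linear_combination -hk⟩
  refine ⟨p, hp, hpN, hp4, hdvd, exists_dvd_sq_sub_of_jacobiSym_eq_one hp ?_⟩
  rw [jacobiSym.quadratic_reciprocity_one_mod_four' hodd hp4,
    jacobiSym.mod_left' (a₂ := -1), jacobiSym.at_neg_one hodd,
    ZMod.χ₄_nat_one_mod_four (by omega)]
  exact Int.emod_eq_emod_iff_emod_sub_eq_zero.mpr (Int.emod_eq_zero_of_dvd (by simpa using hdvd))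

theorem exists_prime_three_mod_four_legendre {N : ℕ} (hN : N % 8 = 1) (hsq : ¬ IsSquare N) :
    ∃ p : ℕ, p.Prime ∧ N < p ∧ p % 4 = 3 ∧ ∃ r : ℤ, (p : ℤ) ∣ r ^ 2 + N := by
  obtain ⟨a, b, hab, hsf⟩ := Nat.sq_mul_squarefree N
  have ha1 : a ≠ 1 := by
    rintro rfl
    exact hsq ⟨b, by rw [← hab]; ring⟩
  have hodd : Odd N := Nat.odd_iff.mpr (by omega)
  have haodd : Odd a := Odd.of_dvd_nat hodd (hab ▸ dvd_mul_left a _)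
  obtain ⟨q, hq, M, rfl⟩ := Nat.exists_prime_and_dvd ha1
  have := Fact.mk hq
  have hqM : q.Coprime M := Nat.coprime_of_squarefree_mul hsf
  have hqodd : Odd q := Odd.of_dvd_nat haodd (dvd_mul_right _ _)
  have hModd : Odd M := Odd.of_dvd_nat haodd (dvd_mul_left _ _)
  obtain ⟨u, hu⟩ := FiniteField.exists_nonsquare (F := ZMod q)
    (by rw [ZMod.ringChar_zmod_n]; rintro rfl; exact absurd hqodd (by decide))
  obtain ⟨e, he4, heM⟩ := Nat.chineseRemainder (Nat.Coprime.four_left_of_odd hModd) 3 1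
  obtain ⟨c, hcq, hc4M⟩ := Nat.chineseRemainder
    (Nat.Coprime.mul_right (Nat.Coprime.four_left_of_odd hqodd).symm hqM) u.val e
  have hc4 : c ≡ 3 [MOD 4] := (hc4M.of_mul_right M).trans he4
  have hcM : c ≡ 1 [MOD M] := (hc4M.of_mul_left 4).trans heM
  have hcu : (c : ZMod q) = u := by
    rw [(ZMod.natCast_eq_natCast_iff _ _ _).mpr hcq, ZMod.natCast_zmod_val]
  have hcop : c.Coprime (q * (4 * M)) := by
    refine Nat.Coprime.mul_right ?_ (Nat.Coprime.mul_right ?_ ?_)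
    · rw [← ZMod.isUnit_iff_coprime, hcu, isUnit_iff_ne_zero]
      rintro rfl
      exact hu (IsSquare.zero)
    · rw [Nat.Coprime, hc4.gcd_eq]; norm_num
    · rw [Nat.Coprime, hcM.gcd_eq]; norm_num
  obtain ⟨p, hpN, hp, hpc⟩ := Nat.forall_exists_prime_gt_and_modEq N
    (by have := hq.pos; have := hModd.pos; positivity) hcop
  have hpq : (p : ZMod q) = u := by
    rw [← hcu]; exact (ZMod.natCast_eq_natCast_iff _ _ _).mpr (hpc.of_mul_right _)
  have hp4 : p % 4 = 3 := ((hpc.of_mul_left q).of_mul_right M).trans hc4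
  have hpM : p ≡ 1 [MOD M] := ((hpc.of_mul_left q).of_mul_left 4).trans hcM
  have hpodd : Odd p := Nat.odd_iff.mpr (by omega)
  have hb0 : b ≠ 0 := by rintro rfl; omega
  have hpb : p.Coprime b := by
    have h := Nat.coprime_of_lt_prime (by omega) hpN hp
    rw [← hab] at h
    exact (h.coprime_mul_right_right).coprime_dvd_right (dvd_pow_self b two_ne_zero)
  have hJq : J((p : ℤ) | q) = -1 := by
    rw [← jacobiSym.legendreSym.to_jacobiSym, legendreSym.eq_neg_one_iff]
    simpa [hpq] using hu
  have hJM : J((p : ℤ) | M) = 1 := by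
    rw [jacobiSym.mod_left' (a₂ := 1), jacobiSym.one_left]
    exact_mod_cast hpM
  have hJN : J((p : ℤ) | N) = -1 := by
    have hM0 : M ≠ 0 := hModd.pos.ne'
    rw [← hab, jacobiSym.mul_right' _ (pow_ne_zero 2 hb0) (mul_ne_zero hq.ne_zero hM0),
      jacobiSym.mul_right' _ hq.ne_zero hM0, jacobiSym.pow_right, hJq, hJM,
      jacobiSym.sq_one (by simpa using hpb)]
    norm_num
  have hJ : J(-(N : ℤ) | p) = 1 := by
    rw [jacobiSym.neg _ hpodd, ZMod.χ₄_nat_three_mod_four hp4,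
      jacobiSym.quadratic_reciprocity_one_mod_four (by omega) hpodd, hJN]
    norm_num
  obtain ⟨r, hr⟩ := exists_dvd_sq_sub_of_jacobiSym_eq_one hp hJ
  exact ⟨p, hp, hpN, hp4, r, by simpa using hr⟩

theorem exists_round (x : ℤ) {t : ℤ} (ht : 0 < t) : ∃ a : ℤ, 4 * (a * t - x) ^ 2 ≤ t ^ 2 := by
  refine ⟨(2 * x + t) / (2 * t), ?_⟩
  have h1 := Int.emod_add_mul_ediv (2 * x + t) (2 * t)
  have h2 := Int.emod_nonneg (2 * x + t) (b := 2 * t) (by omega)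
  have h3 := Int.emod_lt_of_pos (2 * x + t) (b := 2 * t) (by omega)
  generalize (2 * x + t) / (2 * t) = a at *
  nlinarith

/-- The Davenport–Cassels descent: a sum of three rational squares that is an integer is a sum of
three integer squares. -/
theorem exists_sum_three_sq_of_mul_sq {N : ℤ} (t : ℕ) (ht : 0 < t) (X Y Z : ℤ)
    (h : X ^ 2 + Y ^ 2 + Z ^ 2 = N * (t : ℤ) ^ 2) :
    ∃ x y z : ℤ, x ^ 2 + y ^ 2 + z ^ 2 = N := by
  induction t using Nat.strong_induction_on generalizing X Y Z with
  | _ t ih =>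
  have ht' : (0 : ℤ) < t := by exact_mod_cast ht
  obtain ⟨a, ha⟩ := exists_round X ht'
  obtain ⟨b, hb⟩ := exists_round Y ht'
  obtain ⟨c, hc⟩ := exists_round Z ht'
  obtain ⟨A, hA⟩ : ∃ A, A = a ^ 2 + b ^ 2 + c ^ 2 - N := ⟨_, rfl⟩
  obtain ⟨B, hB⟩ : ∃ B, B = 2 * (N * t - (a * X + b * Y + c * Z)) := ⟨_, rfl⟩
  have key : t * (A * t + B) = (a * t - X) ^ 2 + (b * t - Y) ^ 2 + (c * t - Z) ^ 2 := by
    rw [hA, hB]; linear_combination -h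
  have hnn : 0 ≤ A * t + B := by
    refine nonneg_of_mul_nonneg_right ?_ ht'
    rw [key]; positivity
  have hlt : A * t + B < t := by
    refine lt_of_mul_lt_mul_left ?_ ht'.le
    rw [key]; nlinarith
  obtain ⟨s, hs⟩ := Int.eq_ofNat_of_zero_le hnn
  rcases Nat.eq_zero_or_pos s with rfl | hs0
  · rw [hs] at key
    have e1 : a * t - X = 0 := by
      refine pow_eq_zero_iff (two_ne_zero) |>.mp (le_antisymm ?_ (sq_nonneg _))
      push_cast at key; nlinarith [sq_nonneg (b * t - Y), sq_nonneg (c * t - Z)]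
    have e2 : b * t - Y = 0 := by
      refine pow_eq_zero_iff (two_ne_zero) |>.mp (le_antisymm ?_ (sq_nonneg _))
      push_cast at key; nlinarith [sq_nonneg (a * t - X), sq_nonneg (c * t - Z)]
    have e3 : c * t - Z = 0 := by
      refine pow_eq_zero_iff (two_ne_zero) |>.mp (le_antisymm ?_ (sq_nonneg _))
      push_cast at key; nlinarith [sq_nonneg (b * t - Y), sq_nonneg (a * t - X)]
    refine ⟨a, b, c, mul_right_cancel₀ (pow_ne_zero 2 ht'.ne') (h ▸ ?_)⟩
    rw [← sub_eq_zero.mp e1, ← sub_eq_zero.mp e2, ← sub_eq_zero.mp e3]; ring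
  · refine ih s (by rw [hs] at hlt; exact_mod_cast hlt) hs0
      (A * X + B * a) (A * Y + B * b) (A * Z + B * c) ?_
    have hs' : (s : ℤ) = A * t + B := hs.symm
    rw [hs']
    have hB' : 2 * (a * X + b * Y + c * Z) = 2 * N * t - B := by rw [hB]; ring
    have hA' : a ^ 2 + b ^ 2 + c ^ 2 = A + N := by rw [hA]; ring
    linear_combination A ^ 2 * h + A * B * hB' + B ^ 2 * hA'

theorem exists_small_solution {N p : ℕ} (hN : 0 < N) (hp : 0 < p) (r : ℤ) :
    ∃ z s t : ℤ, (z ≠ 0 ∨ s ≠ 0 ∨ t ≠ 0) ∧ z ^ 2 ≤ N * p ∧ s ^ 2 ≤ N ∧ t ^ 2 ≤ p ∧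
      (N : ℤ) ∣ z - s ∧ (p : ℤ) ∣ z - r * t := by
  have : NeZero N := ⟨hN.ne'⟩
  have : NeZero p := ⟨hp.ne'⟩
  let S := Finset.range (Nat.sqrt (N * p) + 1) ×ˢ Finset.range (Nat.sqrt N + 1) ×ˢ
    Finset.range (Nat.sqrt p + 1)
  let f : ℕ × ℕ × ℕ → ZMod N × ZMod p := fun v =>
    ((v.1 : ZMod N) - v.2.1, (v.1 : ZMod p) - r * v.2.2)
  have hcard : (Finset.univ : Finset (ZMod N × ZMod p)).card < S.card := by
    simp only [S, Finset.card_univ, Fintype.card_prod, ZMod.card, Finset.card_product,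
      Finset.card_range]
    have h1 := Nat.lt_succ_sqrt' (N * p)
    have h2 := Nat.lt_succ_sqrt' N
    have h3 := Nat.lt_succ_sqrt' p
    refine lt_of_pow_lt_pow_left₀ 2 (by positivity) ?_
    calc (N * p) ^ 2 = (N * p) * (N * p) := sq _
      _ < (Nat.sqrt (N * p) + 1) ^ 2 * ((Nat.sqrt N + 1) ^ 2 * (Nat.sqrt p + 1) ^ 2) :=
        Nat.mul_lt_mul'' h1 (Nat.mul_lt_mul'' h2 h3)
      _ = _ := by ring
  obtain ⟨⟨z, s, t⟩, hv, ⟨z', s', t'⟩, hv', hne, heq⟩ :=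
    Finset.exists_ne_map_eq_of_card_lt_of_maps_to (f := f) hcard (fun _ _ => Finset.mem_univ _)
  simp only [S, Finset.mem_product, Finset.mem_range, Nat.lt_succ_iff] at hv hv'
  have bound : ∀ {n a b : ℕ}, a ≤ Nat.sqrt n → b ≤ Nat.sqrt n → ((a : ℤ) - b) ^ 2 ≤ n := by
    intro n a b ha hb
    have h : (n.sqrt : ℤ) ^ 2 ≤ n := by exact_mod_cast Nat.sqrt_le' n
    refine le_trans (sq_le_sq.mpr ?_) h
    rw [abs_le, abs_of_nonneg (by positivity)]
    omega
  simp only [f, Prod.mk.injEq] at heq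
  refine ⟨z - z', s - s', t - t', ?_, by exact_mod_cast bound hv.1 hv'.1, bound hv.2.1 hv'.2.1,
    bound hv.2.2 hv'.2.2, ?_, ?_⟩
  · by_contra! h
    apply hne
    simp only [Prod.mk.injEq]
    omega
  · rw [← ZMod.intCast_zmod_eq_zero_iff_dvd]
    push_cast
    linear_combination heq.1
  · rw [← ZMod.intCast_zmod_eq_zero_iff_dvd]
    push_cast
    linear_combination heq.2

theorem exists_conic_solution {N p : ℕ} (hN : 0 < N) (hp : p.Prime) (hNp : N < p)
    (h1 : (N : ℤ) ∣ p + 1) {r : ℤ} (hr : (p : ℤ) ∣ r ^ 2 - N) :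
    ∃ z s t : ℤ, t ≠ 0 ∧ N * t ^ 2 = z ^ 2 + p * s ^ 2 := by
  obtain ⟨z, s, t, hne, hz, hs, ht, hdN, hdp⟩ := exists_small_solution hN hp.pos r
  have hN' : (0 : ℤ) < N := by exact_mod_cast hN
  have hp' : (0 : ℤ) < p := by exact_mod_cast hp.pos
  have hpp := Nat.prime_iff_prime_int.mp hp
  have hdvd : (N * p : ℤ) ∣ z ^ 2 + p * s ^ 2 - N * t ^ 2 := by
    refine IsCoprime.mul_dvd ?_ ?_ ?_
    · exact_mod_cast (Nat.coprime_of_lt_prime hN.ne' hNp hp).symm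
    · obtain ⟨k, hk⟩ := hdN
      obtain ⟨l, hl⟩ := h1
      exact ⟨k * (z + s) + l * s ^ 2 - t ^ 2, by linear_combination (z + s) * hk + s ^ 2 * hl⟩
    · obtain ⟨k, hk⟩ := hdp
      obtain ⟨l, hl⟩ := hr
      exact ⟨k * (z + r * t) + s ^ 2 + l * t ^ 2,
        by linear_combination (z + r * t) * hk + t ^ 2 * hl⟩
  have ht_lt : t ^ 2 < p := lt_of_le_of_ne ht fun h => by
    exact hpp.irreducible.not_isSquare ⟨t, by rw [← h]; ring⟩
  have hz_lt : z ^ 2 < N * p := lt_of_le_of_ne hz fun h => by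
    have h2 : (p : ℤ) ∣ z := hpp.dvd_of_dvd_pow (h ▸ dvd_mul_left _ _)
    obtain ⟨k, rfl⟩ := h2
    have : (N : ℤ) = p * k ^ 2 := mul_right_cancel₀ hp'.ne' (by linear_combination -h)
    have h3 : (p : ℤ) ∣ N := ⟨_, this⟩
    exact absurd (Nat.le_of_dvd hN (by exact_mod_cast h3)) (by omega)
  obtain ⟨k, hk⟩ := hdvd
  have hkl : -1 < k := by
    refine lt_of_mul_lt_mul_left (a := (N * p : ℤ)) ?_ (by positivity)
    rw [← hk]; nlinarith [sq_nonneg z, sq_nonneg s]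
  have hku : k < 2 := by
    refine lt_of_mul_lt_mul_left (a := (N * p : ℤ)) ?_ (by positivity)
    rw [← hk]; nlinarith [sq_nonneg t]
  obtain rfl | rfl : k = 0 ∨ k = 1 := by omega
  · refine ⟨z, s, t, ?_, by linear_combination -hk⟩
    rintro rfl
    have hz0 : z = 0 := by
      have : z ^ 2 ≤ 0 := by nlinarith [mul_nonneg hp'.le (sq_nonneg s)]
      exact pow_eq_zero_iff two_ne_zero |>.mp (le_antisymm this (sq_nonneg z))
    subst hz0
    have hs0 : s = 0 := by
      have : p * s ^ 2 = 0 := by linear_combination hk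
      simpa [hp.ne_zero] using this
    simp_all
  · refine ⟨z * t - p * s, z + s * t, t ^ 2 + p, by positivity, ?_⟩
    linear_combination -(t ^ 2 + p) * hk

theorem exists_quaternion_components (a b c d : ℤ) :
    ∃ q : ℍ[ℤ], q.re = a ∧ q.imI = b ∧ q.imJ = c ∧ q.imK = d :=
  ⟨⟨a, b, c, d⟩, rfl, rfl, rfl, rfl⟩

theorem exists_normSq_sub_smul_lt {m : ℕ} (hm : Odd m) (q : ℍ[ℤ]) :
    ∃ d : ℍ[ℤ], Quaternion.normSq (q - (m : ℤ) • d) < (m : ℤ) ^ 2 := by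
  have key : ∀ x : ℤ, ∃ a : ℤ, 4 * (a * m - x) ^ 2 < (m : ℤ) ^ 2 := by
    intro x
    obtain ⟨a, ha⟩ := exists_round x (t := m) (by exact_mod_cast hm.pos)
    refine ⟨a, lt_of_le_of_ne ha fun h => ?_⟩
    have hodd : Odd ((m : ℤ) ^ 2) := (by exact_mod_cast hm : Odd (m : ℤ)).pow
    rw [← h, Int.odd_iff] at hodd
    omega
  obtain ⟨a, ha⟩ := key q.re
  obtain ⟨b, hb⟩ := key q.imI
  obtain ⟨c, hc⟩ := key q.imJ
  obtain ⟨d, hd⟩ := key q.imK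
  obtain ⟨δ, rfl, rfl, rfl, rfl⟩ := exists_quaternion_components a b c d
  refine ⟨δ, ?_⟩
  simp only [Quaternion.normSq_def', Quaternion.re_sub, Quaternion.imI_sub, Quaternion.imJ_sub,
    Quaternion.imK_sub, Quaternion.re_smul, Quaternion.imI_smul, Quaternion.imJ_smul,
    Quaternion.imK_smul, smul_eq_mul]
  linarith

theorem exists_mul_eq_two_smul_of_even {q : ℍ[ℤ]} (h : Even (Quaternion.normSq q)) :
    ∃ u d : ℍ[ℤ], Quaternion.normSq u = 2 ∧ q * u = (2 : ℤ) • d := by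
  simp only [Quaternion.normSq_def'] at h
  have h' : (q.re + q.imI + q.imJ + q.imK) % 2 = 0 := by
    have : Even (q.re + q.imI + q.imJ + q.imK) := by
      simpa [Int.even_add, Int.even_pow] using h
    exact Int.even_iff.mp this
  have key : ∀ u : ℍ[ℤ], Quaternion.normSq u = 2 → 2 ∣ (q * u).re → 2 ∣ (q * u).imI →
      2 ∣ (q * u).imJ → 2 ∣ (q * u).imK →
      ∃ u d : ℍ[ℤ], Quaternion.normSq u = 2 ∧ q * u = (2 : ℤ) • d := by
    rintro u hu ⟨a, ha⟩ ⟨b, hb⟩ ⟨c, hc⟩ ⟨d, hd⟩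
    obtain ⟨δ, rfl, rfl, rfl, rfl⟩ := exists_quaternion_components a b c d
    exact ⟨u, δ, hu, by ext <;> assumption⟩
  have hcase : ((q.re + q.imI) % 2 = 0 ∧ (q.imJ + q.imK) % 2 = 0) ∨
      ((q.re + q.imJ) % 2 = 0 ∧ (q.imI + q.imK) % 2 = 0) ∨
      ((q.re + q.imK) % 2 = 0 ∧ (q.imI + q.imJ) % 2 = 0) := by omega
  rcases hcase with h | h | h
  · obtain ⟨u, h0, h1, h2, h3⟩ := exists_quaternion_components 1 1 0 0
    apply key u <;> simp [Quaternion.normSq_def', h0, h1, h2, h3] <;> omega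
  · obtain ⟨u, h0, h1, h2, h3⟩ := exists_quaternion_components 1 0 1 0
    apply key u <;> simp [Quaternion.normSq_def', h0, h1, h2, h3] <;> omega
  · obtain ⟨u, h0, h1, h2, h3⟩ := exists_quaternion_components 1 0 0 1
    apply key u <;> simp [Quaternion.normSq_def', h0, h1, h2, h3] <;> omega

theorem exists_eq_smul_of_coprime {m p : ℤ} (h : IsCoprime m p) {x g : ℍ[ℤ]}
    (hx : m • x = p • g) : ∃ g', x = p • g' := by
  obtain ⟨a, b, hab⟩ := h
  refine ⟨a • g + b • x, ?_⟩
  calc x = (a * m + b * p) • x := by rw [hab, one_smul]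
    _ = a • (m • x) + (b * p) • x := by rw [add_smul, mul_smul]
    _ = _ := by rw [hx]; module

/-- If the product `α * β` is divisible by `m`, the quotient is again annihilated by `w` mod `p`. -/
theorem exists_quotient {p m : ℕ} (hp : p.Prime) (hm0 : 0 < m) (hmp : m < p) {w α β γ δ : ℍ[ℤ]}
    {n : ℤ} (hα : Quaternion.normSq α = n * p) (hw : w * α = (p : ℤ) • γ)
    (hδ : α * β = (m : ℤ) • δ) :
    (m : ℤ) ^ 2 * Quaternion.normSq δ = n * p * Quaternion.normSq β ∧
      ∃ γ', w * δ = (p : ℤ) • γ' := by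
  constructor
  · rw [← Quaternion.normSq_smul, ← hδ, map_mul, hα]
  · refine exists_eq_smul_of_coprime (m := m) (g := γ * β) ?_ ?_
    · exact Nat.isCoprime_iff_coprime.mpr (Nat.coprime_of_lt_prime hm0.ne' hmp hp).symm
    · rw [← mul_smul_comm, ← hδ, ← mul_assoc, hw, smul_mul_assoc]

theorem exists_normSq_eq_prime {p : ℕ} (hp : p.Prime) (w : ℍ[ℤ]) (m : ℕ) (hm0 : 0 < m)
    (hmp : m < p) (α γ : ℍ[ℤ]) (hα : Quaternion.normSq α = m * p) (hw : w * α = (p : ℤ) • γ) :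
    ∃ α γ : ℍ[ℤ], Quaternion.normSq α = p ∧ w * α = (p : ℤ) • γ := by
  induction m using Nat.strong_induction_on generalizing α γ with
  | _ m ih =>
  have hm0' : (0 : ℤ) < m := by exact_mod_cast hm0
  have hp0' : (0 : ℤ) < p := by exact_mod_cast hp.pos
  rcases Nat.even_or_odd' m with ⟨k, rfl | rfl⟩
  · obtain ⟨u, δ, hu, hδ⟩ := exists_mul_eq_two_smul_of_even (q := α)
      (by rw [hα]; push_cast; rw [mul_assoc]; exact even_two_mul _)
    obtain ⟨h1, γ', h2⟩ := exists_quotient hp two_pos (by omega) hα hw hδ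
    refine ih k (by omega) (by omega) (by omega) δ γ' ?_ h2
    rw [hu] at h1
    push_cast at h1
    linarith
  · obtain rfl | hk := Nat.eq_zero_or_pos k
    · exact ⟨α, γ, by simpa using hα, hw⟩
    obtain ⟨d, hd⟩ := exists_normSq_sub_smul_lt (m := 2 * k + 1) ⟨k, rfl⟩ (star α)
    generalize hm : 2 * k + 1 = m at *
    have hmul : α * (star α - (m : ℤ) • d) = (m : ℤ) • ((p : ℤ) • (1 : ℍ[ℤ]) - α * d) := by
      rw [mul_sub, Quaternion.self_mul_star, hα, mul_smul_comm, smul_sub, smul_smul]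
      congr 1
      ext <;> simp
    obtain ⟨h1, γ', h2⟩ := exists_quotient hp hm0 hmp hα hw hmul
    have hdvd : (m : ℤ) ∣ Quaternion.normSq (star α - (m : ℤ) • d) := by
      rw [sub_eq_add_neg, Quaternion.normSq_add, Quaternion.normSq_star, Quaternion.normSq_neg,
        Quaternion.normSq_smul, hα]
      refine ⟨p + m * Quaternion.normSq d - 2 * (star α * star d).re, ?_⟩
      simp only [star_neg, star_smul, mul_neg, Quaternion.re_neg, mul_smul_comm,
        Quaternion.re_smul, smul_eq_mul, star_trivial]
      ring
    obtain ⟨k', hk'⟩ := hdvd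
    have hnn : 0 ≤ k' := by
      refine nonneg_of_mul_nonneg_right ?_ hm0'
      rw [← hk']; exact Quaternion.normSq_nonneg
    have hlt : k' < m := by
      refine lt_of_mul_lt_mul_left ?_ hm0'.le
      rw [← hk', ← sq]; exact hd
    obtain ⟨j, rfl⟩ := Int.eq_ofNat_of_zero_le hnn
    have hnorm : Quaternion.normSq ((p : ℤ) • (1 : ℍ[ℤ]) - α * d) = j * p := by
      refine mul_left_cancel₀ (pow_ne_zero 2 hm0'.ne') ?_
      rw [h1, hk']; ring
    obtain rfl | hj := Nat.eq_zero_or_pos j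
    · exfalso
      have h0 : star α = (m : ℤ) • d := by
        rw [← sub_eq_zero, ← Quaternion.normSq_eq_zero, hk']; simp
      have h3 : (m : ℤ) ^ 2 * Quaternion.normSq d = m * p := by
        rw [← Quaternion.normSq_smul, ← h0, Quaternion.normSq_star, hα]
      have h4 : (m : ℤ) ∣ p := ⟨Quaternion.normSq d, by
        refine mul_left_cancel₀ hm0'.ne' ?_
        linear_combination -h3⟩
      have h5 : m ∣ p := by exact_mod_cast h4
      rcases (Nat.dvd_prime hp).mp h5 with h | h <;> omega
    · exact ih j (by exact_mod_cast hlt) hj (by have : j < m := by exact_mod_cast hlt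
                                                omega) _ γ' hnorm h2

/-- If `-|v|²` is a square modulo the odd prime `p > |v|²`, then some integral quaternion of norm `p`
conjugates the pure quaternion `v` to an integral one. -/
theorem exists_conjugator {p : ℕ} (hp : p.Prime) (hodd : Odd p) (v : ℍ[ℤ]) (hv : v.re = 0)
    (hpos : 0 < Quaternion.normSq v) (hlt : Quaternion.normSq v < p)
    {r : ℤ} (hr : (p : ℤ) ∣ r ^ 2 + Quaternion.normSq v) :
    ∃ α u : ℍ[ℤ], Quaternion.normSq α = p ∧ star α * v * α = (p : ℤ) • u := by
  have hp0' : (0 : ℤ) < p := by exact_mod_cast hp.pos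
  obtain ⟨w, hw⟩ : ∃ w : ℍ[ℤ], w = v - (r : ℍ[ℤ]) := ⟨_, rfl⟩
  have hwn : Quaternion.normSq w = r ^ 2 + Quaternion.normSq v := by
    rw [hw]
    simp [Quaternion.normSq_def', hv]
    ring
  obtain ⟨k, hk⟩ := hr
  obtain ⟨d, hd⟩ := exists_normSq_sub_smul_lt hodd (star w)
  have hwα : w * (star w - (p : ℤ) • d) = (p : ℤ) • (k • 1 - w * d) := by
    rw [mul_sub, Quaternion.self_mul_star, hwn, hk, mul_smul_comm, smul_sub, smul_smul]
    congr 1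
    ext <;> simp
  have hne : star w - (p : ℤ) • d ≠ 0 := by
    intro h0
    have h1 : w = (p : ℤ) • star d := by
      rw [← star_star w, sub_eq_zero.mp h0, star_smul, star_trivial]
    have hI : v.imI = p * (star d).imI := by simpa [hw] using congrArg QuaternionAlgebra.imI h1
    have hJ : v.imJ = p * (star d).imJ := by simpa [hw] using congrArg QuaternionAlgebra.imJ h1
    have hK : v.imK = p * (star d).imK := by simpa [hw] using congrArg QuaternionAlgebra.imK h1
    have h2 : (p : ℤ) ∣ Quaternion.normSq v := by
      rw [Quaternion.normSq_def', hv, hI, hJ, hK]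
      exact ⟨p * ((star d).imI ^ 2 + (star d).imJ ^ 2 + (star d).imK ^ 2), by ring⟩
    exact absurd (Int.le_of_dvd hpos h2) (by omega)
  have hdvd : (p : ℤ) ∣ Quaternion.normSq (star w - (p : ℤ) • d) := by
    rw [sub_eq_add_neg, Quaternion.normSq_add, Quaternion.normSq_star, Quaternion.normSq_neg,
      Quaternion.normSq_smul, hwn, hk]
    refine ⟨k + p * Quaternion.normSq d - 2 * (star w * star d).re, ?_⟩
    simp only [star_neg, star_smul, mul_neg, Quaternion.re_neg, mul_smul_comm,
      Quaternion.re_smul, smul_eq_mul, star_trivial]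
    ring
  obtain ⟨m, hm⟩ := hdvd
  have hmpos : 0 < m := by
    refine pos_of_mul_pos_right ?_ hp0'.le
    rw [← hm]
    exact lt_of_le_of_ne Quaternion.normSq_nonneg (Quaternion.normSq_ne_zero.mpr hne).symm
  have hmlt : m < p := by
    refine lt_of_mul_lt_mul_left ?_ hp0'.le
    rw [← hm, ← sq]; exact hd
  obtain ⟨m, rfl⟩ := Int.eq_ofNat_of_zero_le hmpos.le
  obtain ⟨α, γ, hα, hαw⟩ := exists_normSq_eq_prime hp w m (by exact_mod_cast hmpos)
    (by exact_mod_cast hmlt) _ _ (by rw [hm]; ring) hwα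
  refine ⟨α, star α * γ + (r : ℍ[ℤ]), hα, ?_⟩
  have hv' : v = w + (r : ℍ[ℤ]) := by rw [hw]; simp
  have hcomm : star α * (r : ℍ[ℤ]) * α = (p : ℤ) • (r : ℍ[ℤ]) := by
    rw [mul_assoc, (Int.cast_commute r α).eq, ← mul_assoc, Quaternion.star_mul_self, hα]
    ext <;> simp
  rw [hv', mul_add, add_mul, hcomm, mul_assoc, hαw, mul_smul_comm, smul_add]

theorem odd_cross_terms {a b c d : ℤ} (h : (a ^ 2 + b ^ 2 + c ^ 2 + d ^ 2) % 4 = 3) :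
    Odd (a ^ 2 + b ^ 2 - c ^ 2 - d ^ 2) ∧ Odd (b * c - a * d) ∧ Odd (b * d + a * c) := by
  have e : ∀ x : ℤ, x ^ 2 % 4 = if Even x then 0 else 1 := by
    intro x
    rcases Int.even_or_odd' x with ⟨k, rfl | rfl⟩
    · rw [if_pos (even_two_mul k)]; ring_nf; omega
    · rw [if_neg (by simp [parity_simps])]; ring_nf; omega
  have ha := e a
  have hb := e b
  have hc := e c
  have hd := e d
  by_cases h1 : Even a <;> by_cases h2 : Even b <;> by_cases h3 : Even c <;>
    by_cases h4 : Even d <;> simp only [h1, h2, h3, h4, if_true, if_false] at ha hb hc hd <;>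
    first
    | omega
    | simp [← Int.not_even_iff_odd, h1, h2, h3, h4, parity_simps]

theorem exists_odd_of_four_dvd {p : ℕ} (hp : p.Prime) (hp4 : p % 4 = 3) {N : ℤ} {w a b r : ℤ}
    (hw : Odd w) (hN : w ^ 2 + (4 * a) ^ 2 + (4 * b) ^ 2 = N) (hNp : N < p)
    (hr : (p : ℤ) ∣ r ^ 2 + N) :
    ∃ w h k : ℤ, Odd w ∧ Odd h ∧ Odd k ∧ w ^ 2 + (2 * h) ^ 2 + (2 * k) ^ 2 = N := by
  have hpodd : Odd p := Nat.odd_iff.mpr (by omega)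
  have hpodd' : Odd (p : ℤ) := by exact_mod_cast hpodd
  have hp0 : (p : ℤ) ≠ 0 := by exact_mod_cast hp.ne_zero
  obtain ⟨v, h0, h1, h2, h3⟩ := exists_quaternion_components 0 w (4 * a) (4 * b)
  have hvn : Quaternion.normSq v = N := by
    rw [Quaternion.normSq_def', ← hN, h0, h1, h2, h3]; ring
  have hw0 : w ≠ 0 := by rintro rfl; exact absurd hw (by decide)
  obtain ⟨α, u, hα, hu⟩ := exists_conjugator hp hpodd v h0
    (by rw [hvn, ← hN]; positivity) (by rw [hvn]; exact hNp) (by rw [hvn]; exact hr)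
  have hun : Quaternion.normSq u = N := by
    refine mul_left_cancel₀ (pow_ne_zero 2 hp0) ?_
    rw [← Quaternion.normSq_smul, ← hu, map_mul, map_mul, Quaternion.normSq_star, hα, hvn]
    ring
  rw [Quaternion.normSq_def'] at hun hα
  obtain ⟨o1, o2, o3⟩ := odd_cross_terms (a := α.re) (b := α.imI) (c := α.imJ) (d := α.imK)
    (by omega)
  have e0 := congrArg QuaternionAlgebra.re hu
  have e1 := congrArg QuaternionAlgebra.imI hu
  have e2 := congrArg QuaternionAlgebra.imJ hu
  have e3 := congrArg QuaternionAlgebra.imK hu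
  simp only [Quaternion.re_mul, Quaternion.imI_mul, Quaternion.imJ_mul, Quaternion.imK_mul,
    Quaternion.re_star, Quaternion.imI_star, Quaternion.imJ_star, Quaternion.imK_star,
    Quaternion.re_smul, Quaternion.imI_smul, Quaternion.imJ_smul, Quaternion.imK_smul,
    smul_eq_mul, h0, h1, h2, h3] at e0 e1 e2 e3
  generalize α.re = x, α.imI = y, α.imJ = z, α.imK = t at *
  generalize u.re = u0, u.imI = u1, u.imJ = u2, u.imK = u3 at *
  have hu0 : u0 = 0 := by
    refine (mul_eq_zero.mp (?_ : (p : ℤ) * u0 = 0)).resolve_left hp0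
    rw [← e0]; ring
  have two_dvd : ∀ {c u : ℤ}, p * u = 2 * c → ∃ h, u = 2 * h ∧ p * h = c := by
    intro c u h
    have h2 : (2 : ℤ) ∣ u := by
      have : Even ((p : ℤ) * u) := h ▸ even_two_mul c
      rcases Int.even_mul.mp this with h | h
      · exact absurd h (Int.not_even_iff_odd.mpr hpodd')
      · exact h.two_dvd
    obtain ⟨k, rfl⟩ := h2
    exact ⟨k, rfl, by linarith⟩
  obtain ⟨h, rfl, hh⟩ := two_dvd (c := w * (y * z - x * t) +
    2 * (a * (x ^ 2 - y ^ 2 + z ^ 2 - t ^ 2) + b * (2 * (z * t + x * y)))) (by rw [← e2]; ring)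
  obtain ⟨k, rfl, hk⟩ := two_dvd (c := w * (y * t + x * z) +
    2 * (a * (2 * (z * t - x * y)) + b * (x ^ 2 - y ^ 2 - z ^ 2 + t ^ 2))) (by rw [← e3]; ring)
  have hu1 : p * u1 = w * (x ^ 2 + y ^ 2 - z ^ 2 - t ^ 2) +
    2 * (4 * (a * (y * z + x * t)) + 4 * (b * (y * t - x * z))) := by rw [← e1]; ring
  have odd_of : ∀ {c d u : ℤ}, Odd c → p * u = c + 2 * d → Odd u := by
    intro c d u hc h
    have : Odd ((p : ℤ) * u) := h ▸ hc.add_even (even_two_mul d)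
    exact (Int.odd_mul.mp this).2
  refine ⟨u1, h, k, odd_of (hw.mul o1) hu1, odd_of (hw.mul o2) hh, odd_of (hw.mul o3) hk, ?_⟩
  rw [← hun, hu0]
  ring

theorem exists_sum_three_sq_of_mod_eight {N : ℕ} (hN : N % 8 = 1) :
    ∃ x y z : ℤ, x ^ 2 + y ^ 2 + z ^ 2 = N := by
  obtain ⟨p, hp, hNp, hp4, hdvd, r, hr⟩ := exists_prime_one_mod_four_legendre hN
  obtain ⟨z, s, t, ht, h⟩ := exists_conic_solution (by omega) hp hNp hdvd hr
  have := Fact.mk hp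
  obtain ⟨c, d, hcd⟩ := Nat.Prime.sq_add_sq (p := p) (by omega)
  refine exists_sum_three_sq_of_mul_sq t.natAbs (Int.natAbs_pos.mpr ht) z (c * s) (d * s) ?_
  rw [Int.natCast_natAbs, sq_abs, h, ← hcd]
  push_cast
  ring

theorem exists_odd_and_even_of_sum_three_sq {x y z : ℤ} (h : (x ^ 2 + y ^ 2 + z ^ 2) % 8 = 1) :
    ∃ w a b : ℤ, Odd w ∧ w ^ 2 + (2 * a) ^ 2 + (2 * b) ^ 2 = x ^ 2 + y ^ 2 + z ^ 2 := by
  have odd_sq : ∀ k : ℤ, (2 * k + 1) ^ 2 % 4 = 1 := by intro k; ring_nf; omega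
  have even_sq : ∀ k : ℤ, (2 * k) ^ 2 % 4 = 0 := by intro k; ring_nf; omega
  rcases Int.even_or_odd' x with ⟨a, rfl | rfl⟩ <;>
  rcases Int.even_or_odd' y with ⟨b, rfl | rfl⟩ <;>
  rcases Int.even_or_odd' z with ⟨c, rfl | rfl⟩ <;>
  have ha := odd_sq a <;> have hb := odd_sq b <;> have hc := odd_sq c <;>
  have ha' := even_sq a <;> have hb' := even_sq b <;> have hc' := even_sq c <;>
  first
    | omega
    | (refine ⟨2 * c + 1, a, b, ⟨c, rfl⟩, ?_⟩; ring1)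
    | (refine ⟨2 * b + 1, a, c, ⟨b, rfl⟩, ?_⟩; ring1)
    | (refine ⟨2 * a + 1, b, c, ⟨a, rfl⟩, ?_⟩; ring1)

theorem even_add_of_sum_three_sq {w a b : ℤ} (hw : Odd w)
    (h : (w ^ 2 + (2 * a) ^ 2 + (2 * b) ^ 2) % 8 = 1) : Even (a + b) := by
  have h8 : w ^ 2 % 8 = 1 := by
    obtain ⟨k, rfl⟩ := hw
    obtain ⟨l, hl⟩ := Int.even_mul_succ_self k
    have : (2 * k + 1) ^ 2 = 8 * l + 1 := by linear_combination 4 * hl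
    omega
  have h2 : Even (a ^ 2 + b ^ 2) := by
    rw [Int.even_iff]
    ring_nf at h
    omega
  simpa [Int.even_add, Int.even_pow] using h2

/-- `u` and `v` odd in `N = w² + (2u)² + (2v)²`, for `N ≡ 1 (mod 8)` not a square. -/
theorem exists_odd_of_not_isSquare {N : ℕ} (hN : N % 8 = 1) (hsq : ¬ IsSquare N) :
    ∃ w h k : ℤ, Odd w ∧ Odd h ∧ Odd k ∧ w ^ 2 + (2 * h) ^ 2 + (2 * k) ^ 2 = N := by
  obtain ⟨x, y, z, hxyz⟩ := exists_sum_three_sq_of_mod_eight hN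
  obtain ⟨w, a, b, hw, hwab⟩ := exists_odd_and_even_of_sum_three_sq (x := x) (y := y) (z := z)
    (by omega)
  rw [hxyz] at hwab
  have hab := even_add_of_sum_three_sq (a := a) (b := b) hw (by omega)
  by_cases ha : Odd a
  · exact ⟨w, a, b, hw, ha, by rwa [Int.even_add', iff_true_left ha] at hab, hwab⟩
  · have ha' := Int.not_odd_iff_even.mp ha
    have hb' : Even b := by rwa [Int.even_add, iff_true_left ha'] at hab
    obtain ⟨a, rfl⟩ := ha'.two_dvd
    obtain ⟨b, rfl⟩ := hb'.two_dvd
    obtain ⟨p, hp, hNp, hp4, r, hr⟩ := exists_prime_three_mod_four_legendre hN hsq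
    exact exists_odd_of_four_dvd hp hp4 (a := a) (b := b) hw (by rw [← hwab]; ring)
      (by exact_mod_cast hNp) hr

theorem exists_odd_or_eq_zero_of_sq {s : ℕ} (hs : Odd s) (hs1 : s ≠ 1) :
    ∃ w h k : ℤ, Odd w ∧ w ^ 2 + (2 * h) ^ 2 + (2 * k) ^ 2 = s ^ 2 ∧
      ((Odd h ∧ Odd k) ∨ (h ≠ 0 ∧ k = 0)) := by
  obtain ⟨q, hq, m, rfl⟩ := Nat.exists_prime_and_dvd hs1
  have hm : Odd m := Odd.of_dvd_nat hs (dvd_mul_left _ _)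
  have hqo : Odd q := Odd.of_dvd_nat hs (dvd_mul_right _ _)
  have hm' : Odd (m : ℤ) := by exact_mod_cast hm
  have hm0 : (m : ℤ) ≠ 0 := by exact_mod_cast hm.pos.ne'
  by_cases h3 : q % 4 = 3
  · obtain ⟨a, b, c, d, h⟩ := Nat.sum_four_squares q
    have hZ : (a : ℤ) ^ 2 + b ^ 2 + c ^ 2 + d ^ 2 = q := by exact_mod_cast h
    obtain ⟨o1, o2, o3⟩ := odd_cross_terms (a := a) (b := b) (c := c) (d := d) (by omega)
    refine ⟨_, _, _, hm'.mul o1, ?_, Or.inl ⟨hm'.mul o2, hm'.mul o3⟩⟩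
    push_cast
    rw [← hZ]
    ring
  · have := Fact.mk hq
    obtain ⟨a, b, h⟩ := Nat.Prime.sq_add_sq h3
    have hZ : (a : ℤ) ^ 2 + b ^ 2 = q := by exact_mod_cast h
    have hne : ∀ x : ℕ, x ^ 2 ≠ q := fun x hx => hq.prime.irreducible.not_isSquare ⟨x, by
      rw [← hx]; ring⟩
    have ha : a ≠ 0 := by rintro rfl; exact hne b (by simpa using h)
    have hb : b ≠ 0 := by rintro rfl; exact hne a (by simpa using h)
    refine ⟨m * (a ^ 2 - b ^ 2), m * (a * b), 0, hm'.mul ?_, ?_, Or.inr ⟨?_, rfl⟩⟩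
    · have : Odd ((a : ℤ) ^ 2 + b ^ 2) := by rw [hZ]; exact_mod_cast hqo
      simpa [Int.odd_add, Int.odd_sub] using this
    · push_cast
      rw [← hZ]
      ring
    · have : (a : ℤ) ≠ 0 := by exact_mod_cast ha
      have : (b : ℤ) ≠ 0 := by exact_mod_cast hb
      positivity

theorem two_mul_triangular (z : ℕ) : 2 * triangular z = z * (z + 1) :=
  Nat.mul_div_cancel' (Nat.even_mul_succ_self z).two_dvd

theorem exists_eight_mul_triangular_add_one_eq (k : ℤ) :
    ∃ z : ℕ, 8 * (triangular z : ℤ) + 1 = (2 * k + 1) ^ 2 := by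
  have key : ∀ z : ℕ, 8 * (triangular z : ℤ) + 1 = (2 * z + 1) ^ 2 := fun z => by
    have h : 2 * (triangular z : ℤ) = z * (z + 1) := by exact_mod_cast two_mul_triangular z
    linear_combination 4 * h
  rcases le_or_gt 0 k with hk | hk
  · lift k to ℕ using hk
    exact ⟨k, key k⟩
  · obtain ⟨z, hz⟩ : ∃ z : ℕ, (z : ℤ) = -k - 1 := ⟨_, Int.toNat_of_nonneg (by omega)⟩
    refine ⟨z, (key z).trans ?_⟩
    rw [hz]
    ring

/-- Every positive integer is a triangular number plus `x² + y²` with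
`x ≢ y (mod 2)` or `x = y > 0`. -/
theorem triangular_add_two_squares_special (n : ℕ) (hn : 0 < n) :
    ∃ (z : ℕ) (x y : ℤ), (n : ℤ) = (triangular z : ℤ) + x ^ 2 + y ^ 2 ∧
      (x % 2 ≠ y % 2 ∨ (x = y ∧ 0 < x)) := by
  obtain ⟨w, h, k, hw, hN, hhk⟩ : ∃ w h k : ℤ, Odd w ∧
      w ^ 2 + (2 * h) ^ 2 + (2 * k) ^ 2 = 8 * n + 1 ∧
      ((Odd h ∧ Odd k) ∨ (h ≠ 0 ∧ k = 0)) := by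
    by_cases hsq : IsSquare (8 * n + 1)
    · obtain ⟨s, hs⟩ := hsq
      have hodd : Odd (s * s) := hs ▸ ⟨4 * n, by ring⟩
      obtain ⟨w, h, k, hw, hN, hhk⟩ := exists_odd_or_eq_zero_of_sq (Nat.odd_mul.mp hodd).1
        (by rintro rfl; omega)
      have hs' : (8 * n + 1 : ℤ) = s * s := by exact_mod_cast hs
      exact ⟨w, h, k, hw, by rw [hN, hs', sq], hhk⟩
    · obtain ⟨w, h, k, hw, hh, hk, hN⟩ := exists_odd_of_not_isSquare (by omega) hsq
      exact ⟨w, h, k, hw, by exact_mod_cast hN, Or.inl ⟨hh, hk⟩⟩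
  have heven := even_add_of_sum_three_sq (a := h) (b := k) hw (by omega)
  obtain ⟨l, rfl⟩ := hw
  obtain ⟨z, hz⟩ := exists_eight_mul_triangular_add_one_eq l
  rcases hhk with ⟨hh, hk⟩ | ⟨hh, rfl⟩
  · obtain ⟨a, rfl⟩ := hh
    obtain ⟨b, rfl⟩ := hk
    refine ⟨z, a + b + 1, a - b, ?_, Or.inl (by omega)⟩
    refine mul_left_cancel₀ (show (8 : ℤ) ≠ 0 by norm_num) ?_
    linear_combination -hN - hz
  · rw [add_zero] at heven
    obtain ⟨x, rfl⟩ := heven.two_dvd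
    refine ⟨z, |x|, |x|, ?_, Or.inr ⟨rfl, abs_pos.mpr (by simpa using hh)⟩⟩
    rw [sq_abs]
    refine mul_left_cancel₀ (show (8 : ℤ) ≠ 0 by norm_num) ?_
    linear_combination -hN - hz
end

section
/- Let a, b, c be positive integers with a ≤ b. Every natural number n can be written as a·x² + b·y² + c·t_z with x, y, z ∈ ℤ if and only if (a,b,c) is one of the ten triples (1,1,1), (1,1,2), (1,2,1), (1,2,2), (1,2,4), (1,3,1), (1,4,1), (1,4,2), (1,8,1), (2,2,1). -/
/-- The triangular number `t_k = k(k+1)/2` for an integer `k`. -/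
def triZ (k : ℤ) : ℤ := k * (k + 1) / 2

/-- The value at `(x, y, z)` of the ternary quadratic form with Gram matrix
`!![a, f, e; f, b, d; e, d, c]`. -/
def ternaryForm (a b c d e f x y z : ℤ) : ℤ :=
  a * x ^ 2 + b * y ^ 2 + c * z ^ 2 + 2 * d * y * z + 2 * e * x * z + 2 * f * x * y

/-- The ternary form with the given coefficients arises from `G` by an integral linear
substitution. -/
def ArisesFrom (G : ℤ → ℤ → ℤ → ℤ) (a b c d e f : ℤ) : Prop :=
  ∃ p₁ p₂ p₃ q₁ q₂ q₃ r₁ r₂ r₃ : ℤ, ∀ x y z : ℤ, ternaryForm a b c d e f x y z =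
    G (p₁ * x + p₂ * y + p₃ * z) (q₁ * x + q₂ * y + q₃ * z) (r₁ * x + r₂ * y + r₃ * z)

theorem ArisesFrom.shift_swap_xy {G : ℤ → ℤ → ℤ → ℤ} {a b c d e f : ℤ} (k : ℤ)
    (h : ArisesFrom G (b + 2 * k * f + k ^ 2 * a) a c e (d + k * e) (f + k * a)) :
    ArisesFrom G a b c d e f := by
  obtain ⟨p₁, p₂, p₃, q₁, q₂, q₃, r₁, r₂, r₃, h⟩ := h
  refine ⟨p₂, p₁ - k * p₂, p₃, q₂, q₁ - k * q₂, q₃, r₂, r₁ - k * r₂, r₃, fun x y z => ?_⟩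
  convert h y (x - k * y) z using 1
  · unfold ternaryForm; ring
  · congr 1 <;> ring

theorem ArisesFrom.shift_swap_yz {G : ℤ → ℤ → ℤ → ℤ} {a b c d e f : ℤ} (k : ℤ)
    (h : ArisesFrom G a (c + 2 * k * d + k ^ 2 * b) b (d + k * b) f (e + k * f)) :
    ArisesFrom G a b c d e f := by
  obtain ⟨p₁, p₂, p₃, q₁, q₂, q₃, r₁, r₂, r₃, h⟩ := h
  refine ⟨p₁, p₃, p₂ - k * p₃, q₁, q₃, q₂ - k * q₃, r₁, r₃, r₂ - k * r₃, fun x y z => ?_⟩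
  convert h x z (y - k * z) using 1
  · unfold ternaryForm; ring
  · congr 1 <;> ring

theorem exists_four_mul_sq_add_mul_le (a f : ℤ) (ha : 0 < a) :
    ∃ k : ℤ, 4 * (f + k * a) ^ 2 ≤ a ^ 2 := by
  refine ⟨-((2 * f + a) / (2 * a)), ?_⟩
  have h1 := Int.emod_add_mul_ediv (2 * f + a) (2 * a)
  have h2 := Int.emod_nonneg (2 * f + a) (show 2 * a ≠ 0 by omega)
  have h3 := Int.emod_lt_of_pos (2 * f + a) (show 0 < 2 * a by omega)
  set q := (2 * f + a) / (2 * a)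
  set r := (2 * f + a) % (2 * a)
  have h4 : 2 * (f + -q * a) = r - a := by linarith
  nlinarith

/-- Hermite reduction of positive definite ternary forms of determinant at most `3`. -/
theorem arisesFrom_of_det_le_three {δ : ℤ} (hδ : 0 < δ) (hδ3 : δ ≤ 3) (a b c d e f : ℤ)
    (ha : 0 < a) (hD : 0 < a * b - f ^ 2)
    (hdet : a * b * c + 2 * d * e * f - a * d ^ 2 - b * e ^ 2 - c * f ^ 2 = δ) :
    ArisesFrom (fun x y z => x ^ 2 + y ^ 2 + δ * z ^ 2) a b c d e f ∨
      δ = 3 ∧ ArisesFrom (fun x y z => x ^ 2 + 2 * (y ^ 2 + y * z + z ^ 2)) a b c d e f := by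
  induction hm : (a + (a * b - f ^ 2)).toNat using Nat.strong_induction_on
    generalizing a b c d e f with
  | _ m ih =>
    by_cases h1 : 4 * (a * b - f ^ 2) < 3 * a ^ 2
    · obtain ⟨k, hk⟩ := exists_four_mul_sq_add_mul_le a f ha
      have hDeq : (b + 2 * k * f + k ^ 2 * a) * a - (f + k * a) ^ 2 = a * b - f ^ 2 := by ring
      have hb' : 0 < b + 2 * k * f + k ^ 2 * a := by
        by_contra hcon
        nlinarith [sq_nonneg (f + k * a)]
      have hlt : b + 2 * k * f + k ^ 2 * a < a := by
        by_contra hcon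
        nlinarith
      refine (ih _ ?_ _ _ _ _ _ _ hb' (hDeq ▸ hD) ?_ rfl).imp (.shift_swap_xy k)
        (And.imp_right (.shift_swap_xy k))
      · omega
      · linear_combination hdet
    by_cases h2 : 4 * (a * δ) < 3 * (a * b - f ^ 2) ^ 2
    · obtain ⟨k, hk⟩ := exists_four_mul_sq_add_mul_le (a * b - f ^ 2) (a * d - e * f) hD
      have hDeq : (a * (c + 2 * k * d + k ^ 2 * b) - (e + k * f) ^ 2) * (a * b - f ^ 2) =
          a * δ + (a * d - e * f + k * (a * b - f ^ 2)) ^ 2 := by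
        linear_combination a * hdet
      have hpos : 0 < a * δ := mul_pos ha hδ
      have hD' : 0 < a * (c + 2 * k * d + k ^ 2 * b) - (e + k * f) ^ 2 := by
        by_contra hcon
        nlinarith [sq_nonneg (a * d - e * f + k * (a * b - f ^ 2))]
      have hlt : a * (c + 2 * k * d + k ^ 2 * b) - (e + k * f) ^ 2 < a * b - f ^ 2 := by
        by_contra hcon
        nlinarith
      refine (ih _ ?_ _ _ _ _ _ _ ha hD' ?_ rfl).imp (.shift_swap_yz k)
        (And.imp_right (.shift_swap_yz k))
      · omega
      · linear_combination hdet
    have ha1 : a = 1 := by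
      by_contra hcon
      have ha2 : 2 ≤ a := by omega
      have h3 : 9 * a ^ 4 ≤ 16 * (a * b - f ^ 2) ^ 2 := by nlinarith [sq_nonneg a]
      have h4 : a * 8 ≤ a * a ^ 3 := by
        gcongr
        nlinarith [sq_nonneg a]
      nlinarith
    subst ha1
    obtain ⟨D, hDdef⟩ : ∃ D, D = 1 * b - f ^ 2 := ⟨_, rfl⟩
    obtain ⟨H, hH⟩ : ∃ H, H = d - e * f := ⟨_, rfl⟩
    obtain ⟨K, hK⟩ : ∃ K, K = c - e ^ 2 := ⟨_, rfl⟩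
    rw [← hDdef] at hD h1 h2
    have hDK : D * K - H ^ 2 = δ := by subst hDdef hH hK; linear_combination hdet
    have hD2 : D ≤ 2 := by nlinarith
    have hF : ∀ x y z : ℤ, ternaryForm 1 b c d e f x y z =
        (x + f * y + e * z) ^ 2 + D * y ^ 2 + 2 * H * y * z + K * z ^ 2 := by
      intro x y z; subst hDdef hH hK; unfold ternaryForm; ring
    obtain rfl | rfl : D = 1 ∨ D = 2 := by omega
    · refine .inl ⟨1, f, e, 0, 1, H, 0, 0, 1, fun x y z => ?_⟩
      rw [hF]; linear_combination z ^ 2 * hDK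
    · obtain rfl : δ = 3 := by nlinarith
      obtain ⟨h, rfl | rfl⟩ := Int.even_or_odd' H
      · ring_nf at hDK; omega
      · refine .inr ⟨rfl, 1, f, e, 0, 1, h, 0, 0, 1, fun x y z => ?_⟩
        have hK' : K = 2 * (h ^ 2 + h + 1) := by linarith
        rw [hF, hK']; ring

theorem eq_sq_add_of_dvd_sq_add {δ n b A s : ℤ} (hδ : 0 < δ) (hδ3 : δ ≤ 3) (hA : 0 < A)
    (hb : 0 < b) (hn : b * n = A + δ) (hs : A ∣ s ^ 2 + b) :
    (∃ x y z : ℤ, n = x ^ 2 + y ^ 2 + δ * z ^ 2 ∧ (δ = 3 → b % 3 ≠ 2)) ∨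
      δ = 3 ∧ ∃ x y z : ℤ, n = x ^ 2 + 2 * (y ^ 2 + y * z + z ^ 2) := by
  obtain ⟨B, hB⟩ := hs
  have hBpos : 0 < B := by
    by_contra hcon
    nlinarith [sq_nonneg s]
  have hn1 : ternaryForm B A n 0 1 s 0 0 1 = n := by unfold ternaryForm; ring
  refine (arisesFrom_of_det_le_three hδ hδ3 B A n 0 1 s hBpos (by linarith)
    (by linear_combination n * (-hB) + hn)).imp ?_ (And.imp_right ?_)
  · rintro ⟨p₁, p₂, p₃, q₁, q₂, q₃, r₁, r₂, r₃, h⟩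
    refine ⟨p₃, q₃, r₃, ?_, ?_⟩
    · rw [← hn1, h]; ring
    · rintro rfl
      have e1 := h 1 0 0
      have e2 := h 0 1 0
      have e3 := h 1 1 0
      simp only [ternaryForm] at e1 e2 e3
      ring_nf at e1 e2 e3
      have hb3 : b = (p₁ * q₂ - p₂ * q₁) ^ 2 +
          3 * ((p₁ * r₂ - p₂ * r₁) ^ 2 + (q₁ * r₂ - q₂ * r₁) ^ 2) := by
        have hs' : s = p₁ * p₂ + q₁ * q₂ + r₁ * r₂ * 3 := by linarith
        have : b = A * B - s ^ 2 := by linarith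
        rw [this, hs', e1, e2]; ring
      have : (p₁ * q₂ - p₂ * q₁) ^ 2 % 3 ≠ 2 := by
        generalize p₁ * q₂ - p₂ * q₁ = t
        have : t % 3 = 0 ∨ t % 3 = 1 ∨ t % 3 = 2 := by omega
        rcases this with h | h | h <;> simp [pow_two, Int.mul_emod, h]
      omega
  · rintro ⟨p₁, p₂, p₃, q₁, q₂, q₃, r₁, r₂, r₃, h⟩
    exact ⟨p₃, q₃, r₃, by rw [← hn1, h]; ring⟩

section Jacobi

open jacobiSym ZMod
open scoped NumberTheorySymbols

theorem jacobiSym_eq_of_dvd {b c p : ℕ} {k : ℤ} (h : (b : ℤ) ∣ c * p + k) :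
    J(c | b) * J(p | b) = J(-k | b) := by
  rw [← mul_left]
  apply mod_left'
  apply Int.emod_emod_of_dvd _ (dvd_refl _) |>.symm.trans
  rw [Int.emod_emod_of_dvd _ (dvd_refl _)]
  exact Int.ModEq.symm ((Int.modEq_iff_dvd).2 (by simpa using h))

theorem jacobiSym_neg_eq_of_mod_four_eq_one {b p : ℕ} (hb : b % 4 = 1) (hp : p % 2 = 1) :
    J(-b | p) = χ₄ p * J(p | b) := by
  have hp' : Odd p := Nat.odd_iff.2 hp
  rw [jacobiSym.neg _ hp', quadratic_reciprocity_one_mod_four hb hp']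

theorem jacobiSym_two_of_mod_eight_eq_one {b : ℕ} (hb : b % 8 = 1) : J(2 | b) = 1 := by
  rw [at_two (Nat.odd_iff.2 (by omega)), χ₈_nat_eq_if_mod_eight]
  simp [hb, show b % 2 = 1 by omega]

theorem jacobiSym_three_of_mod {b : ℕ} (hb : b % 12 = 5) : J(3 | b) = -1 := by
  have := quadratic_reciprocity_one_mod_four' (a := 3) (b := b) (by decide) (by omega)
  rw [Nat.cast_ofNat] at this
  rw [this, mod_left, show (b : ℤ) % (3 : ℕ) = 2 by omega, at_two (by decide)]
  decide

theorem exists_dvd_sq_add_of_jacobiSym {b p : ℕ} (hp : p.Prime) (h : J(-b | p) = 1) :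
    ∃ s : ℤ, (p : ℤ) ∣ s ^ 2 + b := by
  have := Fact.mk hp
  obtain ⟨s, hs⟩ := isSquare_of_jacobiSym_eq_one h
  obtain ⟨t, rfl⟩ := ZMod.intCast_surjective s
  refine ⟨t, (ZMod.intCast_zmod_eq_zero_iff_dvd _ p).1 ?_⟩
  push_cast at hs ⊢
  linear_combination -hs

end Jacobi

theorem exists_mul_dvd_sq_add {m₁ m₂ b : ℤ} (h : IsCoprime m₁ m₂)
    (h₁ : ∃ s : ℤ, m₁ ∣ s ^ 2 + b) (h₂ : ∃ s : ℤ, m₂ ∣ s ^ 2 + b) :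
    ∃ s : ℤ, m₁ * m₂ ∣ s ^ 2 + b := by
  obtain ⟨u, v, huv⟩ := h
  obtain ⟨s₁, t₁, h₁⟩ := h₁
  obtain ⟨s₂, t₂, h₂⟩ := h₂
  refine ⟨s₁ * (v * m₂) + s₂ * (u * m₁), IsCoprime.mul_dvd ⟨u, v, huv⟩ ?_ ?_⟩
  · refine ⟨t₁ + u * (s₂ - s₁) * (2 * s₁ + u * m₁ * (s₂ - s₁)), ?_⟩
    have : v * m₂ = 1 - u * m₁ := by linarith
    rw [this]; linear_combination h₁
  · refine ⟨t₂ + v * (s₁ - s₂) * (2 * s₂ + v * m₂ * (s₁ - s₂)), ?_⟩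
    have : u * m₁ = 1 - v * m₂ := by linarith
    rw [this]; linear_combination h₂

/-- Dirichlet's theorem, with the prime written explicitly as a term of the progression. -/
theorem exists_prime_eq_add_mul {r q : ℕ} (hq : 0 < q) (h : r.Coprime q) :
    ∃ j : ℕ, (r + q * j).Prime := by
  obtain ⟨p, hpr, hp, hmod⟩ := Nat.forall_exists_prime_gt_and_modEq r hq.ne' h
  obtain ⟨j, hj⟩ := (Nat.modEq_iff_dvd' hpr.le).1 hmod.symm
  exact ⟨j, by rwa [← hj, Nat.add_sub_cancel' hpr.le]⟩

theorem eq_sq_add_sq_add_sq_of_mod_four_eq_two {n : ℕ} (hn : n % 4 = 2) :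
    ∃ x y z : ℤ, (n : ℤ) = x ^ 2 + y ^ 2 + z ^ 2 := by
  have hcop : (n - 1).Coprime (4 * n) := by
    refine Nat.Coprime.mul_right ?_ ?_
    · exact Nat.Coprime.pow_right 2 (Nat.coprime_two_right.2 (Nat.odd_iff.2 (by omega)))
    · have := Nat.coprime_self_add_left (m := 1) (n := n - 1)
      rw [show n = (n - 1) + 1 by omega]
      simp
  obtain ⟨j, hp⟩ := exists_prime_eq_add_mul (by omega) hcop
  set p := n - 1 + 4 * n * j with hpdef
  have hpn : (4 * j + 1) * n = p + 1 := by
    have : (4 * j + 1) * n = n + 4 * n * j := by ring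
    omega
  have hp4 : p % 4 = 1 := by rw [hpdef, mul_assoc]; omega
  have hJ : jacobiSym (-(4 * j + 1 : ℕ)) p = 1 := by
    rw [jacobiSym_neg_eq_of_mod_four_eq_one (by omega) (by omega), ZMod.χ₄_nat_one_mod_four hp4]
    have h := jacobiSym_eq_of_dvd (b := 4 * j + 1) (c := 1) (p := p) (k := 1)
      ⟨n, by exact_mod_cast (by rw [hpn, one_mul])⟩
    rw [jacobiSym.at_neg_one (Nat.odd_iff.2 (by omega)),
      ZMod.χ₄_nat_one_mod_four (by omega)] at h
    simpa using h
  obtain ⟨s, hs⟩ := exists_dvd_sq_add_of_jacobiSym hp hJ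
  obtain ⟨x, y, z, h, -⟩ | h := eq_sq_add_of_dvd_sq_add (δ := 1) (n := n) one_pos (by norm_num)
    (by exact_mod_cast hp.pos) (by positivity) (by exact_mod_cast hpn) hs
  · exact ⟨x, y, z, by linarith⟩
  · omega

theorem coprime_of_add_eq_mul {r n b c k : ℕ} (h2 : r % 2 = 1) (h3 : r % 3 ≠ 0) (hk : k ∣ 3)
    (h : c * r + k = b * n) : r.Coprime (12 * n) := by
  refine Nat.Coprime.mul_right ?_ ?_
  · refine Nat.Coprime.mul_right (k := r) (m := 4) (n := 3) ?_ ?_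
    · exact Nat.Coprime.pow_right 2 (Nat.coprime_two_right.2 (Nat.odd_iff.2 h2))
    · exact ((Nat.Prime.coprime_iff_not_dvd Nat.prime_three).2 (by omega)).symm
  · have h1 : r.gcd n ∣ k := (Nat.dvd_add_right ((Nat.gcd_dvd_left r n).mul_left c)).1
      (h ▸ (Nat.gcd_dvd_right r n).mul_left b)
    refine ((Nat.dvd_prime Nat.prime_three).1 (h1.trans hk)).resolve_right fun h4 => h3 ?_
    exact Nat.mod_eq_zero_of_dvd (h4 ▸ Nat.gcd_dvd_left r n)

theorem eq_sq_add_sq_add_sq_of_mod_four_eq_one {n : ℕ} (hn : n % 4 = 1) :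
    ∃ x y z : ℤ, (n : ℤ) = x ^ 2 + y ^ 2 + z ^ 2 := by
  obtain ⟨r, hr⟩ : ∃ r, 2 * r + 1 = 3 * n := ⟨(3 * n - 1) / 2, by omega⟩
  obtain ⟨j, hp⟩ := exists_prime_eq_add_mul (q := 12 * n) (by omega)
    (coprime_of_add_eq_mul (by omega) (by omega) (one_dvd 3) hr)
  set p := r + 12 * n * j with hpdef
  have hpn : (3 + 24 * j) * n = 2 * p + 1 := by
    rw [hpdef]; linear_combination -hr
  have hp2 : p % 2 = 1 := by rw [hpdef, mul_assoc]; omega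
  have hpodd : Odd p := Nat.odd_iff.2 hp2
  have hbodd : Odd (3 + 24 * j) := Nat.odd_iff.2 (by omega)
  have hJb : jacobiSym p (3 + 24 * j) = 1 := by
    have h := jacobiSym_eq_of_dvd (b := 3 + 24 * j) (c := 2) (p := p) (k := 1)
      ⟨n, by exact_mod_cast hpn.symm⟩
    rw [jacobiSym.at_neg_one hbodd, ZMod.χ₄_nat_three_mod_four (by omega), Nat.cast_ofNat,
      jacobiSym.at_two hbodd, ZMod.χ₈_nat_eq_if_mod_eight] at h
    simpa [show (3 + 24 * j) % 2 = 1 by omega, show (3 + 24 * j) % 8 = 3 by omega] using h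
  have hJ : jacobiSym (-(3 + 24 * j : ℕ)) p = 1 := by
    rw [jacobiSym.neg _ hpodd]
    obtain h4 | h4 : p % 4 = 1 ∨ p % 4 = 3 := by omega
    · rw [ZMod.χ₄_nat_one_mod_four h4, jacobiSym.quadratic_reciprocity_one_mod_four' hbodd h4,
        hJb, one_mul]
    · rw [ZMod.χ₄_nat_three_mod_four h4,
        jacobiSym.quadratic_reciprocity_three_mod_four (by omega) h4, hJb]
      norm_num
  obtain ⟨s, hs⟩ := exists_mul_dvd_sq_add (m₁ := 2) (b := (3 + 24 * j : ℕ))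
    (by exact_mod_cast Nat.isCoprime_iff_coprime.2 (Nat.coprime_two_left.2 hpodd))
    ⟨1, by push_cast; omega⟩ (exists_dvd_sq_add_of_jacobiSym hp hJ)
  obtain ⟨x, y, z, h, -⟩ | h := eq_sq_add_of_dvd_sq_add (δ := 1) (n := n) one_pos (by norm_num)
    (by have := hp.pos; positivity) (by positivity) (by exact_mod_cast hpn) hs
  · exact ⟨x, y, z, by linarith⟩
  · omega

theorem eq_sq_add_two_mul_of_prime {n b c p : ℕ} (hp : p.Prime) (hcp : c.Coprime p) (hc : 0 < c)
    (hbn : b * n = c * p + 3) (hb : b % 3 = 2) (hJ : jacobiSym (-b) p = 1)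
    (hcb : ∃ s : ℤ, (c : ℤ) ∣ s ^ 2 + b) :
    ∃ x y z : ℤ, (n : ℤ) = x ^ 2 + 2 * (y ^ 2 + y * z + z ^ 2) := by
  obtain ⟨s, hs⟩ := exists_mul_dvd_sq_add (Nat.isCoprime_iff_coprime.2 hcp) hcb
    (exists_dvd_sq_add_of_jacobiSym hp hJ)
  obtain ⟨x, y, z, -, h⟩ | ⟨-, h⟩ := eq_sq_add_of_dvd_sq_add (δ := 3) (n := n) (b := b)
    (by norm_num) (by norm_num) (by have := hp.pos; positivity) (by omega)
    (by exact_mod_cast hbn) hs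
  · exact absurd (h rfl) (by omega)
  · exact h

theorem eq_sq_add_two_mul_of_mod_eight_eq_one {n : ℕ} (hn : n % 8 = 1) :
    ∃ x y z : ℤ, (n : ℤ) = x ^ 2 + 2 * (y ^ 2 + y * z + z ^ 2) := by
  by_cases h3 : n % 3 = 0
  · obtain ⟨m, rfl⟩ := Nat.dvd_of_mod_eq_zero h3
    by_cases hm : m % 3 = 2
    · obtain ⟨b₀, r, hr, hb₀, hr3⟩ : ∃ b₀ r, 6 * r + 1 = b₀ * m ∧ b₀ % 24 = 17 ∧ r % 3 ≠ 0 := by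
        by_cases h9 : m % 9 = 8
        · exact ⟨41, (41 * m - 1) / 6, by omega, by norm_num, by omega⟩
        · exact ⟨17, (17 * m - 1) / 6, by omega, by norm_num, by omega⟩
      have hr4 : r % 4 = 3 := by
        obtain ⟨i, rfl⟩ : ∃ i, b₀ = 17 + 24 * i := ⟨b₀ / 24, by omega⟩
        have : 6 * r + 1 = 17 * m + 24 * (i * m) := by rw [hr]; ring
        omega
      obtain ⟨j, hp⟩ := exists_prime_eq_add_mul (q := 12 * m) (by omega)
        (coprime_of_add_eq_mul (by omega) hr3 (one_dvd 3) hr)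
      set p := r + 12 * m * j with hpdef
      have hpm : (b₀ + 72 * j) * m = 6 * p + 1 := by
        rw [hpdef]; linear_combination -hr
      have hp4 : p % 4 = 3 := by rw [hpdef, mul_assoc]; omega
      have hp3 : p % 3 ≠ 0 := by rw [hpdef, mul_assoc]; omega
      have hJb : jacobiSym p (b₀ + 72 * j) = -1 := by
        have h := jacobiSym_eq_of_dvd (b := b₀ + 72 * j) (c := 6) (p := p) (k := 1)
          ⟨m, by exact_mod_cast hpm.symm⟩
        rw [jacobiSym.at_neg_one (Nat.odd_iff.2 (by omega)), ZMod.χ₄_nat_one_mod_four (by omega),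
          show ((6 : ℕ) : ℤ) = 2 * 3 by norm_num, jacobiSym.mul_left,
          jacobiSym_two_of_mod_eight_eq_one (by omega), jacobiSym_three_of_mod (by omega)] at h
        linarith
      refine eq_sq_add_two_mul_of_prime (c := 18) (b := b₀ + 72 * j) hp ?_ (by norm_num)
        (by linear_combination 3 * hpm) (by omega) ?_ ?_
      · refine Nat.Coprime.mul_left (m := 2) (n := 3 ^ 2) ?_ (Nat.Coprime.pow_left 2 ?_)
        · exact Nat.coprime_two_left.2 (Nat.odd_iff.2 (by omega))
        · exact (Nat.Prime.coprime_iff_not_dvd Nat.prime_three).2 (by omega)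
      · rw [jacobiSym_neg_eq_of_mod_four_eq_one (by omega) (by omega),
          ZMod.χ₄_nat_three_mod_four hp4, hJb]
        norm_num
      · push_cast
        obtain h | h | h : b₀ % 18 = 5 ∨ b₀ % 18 = 11 ∨ b₀ % 18 = 17 := by omega
        · exact ⟨7, by omega⟩
        · exact ⟨5, by omega⟩
        · exact ⟨1, by omega⟩
    · obtain ⟨r, hr⟩ : ∃ r, 2 * r + 1 = 17 * m := ⟨(17 * m - 1) / 2, by omega⟩
      obtain ⟨j, hp⟩ := exists_prime_eq_add_mul (q := 12 * m) (by omega)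
        (coprime_of_add_eq_mul (by omega) (by omega) (one_dvd 3) hr)
      set p := r + 12 * m * j with hpdef
      have hpm : (17 + 24 * j) * m = 2 * p + 1 := by
        rw [hpdef]; linear_combination -hr
      have hp4 : p % 4 = 1 := by rw [hpdef, mul_assoc]; omega
      have hp3 : p % 3 ≠ 0 := by rw [hpdef, mul_assoc]; omega
      have hJb : jacobiSym p (17 + 24 * j) = 1 := by
        have h := jacobiSym_eq_of_dvd (b := 17 + 24 * j) (c := 2) (p := p) (k := 1)
          ⟨m, by exact_mod_cast hpm.symm⟩
        rw [jacobiSym.at_neg_one (Nat.odd_iff.2 (by omega)), ZMod.χ₄_nat_one_mod_four (by omega),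
          Nat.cast_ofNat, jacobiSym_two_of_mod_eight_eq_one (by omega)] at h
        linarith
      refine eq_sq_add_two_mul_of_prime (c := 6) (b := 17 + 24 * j) hp ?_ (by norm_num)
        (by linear_combination 3 * hpm) (by omega) ?_ ⟨1, by push_cast; omega⟩
      · refine Nat.Coprime.mul_left (m := 2) (n := 3) ?_ ?_
        · exact Nat.coprime_two_left.2 (Nat.odd_iff.2 (by omega))
        · exact (Nat.Prime.coprime_iff_not_dvd Nat.prime_three).2 (by omega)
      · rw [jacobiSym_neg_eq_of_mod_four_eq_one (by omega) (by omega),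
          ZMod.χ₄_nat_one_mod_four hp4, hJb, one_mul]
  · obtain ⟨r, hr⟩ : ∃ r, 2 * r + 3 = 17 * n := ⟨(17 * n - 3) / 2, by omega⟩
    obtain ⟨j, hp⟩ := exists_prime_eq_add_mul (q := 12 * n) (by omega)
      (coprime_of_add_eq_mul (by omega) (by omega) dvd_rfl hr)
    set p := r + 12 * n * j with hpdef
    have hpn : (17 + 24 * j) * n = 2 * p + 3 := by
      rw [hpdef]; linear_combination -hr
    have hp4 : p % 4 = 3 := by rw [hpdef, mul_assoc]; omega
    have hJb : jacobiSym p (17 + 24 * j) = -1 := by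
      have h := jacobiSym_eq_of_dvd (b := 17 + 24 * j) (c := 2) (p := p) (k := 3)
        ⟨n, by exact_mod_cast hpn.symm⟩
      rw [jacobiSym.neg _ (Nat.odd_iff.2 (by omega)), ZMod.χ₄_nat_one_mod_four (by omega),
        Nat.cast_ofNat, jacobiSym_two_of_mod_eight_eq_one (by omega),
        jacobiSym_three_of_mod (by omega)] at h
      linarith
    refine eq_sq_add_two_mul_of_prime (c := 2) (b := 17 + 24 * j) hp
      (Nat.coprime_two_left.2 (Nat.odd_iff.2 (by omega))) (by norm_num) hpn (by omega) ?_
      ⟨1, by push_cast; omega⟩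
    rw [jacobiSym_neg_eq_of_mod_four_eq_one (by omega) (by omega),
      ZMod.χ₄_nat_three_mod_four hp4, hJb]
    norm_num

section Rotation

open Quaternion

/-- The quaternion with the given coordinates. -/
def quat (a b c d : ℤ) : ℍ[ℤ] := ⟨a, b, c, d⟩

@[simp] theorem re_quat (a b c d : ℤ) : (quat a b c d).re = a := rfl

@[simp] theorem imI_quat (a b c d : ℤ) : (quat a b c d).imI = b := rfl

@[simp] theorem imJ_quat (a b c d : ℤ) : (quat a b c d).imJ = c := rfl

@[simp] theorem imK_quat (a b c d : ℤ) : (quat a b c d).imK = d := rfl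

theorem exists_four_mul_sq_sub_mul_lt {k : ℤ} (hk : 0 < k) (hodd : k % 2 = 1) (n : ℤ) :
    ∃ s : ℤ, 4 * (n - k * s) ^ 2 < k ^ 2 := by
  refine ⟨(2 * n + k) / (2 * k), ?_⟩
  have h1 := Int.emod_add_mul_ediv (2 * n + k) (2 * k)
  have h2 := Int.emod_nonneg (2 * n + k) (show 2 * k ≠ 0 by omega)
  have h3 := Int.emod_lt_of_pos (2 * n + k) (show 0 < 2 * k by omega)
  set q := (2 * n + k) / (2 * k)
  set r := (2 * n + k) % (2 * k)
  have h5 : r ≠ 0 := by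
    intro h
    have : k * (2 * q) = 2 * n + k := by linarith
    have h6 : (2 * (k * q)) = 2 * n + k := by linarith
    omega
  have h4 : 2 * (n - k * q) = r - k := by linarith
  have h6 : 0 < r := by omega
  nlinarith

theorem exists_normSq_sub_smul_lt_s8 {k : ℤ} (hk : 0 < k) (hodd : k % 2 = 1) (q : ℍ[ℤ]) :
    ∃ s : ℍ[ℤ], normSq (q - k • s) < k ^ 2 := by
  obtain ⟨s₁, h₁⟩ := exists_four_mul_sq_sub_mul_lt hk hodd q.re
  obtain ⟨s₂, h₂⟩ := exists_four_mul_sq_sub_mul_lt hk hodd q.imI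
  obtain ⟨s₃, h₃⟩ := exists_four_mul_sq_sub_mul_lt hk hodd q.imJ
  obtain ⟨s₄, h₄⟩ := exists_four_mul_sq_sub_mul_lt hk hodd q.imK
  refine ⟨quat s₁ s₂ s₃ s₄, ?_⟩
  simp only [normSq_def', re_sub, imI_sub, imJ_sub, imK_sub, re_smul, imI_smul, imJ_smul,
    imK_smul, smul_eq_mul, re_quat, imI_quat, imJ_quat, imK_quat]
  linarith

theorem dvd_normSq_sub_smul (k : ℤ) (q s : ℍ[ℤ]) : k ∣ normSq (q - k • s) - normSq q := by
  refine ⟨-2 * (q.re * s.re + q.imI * s.imI + q.imJ * s.imJ + q.imK * s.imK) +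
    k * normSq s, ?_⟩
  simp only [normSq_def', re_sub, imI_sub, imJ_sub, imK_sub, re_smul, imI_smul, imJ_smul,
    imK_smul, smul_eq_mul]
  ring

theorem exists_mul_eq_two_smul {q : ℍ[ℤ]} (h : normSq q % 2 = 0) :
    ∃ w q' : ℍ[ℤ], normSq w = 2 ∧ q * w = (2 : ℤ) • q' := by
  obtain ⟨a, ha⟩ : ∃ a, a = q.re := ⟨_, rfl⟩
  obtain ⟨b, hb⟩ : ∃ b, b = q.imI := ⟨_, rfl⟩
  obtain ⟨c, hc⟩ : ∃ c, c = q.imJ := ⟨_, rfl⟩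
  obtain ⟨d, hd⟩ : ∃ d, d = q.imK := ⟨_, rfl⟩
  have hpar : (a + b + c + d) % 2 = 0 := by
    rw [normSq_def', ← ha, ← hb, ← hc, ← hd] at h
    have key : ∀ t : ℤ, t ^ 2 % 2 = t % 2 := fun t => by
      obtain h | h : t % 2 = 0 ∨ t % 2 = 1 := by omega
      all_goals simp [pow_two, Int.mul_emod, h]
    have h₁ := key a; have h₂ := key b; have h₃ := key c; have h₄ := key d
    omega
  have hw : (a + b) % 2 = 0 ∨ (a + c) % 2 = 0 ∨ (a + d) % 2 = 0 := by omega
  rcases hw with hw | hw | hw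
  · refine ⟨quat 1 1 0 0, quat ((a - b) / 2) ((a + b) / 2) ((c + d) / 2) ((d - c) / 2),
      by simp [normSq_def'], ?_⟩
    ext <;> simp only [re_mul, imI_mul, imJ_mul, imK_mul, re_smul, imI_smul, imJ_smul,
      imK_smul, smul_eq_mul, re_quat, imI_quat, imJ_quat, imK_quat, ← ha, ← hb, ← hc, ← hd] <;> omega
  · refine ⟨quat 1 0 1 0, quat ((a - c) / 2) ((b - d) / 2) ((a + c) / 2) ((b + d) / 2),
      by simp [normSq_def'], ?_⟩
    ext <;> simp only [re_mul, imI_mul, imJ_mul, imK_mul, re_smul, imI_smul, imJ_smul,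
      imK_smul, smul_eq_mul, re_quat, imI_quat, imJ_quat, imK_quat, ← ha, ← hb, ← hc, ← hd] <;> omega
  · refine ⟨quat 1 0 0 1, quat ((a - d) / 2) ((b + c) / 2) ((c - b) / 2) ((a + d) / 2),
      by simp [normSq_def'], ?_⟩
    ext <;> simp only [re_mul, imI_mul, imJ_mul, imK_mul, re_smul, imI_smul, imJ_smul,
      imK_smul, smul_eq_mul, re_quat, imI_quat, imJ_quat, imK_quat, ← ha, ← hb, ← hc, ← hd] <;> omega

theorem exists_mul_eq_smul_of_mul_eq_smul {p m : ℤ} (hpm : IsCoprime p m) {α q w q' t : ℍ[ℤ]}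
    (ht : α * q = p • t) (hw : q * w = m • q') : ∃ t', α * q' = p • t' := by
  obtain ⟨u, v, huv⟩ := hpm
  have h : m • (α * q') = p • (t * w) := by
    rw [← mul_smul_comm, ← hw, ← mul_assoc, ht, smul_mul_assoc]
  refine ⟨u • (α * q') + v • (t * w), ?_⟩
  calc α * q' = (u * p + v * m) • (α * q') := by rw [huv, one_smul]
    _ = (p * u) • (α * q') + v • (m • (α * q')) := by rw [add_smul, mul_smul v, mul_comm u]
    _ = _ := by rw [h, smul_add, mul_smul, smul_comm v p]

theorem exists_normSq_eq_of_lt {p : ℕ} (hp : p.Prime) (hp2 : p ≠ 2) (α : ℍ[ℤ]) (k : ℕ) :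
    ∀ q t : ℍ[ℤ], 0 < k → k < p → normSq q = p * k → α * q = (p : ℤ) • t →
      ∃ q t : ℍ[ℤ], normSq q = p ∧ α * q = (p : ℤ) • t := by
  induction k using Nat.strong_induction_on with
  | _ k ih =>
  intro q t hk hkp hq ht
  have hp0 : (0 : ℤ) < p := by exact_mod_cast hp.pos
  obtain hk2 | hk2 : k % 2 = 0 ∨ k % 2 = 1 := by omega
  · obtain ⟨l, rfl⟩ := Nat.dvd_of_mod_eq_zero hk2
    obtain ⟨w, q', hw, hq'⟩ := exists_mul_eq_two_smul (q := q)
      (by rw [hq]; push_cast; rw [show (p : ℤ) * (2 * l) = 2 * (p * l) by ring]; omega)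
    obtain ⟨t', ht'⟩ := exists_mul_eq_smul_of_mul_eq_smul
      (by exact_mod_cast Nat.isCoprime_iff_coprime.2 ((Nat.coprime_primes hp Nat.prime_two).2 hp2))
      ht hq'
    have hn := congrArg normSq hq'
    rw [map_mul, normSq_smul, hw, hq] at hn
    push_cast at hn
    exact ih l (by omega) q' t' (by omega) (by omega) (by linarith) ht'
  · obtain rfl | hk1 : k = 1 ∨ 1 < k := by omega
    · exact ⟨q, t, by simpa using hq, ht⟩
    obtain ⟨s, hs⟩ := exists_normSq_sub_smul_lt_s8 (k := k) (by omega) (by omega) q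
    obtain ⟨c, hc⟩ : (k : ℤ) ∣ normSq (q - (k : ℤ) • s) :=
      (dvd_sub_left ⟨(p : ℤ), by rw [hq]; ring⟩).1 (dvd_normSq_sub_smul k q s)
    have hkpos : (0 : ℤ) < k := by omega
    have hc0 : 0 < c := by
      have h0 : 0 ≤ c := by
        have := normSq_nonneg (a := q - (k : ℤ) • s)
        rw [hc] at this
        exact nonneg_of_mul_nonneg_right this hkpos
      refine lt_of_le_of_ne h0 fun h => ?_
      rw [← h, mul_zero, normSq_eq_zero, sub_eq_zero] at hc
      have hn := hq
      rw [hc, normSq_smul] at hn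
      have : (p : ℤ) = k * normSq s := by
        apply mul_right_cancel₀ hkpos.ne'
        linarith
      have hdvd : k ∣ p := Int.natCast_dvd_natCast.1 ⟨_, this⟩
      obtain h | h := (Nat.dvd_prime hp).1 hdvd <;> omega
    have hck : c < k := by
      rw [hc] at hs
      nlinarith
    lift c to ℕ using hc0.le
    have hq' : q * star (q - (k : ℤ) • s) = (k : ℤ) • ((p : ℍ[ℤ]) - q * star s) := by
      rw [star_sub, mul_sub, self_mul_star, hq, Quaternion.star_smul, mul_smul_comm, smul_sub]
      congr 1
      ext <;> simp [mul_comm]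
    obtain ⟨t', ht'⟩ := exists_mul_eq_smul_of_mul_eq_smul
      (Nat.isCoprime_iff_coprime.2 ((Nat.coprime_of_lt_prime hk.ne' hkp hp))) ht hq'
    have hn := congrArg normSq hq'
    rw [map_mul, normSq_smul, normSq_star, hc, hq] at hn
    refine ih c (by omega) _ t' (by omega) (by omega) ?_ ht'
    apply mul_left_cancel₀ (pow_pos hkpos 2).ne'
    linarith

/-- If `-N` is a nonzero square modulo an odd prime `p`, then every integral vector of square
length `N` is carried to an integral vector by the rotation attached to a suitable integral
quaternion of norm `p`. -/
theorem exists_rotation {p : ℕ} (hp : p.Prime) (hp2 : p ≠ 2) {m w x y : ℤ} (hm : ¬ (p : ℤ) ∣ m)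
    (h : (p : ℤ) ∣ m ^ 2 + (w ^ 2 + x ^ 2 + y ^ 2)) :
    ∃ a b c d w' x' y' : ℤ, a ^ 2 + b ^ 2 + c ^ 2 + d ^ 2 = p ∧
      w' ^ 2 + x' ^ 2 + y' ^ 2 = w ^ 2 + x ^ 2 + y ^ 2 ∧
      p * w' = (a ^ 2 + b ^ 2 - c ^ 2 - d ^ 2) * w + 2 * (b * c + a * d) * x +
        2 * (b * d - a * c) * y ∧
      p * x' = 2 * (b * c - a * d) * w + (a ^ 2 - b ^ 2 + c ^ 2 - d ^ 2) * x +
        2 * (c * d + a * b) * y ∧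
      p * y' = 2 * (b * d + a * c) * w + 2 * (c * d - a * b) * x +
        (a ^ 2 - b ^ 2 - c ^ 2 + d ^ 2) * y := by
  have hp0 : (0 : ℤ) < p := by exact_mod_cast hp.pos
  have hodd : (p : ℤ) % 2 = 1 := by have := hp.eq_two_or_odd; omega
  obtain ⟨α, hα⟩ : ∃ α : ℍ[ℤ], α = quat m w x y := ⟨_, rfl⟩
  have hαn : normSq α = m ^ 2 + (w ^ 2 + x ^ 2 + y ^ 2) := by
    rw [hα, normSq_def']; simp only [re_quat, imI_quat, imJ_quat, imK_quat]; ring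
  obtain ⟨s, hs⟩ := exists_normSq_sub_smul_lt_s8 hp0 hodd (star α)
  obtain ⟨k, hk⟩ : (p : ℤ) ∣ normSq (star α - (p : ℤ) • s) :=
    (dvd_sub_left (by rwa [normSq_star, hαn])).1 (dvd_normSq_sub_smul p (star α) s)
  have hk0 : 0 < k := by
    have h0 : 0 ≤ k := by
      have := normSq_nonneg (a := star α - (p : ℤ) • s)
      rw [hk] at this
      exact nonneg_of_mul_nonneg_right this hp0
    refine lt_of_le_of_ne h0 fun h => hm ?_
    rw [← h, mul_zero, normSq_eq_zero, sub_eq_zero] at hk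
    exact ⟨s.re, by simpa [hα] using congrArg QuaternionAlgebra.re hk⟩
  have hkp : k < p := by
    rw [hk] at hs
    nlinarith
  lift k to ℕ using hk0.le
  obtain ⟨l, hl⟩ := h
  obtain ⟨q, t, hq, ht⟩ := exists_normSq_eq_of_lt hp hp2 α k (star α - (p : ℤ) • s)
    ((l : ℍ[ℤ]) - α * s) (by omega) (by omega) hk (by
      rw [mul_sub, self_mul_star, hαn, hl, mul_smul_comm, smul_sub]
      congr 1)
  have hconj : (p : ℤ) • (star q * t) = star q * α * q := by
    rw [mul_assoc, ht, mul_smul_comm]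
  have h₂ := congrArg QuaternionAlgebra.imI hconj
  have h₃ := congrArg QuaternionAlgebra.imJ hconj
  have h₄ := congrArg QuaternionAlgebra.imK hconj
  rw [normSq_def'] at hq
  simp only [hα, imI_smul, imJ_smul, imK_smul, smul_eq_mul] at h₂ h₃ h₄
  generalize (star q * t).imI = w' at *
  generalize (star q * t).imJ = x' at *
  generalize (star q * t).imK = y' at *
  simp at h₂ h₃ h₄ hq
  generalize q.re = a at *
  generalize q.imI = b at *
  generalize q.imJ = c at *
  generalize q.imK = d at *
  have e₂ : p * w' = (a ^ 2 + b ^ 2 - c ^ 2 - d ^ 2) * w + 2 * (b * c + a * d) * x +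
      2 * (b * d - a * c) * y := by rw [h₂]; ring
  have e₃ : p * x' = 2 * (b * c - a * d) * w + (a ^ 2 - b ^ 2 + c ^ 2 - d ^ 2) * x +
      2 * (c * d + a * b) * y := by rw [h₃]; ring
  have e₄ : p * y' = 2 * (b * d + a * c) * w + 2 * (c * d - a * b) * x +
      (a ^ 2 - b ^ 2 - c ^ 2 + d ^ 2) * y := by rw [h₄]; ring
  refine ⟨a, b, c, d, w', x', y', hq, ?_, e₂, e₃, e₄⟩
  apply mul_left_cancel₀ (pow_pos hp0 2).ne'
  calc (p : ℤ) ^ 2 * (w' ^ 2 + x' ^ 2 + y' ^ 2) = (p * w') ^ 2 + (p * x') ^ 2 + (p * y') ^ 2 := by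
        ring
    _ = (a ^ 2 + b ^ 2 + c ^ 2 + d ^ 2) ^ 2 * (w ^ 2 + x ^ 2 + y ^ 2) := by
        rw [e₂, e₃, e₄]; ring
    _ = _ := by rw [hq]

end Rotation

section Toggle

open jacobiSym ZMod
open scoped NumberTheorySymbols

theorem exists_odd_prime_mul_not_dvd {N : ℕ} (hN : N % 2 = 1) (hsq : ¬ IsSquare N) :
    ∃ q k M : ℕ, q.Prime ∧ q % 2 = 1 ∧ N = q ^ (2 * k + 1) * M ∧ ¬ q ∣ M := by
  have h0 : N ≠ 0 := by omega
  obtain ⟨q, hq, hodd⟩ : ∃ q, q.Prime ∧ N.factorization q % 2 = 1 := by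
    by_contra! h
    apply hsq
    refine ⟨∏ p ∈ N.primeFactors, p ^ (N.factorization p / 2), ?_⟩
    rw [← Finset.prod_mul_distrib]
    conv_lhs => rw [← Nat.prod_factorization_pow_eq_self h0]
    refine Finset.prod_congr rfl fun p hp => ?_
    rw [← pow_add]
    congr 1
    have := h p (Nat.prime_of_mem_primeFactors hp)
    omega
  refine ⟨q, N.factorization q / 2, N / q ^ N.factorization q, hq, ?_, ?_, ?_⟩
  · obtain rfl | h := hq.eq_two_or_odd
    · rw [Nat.factorization_eq_zero_of_not_dvd (by omega)] at hodd
      omega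
    · exact h
  · rw [show 2 * (N.factorization q / 2) + 1 = N.factorization q by omega]
    exact (Nat.ordProj_mul_ordCompl_eq_self N q).symm
  · exact Nat.not_dvd_ordCompl hq h0

theorem exists_legendreSym_eq_neg_one {q : ℕ} [Fact q.Prime] (hq : q % 2 = 1) :
    ∃ r : ℕ, J(r | q) = -1 := by
  obtain ⟨a, ha⟩ := FiniteField.exists_nonsquare (F := ZMod q) (by rw [ringChar_zmod_n]; omega)
  refine ⟨a.val, ?_⟩
  rw [← jacobiSym.legendreSym.to_jacobiSym]
  apply (legendreSym.eq_neg_one_iff' q).2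
  rwa [ZMod.natCast_zmod_val]

theorem exists_prime_jacobiSym_eq_neg_one {N : ℕ} (hN : N % 8 = 1) (hsq : ¬ IsSquare N) :
    ∃ p : ℕ, p.Prime ∧ p % 8 = 7 ∧ J(N | p) = -1 := by
  obtain ⟨q, k, M, hq, hq2, hNM, hqM⟩ := exists_odd_prime_mul_not_dvd (by omega) hsq
  have := Fact.mk hq
  obtain ⟨s, hs⟩ := exists_legendreSym_eq_neg_one hq2
  have hM2 : M % 2 = 1 := by
    by_contra h
    have : 2 ∣ N := hNM ▸ Dvd.dvd.mul_left (by omega) _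
    omega
  have hcop8 : ∀ {t : ℕ}, t % 2 = 1 → Nat.Coprime 8 t := fun ht =>
    Nat.Coprime.pow_left 3 (Nat.coprime_two_left.2 (Nat.odd_iff.2 ht))
  have hqMc : q.Coprime M := (Nat.Prime.coprime_iff_not_dvd hq).2 hqM
  obtain ⟨u, hu⟩ := Nat.chineseRemainder hqMc s 1
  obtain ⟨r, hr⟩ := Nat.chineseRemainder
    (hcop8 (t := q * M) (by rw [Nat.mul_mod, hq2, hM2])) 7 u
  have hrq : r ≡ s [MOD q] := (hr.2.of_mul_right M).trans hu.1
  have hrM : r ≡ 1 [MOD M] := (hr.2.of_mul_left q).trans hu.2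
  have hJ : ∀ t : ℕ, t ≡ r [MOD 8 * N] → J(t | N) = -1 := by
    intro t ht
    have ht' : t ≡ r [MOD N] := ht.of_mul_left 8
    have htq : t ≡ s [MOD q] :=
      (ht'.of_dvd (hNM ▸ Dvd.dvd.mul_right (dvd_pow_self q (by omega)) M)).trans hrq
    have htM : t ≡ 1 [MOD M] := (ht'.of_dvd (hNM ▸ Dvd.intro_left _ rfl)).trans hrM
    have h1 : J(t | q) = -1 := by
      rw [← hs]
      exact jacobiSym.mod_left' (by exact_mod_cast htq)
    have h2 : J(t | M) = 1 := by
      rw [← jacobiSym.one_left M]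
      exact jacobiSym.mod_left' (by exact_mod_cast htM)
    have : NeZero M := ⟨by omega⟩
    rw [hNM, jacobiSym.mul_right, jacobiSym.pow_right, h1, h2]
    exact (by rw [mul_one]; exact Odd.neg_one_pow ⟨k, rfl⟩)
  have hcop : r.Coprime (8 * N) := by
    refine Nat.Coprime.mul_right ?_ ?_
    · have : r % 8 = 7 := hr.1
      exact (hcop8 (by omega)).symm
    · by_contra h
      have : NeZero N := ⟨by omega⟩
      have h0 : J(r | N) = 0 := jacobiSym.eq_zero_iff_not_coprime.2 (by simpa using h)
      rw [hJ r rfl] at h0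
      omega
  obtain ⟨p, -, hp, hmod⟩ := Nat.forall_exists_prime_gt_and_modEq 0
    (show 8 * N ≠ 0 by omega) hcop
  have hp8 : p % 8 = 7 := (hmod.of_mul_right N).trans hr.1
  refine ⟨p, hp, hp8, ?_⟩
  rw [jacobiSym.quadratic_reciprocity_one_mod_four (by omega) (Nat.odd_iff.2 (by omega))]
  exact hJ p hmod

/-- A nonsquare `N ≡ 1 mod 8` admits a prime `p ≡ 7 mod 8` modulo which `-N` and `-2N` are both
nonzero squares. -/
theorem exists_prime_dvd_sq_add {N : ℕ} (hN : N % 8 = 1) (hsq : ¬ IsSquare N) :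
    ∃ p : ℕ, p.Prime ∧ p % 8 = 7 ∧ (∃ m : ℤ, ¬ (p : ℤ) ∣ m ∧ (p : ℤ) ∣ m ^ 2 + N) ∧
      ∃ m : ℤ, ¬ (p : ℤ) ∣ m ∧ (p : ℤ) ∣ m ^ 2 + 2 * N := by
  obtain ⟨p, hp, hp8, hJ⟩ := exists_prime_jacobiSym_eq_neg_one hN hsq
  have hodd : Odd p := Nat.odd_iff.2 (by omega)
  have hneg : J(-N | p) = 1 := by
    rw [jacobiSym.neg _ hodd, hJ, χ₄_nat_three_mod_four (by omega)]
    norm_num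
  have htwo : J(2 | p) = 1 := by
    rw [at_two hodd, χ₈_nat_eq_if_mod_eight]
    simp [hp8, show p % 2 = 1 by omega]
  have hneg' : J(-(2 * N : ℕ) | p) = 1 := by
    rw [Nat.cast_mul, ← mul_neg, jacobiSym.mul_left, hneg, Nat.cast_ofNat, htwo, one_mul]
  have hmain : ∀ {b : ℕ}, J(-b | p) = 1 → ∃ m : ℤ, ¬ (p : ℤ) ∣ m ∧ (p : ℤ) ∣ m ^ 2 + b := by
    intro b hb
    obtain ⟨m, hm⟩ := exists_dvd_sq_add_of_jacobiSym hp hb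
    refine ⟨m, fun h => ?_, hm⟩
    have hpb : (p : ℤ) ∣ -b := ((dvd_add_right (h.trans (dvd_pow_self m two_ne_zero))).1 hm).neg_right
    rw [jacobiSym.mod_left, Int.emod_eq_zero_of_dvd hpb, jacobiSym.zero_left hp.one_lt] at hb
    omega
  exact ⟨p, hp, hp8, hmain hneg, by simpa using hmain hneg'⟩

end Toggle

section Parity

theorem Int.exists_sq_eq_of_odd {t : ℤ} (ht : t % 2 = 1) : ∃ k, t ^ 2 = 8 * k + 1 := by
  obtain ⟨s, rfl⟩ := Int.odd_iff.2 ht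
  obtain ⟨k, hk⟩ := Int.even_mul_succ_self s
  exact ⟨k, by linear_combination 4 * hk⟩

/-- In a sum of four squares congruent to `7` modulo `8`, exactly one term is even. -/
theorem parity_of_four_squares {a b c d : ℤ} (h : (a ^ 2 + b ^ 2 + c ^ 2 + d ^ 2) % 8 = 7) :
    (a % 4 = 2 ∧ b % 2 = 1 ∧ c % 2 = 1 ∧ d % 2 = 1) ∨
    (a % 2 = 1 ∧ b % 4 = 2 ∧ c % 2 = 1 ∧ d % 2 = 1) ∨
    (a % 2 = 1 ∧ b % 2 = 1 ∧ c % 4 = 2 ∧ d % 2 = 1) ∨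
    (a % 2 = 1 ∧ b % 2 = 1 ∧ c % 2 = 1 ∧ d % 4 = 2) := by
  have key : ∀ t : ℤ, (t % 2 = 1 ∧ t ^ 2 % 8 = 1) ∨ (t % 4 = 2 ∧ t ^ 2 % 8 = 4) ∨
      (t % 4 = 0 ∧ t ^ 2 % 8 = 0) := by
    intro t
    have : t % 8 = 0 ∨ t % 8 = 1 ∨ t % 8 = 2 ∨ t % 8 = 3 ∨ t % 8 = 4 ∨ t % 8 = 5 ∨ t % 8 = 6 ∨
      t % 8 = 7 := by omega
    rcases this with h | h | h | h | h | h | h | h <;> simp [pow_two, Int.mul_emod, h] <;> omega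
  rcases key a with ⟨ha, ha'⟩ | ⟨ha, ha'⟩ | ⟨ha, ha'⟩ <;>
  rcases key b with ⟨hb, hb'⟩ | ⟨hb, hb'⟩ | ⟨hb, hb'⟩ <;>
  rcases key c with ⟨hc, hc'⟩ | ⟨hc, hc'⟩ | ⟨hc, hc'⟩ <;>
  rcases key d with ⟨hd, hd'⟩ | ⟨hd, hd'⟩ | ⟨hd, hd'⟩ <;>
  omega

theorem exists_eq_four_mul {p t w x y e f g : ℤ} (hp : p % 8 = 7) (hw : w % 2 = 1)
    (he : e % 8 = 4) (hf : f % 2 = 1) (hg : g % 2 = 0)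
    (h : p * t = w * e + 4 * y * f + 4 * x * g) : ∃ y', t = 4 * y' ∧ (y' + y) % 2 = 1 := by
  obtain ⟨P, rfl⟩ : ∃ P, p = 8 * P + 7 := ⟨p / 8, by omega⟩
  obtain ⟨W, rfl⟩ : ∃ W, w = 2 * W + 1 := ⟨w / 2, by omega⟩
  obtain ⟨E, rfl⟩ : ∃ E, e = 8 * E + 4 := ⟨e / 8, by omega⟩
  obtain ⟨F, rfl⟩ : ∃ F, f = 2 * F + 1 := ⟨f / 2, by omega⟩
  obtain ⟨G, rfl⟩ : ∃ G, g = 2 * G := ⟨g / 2, by omega⟩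
  have h' : 7 * t = 8 * (2 * W * E + W + E + y * F + x * G - P * t) + 4 + 4 * y := by
    linear_combination h
  exact ⟨t / 4, by omega, by omega⟩

theorem sq_sub_sq_add_two_mul_emod {a b c d : ℤ} (ha : a % 4 = 2) (hb : b % 2 = 1)
    (hc : c % 2 = 1) (hd : d % 2 = 1) : (b ^ 2 - c ^ 2 + 2 * (a * d)) % 8 = 4 := by
  obtain ⟨B, hB⟩ := Int.exists_sq_eq_of_odd hb
  obtain ⟨C, hC⟩ := Int.exists_sq_eq_of_odd hc
  obtain ⟨A, rfl⟩ : ∃ A, a = 4 * A + 2 := ⟨a / 4, by omega⟩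
  obtain ⟨D, rfl⟩ : ∃ D, d = 2 * D + 1 := ⟨d / 2, by omega⟩
  have : b ^ 2 - c ^ 2 + 2 * ((4 * A + 2) * (2 * D + 1)) =
      8 * (B - C + 2 * A * D + A + D) + 4 := by linear_combination hB - hC
  omega

end Parity

/-- A nonsquare `n ≡ 1 mod 8` is moved by a rotation between representations
`n = w² + 4u² + 4v²` with both parities of `u`. -/
theorem exists_sq_add_four_mul_sq_parity_ne {n : ℕ} (hn : n % 8 = 1) (hsq : ¬ IsSquare n)
    {w u v : ℤ} (h : (n : ℤ) = w ^ 2 + 4 * u ^ 2 + 4 * v ^ 2) :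
    ∃ w' u' v' : ℤ, (n : ℤ) = w' ^ 2 + 4 * u' ^ 2 + 4 * v' ^ 2 ∧ (u' + u) % 2 = 1 := by
  obtain ⟨p, hp, hp8, ⟨m, hm, hmd⟩, -⟩ := exists_prime_dvd_sq_add hn hsq
  obtain ⟨a, b, c, d, w', x', y', hpa, hN, hw', hx', hy'⟩ := exists_rotation hp (by omega) hm
    (w := w) (x := 2 * u) (y := 2 * v) (by rw [h] at hmd; convert hmd using 2; ring)
  have hp2 : (p : ℤ) % 8 = 7 := by omega
  have hpar := parity_of_four_squares (hpa ▸ hp2)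
  obtain ⟨P, hP⟩ : ∃ P, (p : ℤ) = 2 * P + 1 := ⟨p / 2, by omega⟩
  have hw : w % 2 = 1 := by
    by_contra hw
    obtain ⟨W, rfl⟩ : ∃ W, w = 2 * W := ⟨w / 2, by omega⟩
    ring_nf at h
    omega
  have hx2 : ∃ u', x' = 2 * u' := ⟨(b * c - a * d) * w + (a ^ 2 - b ^ 2 + c ^ 2 - d ^ 2) * u +
    2 * (c * d + a * b) * v - P * x', by rw [hP] at hx'; linear_combination hx'⟩
  have hy2 : ∃ v', y' = 2 * v' := ⟨(b * d + a * c) * w + (a ^ 2 - b ^ 2 - c ^ 2 + d ^ 2) * v +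
    2 * (c * d - a * b) * u - P * y', by rw [hP] at hy'; linear_combination hy'⟩
  obtain ⟨u', rfl⟩ := hx2
  obtain ⟨v', rfl⟩ := hy2
  refine ⟨w', u', v', by rw [h]; linear_combination -hN, ?_⟩
  have hodd : ¬ Even (b * c - a * d) := by
    simp only [Int.even_sub, Int.even_mul]
    simp only [Int.even_iff]
    omega
  have hu : u' + u = (b * c - a * d) * w + 2 * ((P + 1 - b ^ 2 - d ^ 2) * u +
      (c * d + a * b) * v - P * u') := by
    rw [hP] at hx' hpa
    apply mul_left_cancel₀ (two_ne_zero' ℤ)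
    linear_combination hx' + 2 * u * hpa
  have : (b * c - a * d) * w % 2 = 1 := by
    rw [← Int.odd_iff]
    exact (Int.not_even_iff_odd.1 hodd).mul (Int.odd_iff.2 hw)
  omega

/-- A nonsquare `n ≡ 1 mod 8` is moved by a rotation between representations
`n = w² + 16y² + 8x²` with both parities of `y`. -/
theorem exists_sq_add_sixteen_mul_sq_parity_ne {n : ℕ} (hn : n % 8 = 1) (hsq : ¬ IsSquare n)
    {w x y : ℤ} (h : (n : ℤ) = w ^ 2 + 16 * y ^ 2 + 8 * x ^ 2) :
    ∃ w' x' y' : ℤ, (n : ℤ) = w' ^ 2 + 16 * y' ^ 2 + 8 * x' ^ 2 ∧ (y' + y) % 2 = 1 := by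
  obtain ⟨p, hp, hp8, -, m, hm, hmd⟩ := exists_prime_dvd_sq_add hn hsq
  obtain ⟨a, b, c, d, U, V, Z, hpa, hN, hU, hV, hZ⟩ := exists_rotation hp (by omega) hm
    (w := w + 4 * y) (x := w - 4 * y) (y := 4 * x) (by
      rw [h] at hmd; convert hmd using 2; ring)
  have hp2 : (p : ℤ) % 8 = 7 := by omega
  have hpar := parity_of_four_squares (hpa ▸ hp2)
  obtain ⟨P, hP⟩ : ∃ P, (p : ℤ) = 8 * P + 7 := ⟨p / 8, by omega⟩
  have hw : w % 2 = 1 := by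
    by_contra hw
    obtain ⟨W, rfl⟩ : ∃ W, w = 2 * W := ⟨w / 2, by omega⟩
    ring_nf at h
    omega
  have hUV : (U + V) % 2 = 0 := by
    have : U + V = 2 * (w * (a ^ 2 - d ^ 2 + 2 * (b * c)) +
        4 * y * (b ^ 2 - c ^ 2 - 2 * (a * d)) + 4 * x * (b * d - a * c + c * d + a * b) -
        (4 * P + 3) * (U + V)) := by
      rw [hP] at hU hV
      linear_combination hU + hV
    omega
  obtain ⟨A, B, rfl, rfl⟩ : ∃ A B, U = A + B ∧ V = A - B :=
    ⟨(U + V) / 2, (U - V) / 2, by omega, by omega⟩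
  have hA : p * A = w * (a ^ 2 - d ^ 2 + 2 * (b * c)) +
      4 * y * (b ^ 2 - c ^ 2 - 2 * (a * d)) + 4 * x * (b * d - a * c + c * d + a * b) := by
    apply mul_left_cancel₀ (two_ne_zero' ℤ)
    linear_combination hU + hV
  have hB : p * B = w * (b ^ 2 - c ^ 2 + 2 * (a * d)) +
      4 * y * (a ^ 2 - d ^ 2 - 2 * (b * c)) + 4 * x * (b * d - a * c - c * d - a * b) := by
    apply mul_left_cancel₀ (two_ne_zero' ℤ)
    linear_combination hU - hV
  have hZ4 : ∃ z, Z = 4 * z := by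
    have h1 : (b * d + a * c + c * d - a * b) % 2 = 0 := by
      rw [← Int.even_iff]
      simp only [Int.even_sub, Int.even_add, Int.even_mul]
      simp only [Int.even_iff]
      omega
    obtain ⟨e, he⟩ : ∃ e, b * d + a * c + c * d - a * b = 2 * e :=
      Int.dvd_of_emod_eq_zero h1
    refine ⟨2 * (P + 1) * Z - (e * w + 2 * (b * d + a * c - c * d + a * b) * y +
      (a ^ 2 - b ^ 2 - c ^ 2 + d ^ 2) * x), ?_⟩
    rw [hP] at hZ
    linear_combination -hZ - 2 * w * he
  obtain ⟨z, rfl⟩ := hZ4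
  have hrep : (n : ℤ) = A ^ 2 + B ^ 2 + 8 * z ^ 2 := by
    apply mul_left_cancel₀ (two_ne_zero' ℤ)
    rw [h]; linear_combination -hN
  have hbd : (b * d - a * c - c * d - a * b) % 2 = 0 ∧
      (b * d - a * c + c * d + a * b) % 2 = 0 := by
    simp only [← Int.even_iff, Int.even_sub, Int.even_add, Int.even_mul]
    simp only [Int.even_iff]
    omega
  have hcase : ((b ^ 2 - c ^ 2 + 2 * (a * d)) % 8 = 4 ∧ (a ^ 2 - d ^ 2 - 2 * (b * c)) % 2 = 1) ∨
      ((a ^ 2 - d ^ 2 + 2 * (b * c)) % 8 = 4 ∧ (b ^ 2 - c ^ 2 - 2 * (a * d)) % 2 = 1) := by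
    have hparity : ∀ s t e : ℤ, (s + t) % 2 = 1 →
        (s ^ 2 - t ^ 2 - 2 * e) % 2 = 1 := by
      intro s t e hst
      simp only [← Int.odd_iff, ← Int.not_even_iff_odd, Int.even_sub, Int.even_add, Int.even_mul,
        Int.even_pow] at hst ⊢
      simp only [Int.even_iff] at hst ⊢
      omega
    rcases hpar with ⟨ha, hb, hc, hd⟩ | ⟨ha, hb, hc, hd⟩ | ⟨ha, hb, hc, hd⟩ | ⟨ha, hb, hc, hd⟩
    · exact Or.inl ⟨sq_sub_sq_add_two_mul_emod ha hb hc hd, hparity a d _ (by omega)⟩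
    · exact Or.inr ⟨sq_sub_sq_add_two_mul_emod hb ha hd hc, hparity b c _ (by omega)⟩
    · exact Or.inr ⟨mul_comm b c ▸ sq_sub_sq_add_two_mul_emod hc ha hd hb,
        hparity b c _ (by omega)⟩
    · exact Or.inl ⟨mul_comm a d ▸ sq_sub_sq_add_two_mul_emod hd hb hc ha,
        hparity a d _ (by omega)⟩
  rcases hcase with ⟨he, hf⟩ | ⟨he, hf⟩
  · obtain ⟨y', rfl, hy'⟩ := exists_eq_four_mul hp2 hw he hf hbd.1 hB
    exact ⟨A, z, y', by rw [hrep]; ring, hy'⟩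
  · obtain ⟨y', rfl, hy'⟩ := exists_eq_four_mul hp2 hw he hf hbd.2 hA
    exact ⟨B, z, y', by rw [hrep]; ring, hy'⟩

section Representations

theorem Int.sq_emod_four (t : ℤ) : t % 2 = 0 ∧ t ^ 2 % 4 = 0 ∨ t % 2 = 1 ∧ t ^ 2 % 4 = 1 := by
  obtain h | h := Int.emod_two_eq_zero_or_one t
  · obtain ⟨s, rfl⟩ := Int.dvd_of_emod_eq_zero h
    exact Or.inl ⟨h, by rw [mul_pow]; omega⟩
  · obtain ⟨k, hk⟩ := Int.exists_sq_eq_of_odd h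
    exact Or.inr ⟨h, by omega⟩

theorem exists_odd_sq_add_four_mul {n : ℕ} (hn : n % 4 = 1) :
    ∃ w u v : ℤ, w % 2 = 1 ∧ (n : ℤ) = w ^ 2 + 4 * u ^ 2 + 4 * v ^ 2 := by
  obtain ⟨x, y, z, h⟩ := eq_sq_add_sq_add_sq_of_mod_four_eq_one hn
  have hx := Int.sq_emod_four x
  have hy := Int.sq_emod_four y
  have hz := Int.sq_emod_four z
  have hcase : (x % 2 = 1 ∧ y % 2 = 0 ∧ z % 2 = 0) ∨ (x % 2 = 0 ∧ y % 2 = 1 ∧ z % 2 = 0) ∨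
    (x % 2 = 0 ∧ y % 2 = 0 ∧ z % 2 = 1) := by omega
  rcases hcase with ⟨hx, hy, hz⟩ | ⟨hx, hy, hz⟩ | ⟨hx, hy, hz⟩
  · obtain ⟨u, rfl⟩ := Int.dvd_of_emod_eq_zero hy
    obtain ⟨v, rfl⟩ := Int.dvd_of_emod_eq_zero hz
    exact ⟨x, u, v, hx, by linarith⟩
  · obtain ⟨u, rfl⟩ := Int.dvd_of_emod_eq_zero hx
    obtain ⟨v, rfl⟩ := Int.dvd_of_emod_eq_zero hz
    exact ⟨y, u, v, hy, by linarith⟩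
  · obtain ⟨u, rfl⟩ := Int.dvd_of_emod_eq_zero hx
    obtain ⟨v, rfl⟩ := Int.dvd_of_emod_eq_zero hy
    exact ⟨z, u, v, hz, by linarith⟩

theorem exists_odd_sq_add_four_mul_add_two_mul {n : ℕ} (hn : n % 2 = 1) :
    ∃ w y x : ℤ, w % 2 = 1 ∧ (n : ℤ) = w ^ 2 + 4 * y ^ 2 + 2 * x ^ 2 := by
  have key : ∀ x y z : ℤ, x % 2 = 1 → y % 2 = 1 → z % 2 = 0 → 2 * (n : ℤ) = x ^ 2 + y ^ 2 + z ^ 2 →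
      ∃ w y x : ℤ, w % 2 = 1 ∧ (n : ℤ) = w ^ 2 + 4 * y ^ 2 + 2 * x ^ 2 := by
    intro x y z hx hy hz h
    obtain ⟨a, rfl⟩ : ∃ a, x = 2 * a + 1 := ⟨x / 2, by omega⟩
    obtain ⟨b, rfl⟩ : ∃ b, y = 2 * b + 1 := ⟨y / 2, by omega⟩
    obtain ⟨c, rfl⟩ := Int.dvd_of_emod_eq_zero hz
    have h' : (n : ℤ) = (a + b + 1) ^ 2 + (a - b) ^ 2 + 2 * c ^ 2 := by
      apply mul_left_cancel₀ (two_ne_zero' ℤ)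
      linear_combination h
    obtain hab | hab := Int.emod_two_eq_zero_or_one (a - b)
    · obtain ⟨d, hd⟩ := Int.dvd_of_emod_eq_zero hab
      exact ⟨a + b + 1, d, c, by omega, by rw [h', hd]; ring⟩
    · obtain ⟨d, hd⟩ : ∃ d, a + b + 1 = 2 * d := ⟨(a + b + 1) / 2, by omega⟩
      exact ⟨a - b, d, c, hab, by rw [h', hd]; ring⟩
  obtain ⟨x, y, z, h⟩ := eq_sq_add_sq_add_sq_of_mod_four_eq_two (n := 2 * n) (by omega)
  push_cast at h
  have hx := Int.sq_emod_four x
  have hy := Int.sq_emod_four y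
  have hz := Int.sq_emod_four z
  have hcase : (x % 2 = 0 ∧ y % 2 = 1 ∧ z % 2 = 1) ∨ (x % 2 = 1 ∧ y % 2 = 0 ∧ z % 2 = 1) ∨
    (x % 2 = 1 ∧ y % 2 = 1 ∧ z % 2 = 0) := by omega
  rcases hcase with ⟨hx, hy, hz⟩ | ⟨hx, hy, hz⟩ | ⟨hx, hy, hz⟩
  · exact key y z x hy hz hx (by linarith)
  · exact key x z y hx hz hy (by linarith)
  · exact key x y z hx hy hz h

theorem exists_odd_sq_add_four_mul_add_eight_mul {n : ℕ} (hn : n % 4 = 1) :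
    ∃ w y x : ℤ, w % 2 = 1 ∧ (n : ℤ) = w ^ 2 + 4 * y ^ 2 + 8 * x ^ 2 := by
  obtain ⟨w, y, x, hw, h⟩ := exists_odd_sq_add_four_mul_add_two_mul (n := n) (by omega)
  have hw' := Int.sq_emod_four w
  have hx := Int.sq_emod_four x
  obtain ⟨c, rfl⟩ : ∃ c, x = 2 * c := ⟨x / 2, by omega⟩
  exact ⟨w, y, c, hw, by linarith⟩

theorem exists_odd_sq_add_sixteen_mul_add_eight_mul {n : ℕ} (hn : n % 8 = 1) :
    ∃ w y x : ℤ, w % 2 = 1 ∧ (n : ℤ) = w ^ 2 + 16 * y ^ 2 + 8 * x ^ 2 := by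
  obtain ⟨w, y, x, hw, h⟩ := exists_odd_sq_add_four_mul_add_eight_mul (n := n) (by omega)
  obtain ⟨k, hk⟩ := Int.exists_sq_eq_of_odd hw
  have hy := Int.sq_emod_four y
  obtain ⟨c, rfl⟩ : ∃ c, y = 2 * c := ⟨y / 2, by omega⟩
  exact ⟨w, c, x, hw, by linarith⟩

theorem sq_emod_two_of_sq_add_eq {n : ℕ} (hn : n % 8 = 1) {w u v : ℤ}
    (h : (n : ℤ) = w ^ 2 + 4 * u ^ 2 + 4 * v ^ 2) : w % 2 = 1 ∧ (u + v) % 2 = 0 := by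
  have hw := Int.sq_emod_four w
  obtain ⟨k, hk⟩ := Int.exists_sq_eq_of_odd (t := w) (by omega)
  have hu := Int.sq_emod_four u
  have hv := Int.sq_emod_four v
  omega

theorem exists_odd_sq_of_isSquare {n : ℕ} (hn : n % 2 = 1) (h : IsSquare n) :
    ∃ w : ℤ, w % 2 = 1 ∧ (n : ℤ) = w ^ 2 := by
  obtain ⟨w, rfl⟩ := h
  refine ⟨w, ?_, by push_cast; ring⟩
  have := Int.sq_emod_four w
  have h2 : (w : ℤ) ^ 2 = (w * w : ℕ) := by push_cast; ring
  omega

theorem exists_odd_sq_add_eight_mul_add_thirtytwo_mul {n : ℕ} (hn : n % 8 = 1) :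
    ∃ w x y : ℤ, w % 2 = 1 ∧ (n : ℤ) = w ^ 2 + 8 * x ^ 2 + 32 * y ^ 2 := by
  by_cases hsq : IsSquare n
  · obtain ⟨w, hw, h⟩ := exists_odd_sq_of_isSquare (by omega) hsq
    exact ⟨w, 0, 0, hw, by rw [h]; ring⟩
  obtain ⟨w, u, v, hu, h⟩ : ∃ w u v : ℤ, u % 2 = 1 ∧ (n : ℤ) = w ^ 2 + 4 * u ^ 2 + 4 * v ^ 2 := by
    obtain ⟨w, u, v, -, h⟩ := exists_odd_sq_add_four_mul (n := n) (by omega)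
    obtain hu | hu := Int.emod_two_eq_zero_or_one u
    · obtain ⟨w', u', v', h', hu'⟩ := exists_sq_add_four_mul_sq_parity_ne hn hsq h
      exact ⟨w', u', v', by omega, h'⟩
    · exact ⟨w, u, v, hu, h⟩
  obtain ⟨hw, huv⟩ := sq_emod_two_of_sq_add_eq hn h
  obtain ⟨p, q, rfl, rfl⟩ : ∃ p q, u = p + q ∧ v = p - q :=
    ⟨(u + v) / 2, (u - v) / 2, by omega, by omega⟩
  obtain hp | hp := Int.emod_two_eq_zero_or_one p
  · obtain ⟨c, rfl⟩ := Int.dvd_of_emod_eq_zero hp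
    exact ⟨w, q, c, hw, by rw [h]; ring⟩
  · obtain ⟨c, rfl⟩ : ∃ c, q = 2 * c := ⟨q / 2, by omega⟩
    exact ⟨w, p, c, hw, by rw [h]; ring⟩

theorem exists_odd_sq_add_sixteen_mul {n : ℕ} (hn : n % 8 = 1) :
    ∃ w x y : ℤ, w % 2 = 1 ∧ (n : ℤ) = w ^ 2 + 16 * x ^ 2 + 16 * y ^ 2 := by
  by_cases hsq : IsSquare n
  · obtain ⟨w, hw, h⟩ := exists_odd_sq_of_isSquare (by omega) hsq
    exact ⟨w, 0, 0, hw, by rw [h]; ring⟩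
  obtain ⟨w, u, v, hu, h⟩ : ∃ w u v : ℤ, u % 2 = 0 ∧ (n : ℤ) = w ^ 2 + 4 * u ^ 2 + 4 * v ^ 2 := by
    obtain ⟨w, u, v, -, h⟩ := exists_odd_sq_add_four_mul (n := n) (by omega)
    obtain hu | hu := Int.emod_two_eq_zero_or_one u
    · exact ⟨w, u, v, hu, h⟩
    · obtain ⟨w', u', v', h', hu'⟩ := exists_sq_add_four_mul_sq_parity_ne hn hsq h
      exact ⟨w', u', v', by omega, h'⟩
  obtain ⟨hw, huv⟩ := sq_emod_two_of_sq_add_eq hn h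
  obtain ⟨c, rfl⟩ := Int.dvd_of_emod_eq_zero hu
  obtain ⟨d, rfl⟩ : ∃ d, v = 2 * d := ⟨v / 2, by omega⟩
  exact ⟨w, c, d, hw, by rw [h]; ring⟩

theorem exists_odd_sq_add_four_mul_add_sixteen_mul {n : ℕ} (hn : n % 4 = 1) :
    ∃ w x y : ℤ, w % 2 = 1 ∧ (n : ℤ) = w ^ 2 + 4 * x ^ 2 + 16 * y ^ 2 := by
  obtain h8 | h8 : n % 8 = 1 ∨ n % 8 = 5 := by omega
  · obtain ⟨w, x, y, hw, h⟩ := exists_odd_sq_add_sixteen_mul h8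
    exact ⟨w, 2 * x, y, hw, by rw [h]; ring⟩
  · obtain ⟨w, u, v, hw, h⟩ := exists_odd_sq_add_four_mul hn
    obtain ⟨k, hk⟩ := Int.exists_sq_eq_of_odd hw
    have hu := Int.sq_emod_four u
    have hv := Int.sq_emod_four v
    obtain hu | hv : u % 2 = 0 ∨ v % 2 = 0 := by omega
    · obtain ⟨c, rfl⟩ := Int.dvd_of_emod_eq_zero hu
      exact ⟨w, v, c, hw, by rw [h]; ring⟩
    · obtain ⟨c, rfl⟩ := Int.dvd_of_emod_eq_zero hv
      exact ⟨w, u, c, hw, by rw [h]; ring⟩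

theorem exists_odd_sq_add_eight_mul_add_sixtyfour_mul {n : ℕ} (hn : n % 8 = 1) :
    ∃ w x y : ℤ, w % 2 = 1 ∧ (n : ℤ) = w ^ 2 + 8 * x ^ 2 + 64 * y ^ 2 := by
  by_cases hsq : IsSquare n
  · obtain ⟨w, hw, h⟩ := exists_odd_sq_of_isSquare (by omega) hsq
    exact ⟨w, 0, 0, hw, by rw [h]; ring⟩
  obtain ⟨w, y, x, hy, h⟩ : ∃ w y x : ℤ, y % 2 = 0 ∧ (n : ℤ) = w ^ 2 + 16 * y ^ 2 + 8 * x ^ 2 := by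
    obtain ⟨w, y, x, -, h⟩ := exists_odd_sq_add_sixteen_mul_add_eight_mul hn
    obtain hy | hy := Int.emod_two_eq_zero_or_one y
    · exact ⟨w, y, x, hy, h⟩
    · obtain ⟨w', x', y', h', hy'⟩ := exists_sq_add_sixteen_mul_sq_parity_ne hn hsq h
      exact ⟨w', y', x', by omega, h'⟩
  have hw := Int.sq_emod_four w
  obtain ⟨c, rfl⟩ := Int.dvd_of_emod_eq_zero hy
  exact ⟨w, x, c, by omega, by rw [h]; ring⟩

theorem exists_sq_add_three_mul_sq_eq (s t : ℤ) :
    ∃ x y : ℤ, x ^ 2 + 3 * y ^ 2 = s ^ 2 + s * t + t ^ 2 := by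
  obtain hs | hs := Int.emod_two_eq_zero_or_one s
  · obtain ⟨c, rfl⟩ := Int.dvd_of_emod_eq_zero hs
    exact ⟨t + c, c, by ring⟩
  · obtain ht | ht := Int.emod_two_eq_zero_or_one t
    · obtain ⟨c, rfl⟩ := Int.dvd_of_emod_eq_zero ht
      exact ⟨s + c, c, by ring⟩
    · obtain ⟨x, y, rfl, rfl⟩ : ∃ x y, s = x + y ∧ t = y - x :=
        ⟨(s - t) / 2, (s + t) / 2, by omega, by omega⟩
      exact ⟨x, y, by ring⟩

theorem exists_odd_sq_add_eight_mul_add_twentyfour_mul {n : ℕ} (hn : n % 8 = 1) :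
    ∃ w x y : ℤ, w % 2 = 1 ∧ (n : ℤ) = w ^ 2 + 8 * x ^ 2 + 24 * y ^ 2 := by
  obtain ⟨w, s, t, h⟩ := eq_sq_add_two_mul_of_mod_eight_eq_one hn
  have hw : w % 2 = 1 := by
    have := Int.sq_emod_four w
    omega
  obtain ⟨k, hk⟩ := Int.exists_sq_eq_of_odd hw
  have hst : s % 2 = 0 ∧ t % 2 = 0 := by
    have h4 : Even (s ^ 2 + s * t + t ^ 2) := Int.even_iff.2 (by omega)
    simp only [Int.even_add, Int.even_mul, Int.even_pow] at h4
    simp only [Int.even_iff] at h4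
    omega
  obtain ⟨c, rfl⟩ := Int.dvd_of_emod_eq_zero hst.1
  obtain ⟨d, rfl⟩ := Int.dvd_of_emod_eq_zero hst.2
  obtain ⟨x, y, hxy⟩ := exists_sq_add_three_mul_sq_eq c d
  exact ⟨w, x, y, hw, by linear_combination h - 8 * hxy⟩

theorem exists_odd_sq_add_eight_mul {n : ℕ} (hn : n % 8 = 1) :
    ∃ w x y : ℤ, w % 2 = 1 ∧ (n : ℤ) = w ^ 2 + 8 * x ^ 2 + 8 * y ^ 2 := by
  obtain ⟨w, u, v, -, h⟩ := exists_odd_sq_add_four_mul (n := n) (by omega)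
  obtain ⟨hw, huv⟩ := sq_emod_two_of_sq_add_eq hn h
  obtain ⟨p, q, rfl, rfl⟩ : ∃ p q, u = p + q ∧ v = p - q :=
    ⟨(u + v) / 2, (u - v) / 2, by omega, by omega⟩
  exact ⟨w, p, q, hw, by rw [h]; ring⟩

end Representations

section Triangular

theorem triZ_two_mul (z : ℤ) : 2 * triZ z = z * (z + 1) :=
  Int.mul_ediv_cancel' (Int.even_mul_succ_self z).two_dvd

theorem exists_eq_of_eight_mul_add {a b c n : ℕ}
    (h : ∃ x y w : ℤ, w % 2 = 1 ∧ 8 * (n : ℤ) + c = 8 * a * x ^ 2 + 8 * b * y ^ 2 + c * w ^ 2) :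
    ∃ x y z : ℤ, (n : ℤ) = a * x ^ 2 + b * y ^ 2 + c * triZ z := by
  obtain ⟨x, y, w, hw, h⟩ := h
  obtain ⟨z, rfl⟩ : ∃ z, w = 2 * z + 1 := ⟨w / 2, by omega⟩
  refine ⟨x, y, z, ?_⟩
  apply mul_left_cancel₀ (show (8 : ℤ) ≠ 0 by norm_num)
  linear_combination h - 4 * c * triZ_two_mul z

theorem exists_eq_of_mem {a b c : ℕ} (h : (a, b, c) = (1, 1, 1) ∨ (a, b, c) = (1, 1, 2) ∨
    (a, b, c) = (1, 2, 1) ∨ (a, b, c) = (1, 2, 2) ∨ (a, b, c) = (1, 2, 4) ∨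
    (a, b, c) = (1, 3, 1) ∨ (a, b, c) = (1, 4, 1) ∨ (a, b, c) = (1, 4, 2) ∨
    (a, b, c) = (1, 8, 1) ∨ (a, b, c) = (2, 2, 1)) (n : ℕ) :
    ∃ x y z : ℤ, (n : ℤ) = a * x ^ 2 + b * y ^ 2 + c * triZ z := by
  apply exists_eq_of_eight_mul_add
  simp only [Prod.mk.injEq] at h
  rcases h with ⟨rfl, rfl, rfl⟩ | ⟨rfl, rfl, rfl⟩ | ⟨rfl, rfl, rfl⟩ | ⟨rfl, rfl, rfl⟩ |
    ⟨rfl, rfl, rfl⟩ | ⟨rfl, rfl, rfl⟩ | ⟨rfl, rfl, rfl⟩ | ⟨rfl, rfl, rfl⟩ | ⟨rfl, rfl, rfl⟩ |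
    ⟨rfl, rfl, rfl⟩
  · obtain ⟨w, x, y, hw, h⟩ := exists_odd_sq_add_eight_mul (n := 8 * n + 1) (by omega)
    exact ⟨x, y, w, hw, by push_cast at h ⊢; linear_combination h⟩
  · obtain ⟨w, x, y, hw, h⟩ := exists_odd_sq_add_four_mul (n := 4 * n + 1) (by omega)
    exact ⟨x, y, w, hw, by push_cast at h ⊢; linear_combination 2 * h⟩
  · obtain ⟨w, y, x, hw, h⟩ :=
      exists_odd_sq_add_sixteen_mul_add_eight_mul (n := 8 * n + 1) (by omega)
    exact ⟨x, y, w, hw, by push_cast at h ⊢; linear_combination h⟩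
  · obtain ⟨w, x, y, hw, h⟩ :=
      exists_odd_sq_add_four_mul_add_eight_mul (n := 4 * n + 1) (by omega)
    exact ⟨x, y, w, hw, by push_cast at h ⊢; linear_combination 2 * h⟩
  · obtain ⟨w, y, x, hw, h⟩ :=
      exists_odd_sq_add_four_mul_add_two_mul (n := 2 * n + 1) (by omega)
    exact ⟨x, y, w, hw, by push_cast at h ⊢; linear_combination 4 * h⟩
  · obtain ⟨w, x, y, hw, h⟩ :=
      exists_odd_sq_add_eight_mul_add_twentyfour_mul (n := 8 * n + 1) (by omega)
    exact ⟨x, y, w, hw, by push_cast at h ⊢; linear_combination h⟩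
  · obtain ⟨w, x, y, hw, h⟩ :=
      exists_odd_sq_add_eight_mul_add_thirtytwo_mul (n := 8 * n + 1) (by omega)
    exact ⟨x, y, w, hw, by push_cast at h ⊢; linear_combination h⟩
  · obtain ⟨w, x, y, hw, h⟩ :=
      exists_odd_sq_add_four_mul_add_sixteen_mul (n := 4 * n + 1) (by omega)
    exact ⟨x, y, w, hw, by push_cast at h ⊢; linear_combination 2 * h⟩
  · obtain ⟨w, x, y, hw, h⟩ :=
      exists_odd_sq_add_eight_mul_add_sixtyfour_mul (n := 8 * n + 1) (by omega)
    exact ⟨x, y, w, hw, by push_cast at h ⊢; linear_combination h⟩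
  · obtain ⟨w, x, y, hw, h⟩ := exists_odd_sq_add_sixteen_mul (n := 8 * n + 1) (by omega)
    exact ⟨x, y, w, hw, by push_cast at h ⊢; linear_combination h⟩

end Triangular

section Necessity

theorem exists_nat_eq_of_eq {a b c n : ℕ} (ha : 0 < a) (hb : 0 < b) (hc : 0 < c)
    (h : ∃ x y z : ℤ, (n : ℤ) = a * x ^ 2 + b * y ^ 2 + c * triZ z) (s r : ℕ)
    (hs : n < (s + 1) ^ 2) (hr : 2 * n < (r + 1) ^ 2) :
    ∃ x ≤ s, ∃ y ≤ s, ∃ k ≤ r, n = a * x ^ 2 + b * y ^ 2 + c * (k * (k + 1) / 2) := by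
  have key : ∀ {m l : ℕ}, m ^ 2 < (l + 1) ^ 2 → m ≤ l := fun h =>
    Nat.le_of_lt_succ (lt_of_pow_lt_pow_left₀ 2 (Nat.zero_le _) h)
  obtain ⟨x, y, z, h⟩ := h
  obtain ⟨k, hk⟩ : ∃ k : ℕ, triZ z = (k * (k + 1) / 2 : ℕ) := by
    obtain ⟨k, rfl | rfl⟩ : ∃ k : ℕ, z = k ∨ z = -k - 1 := by
      obtain hz | hz := le_or_gt 0 z
      · exact ⟨z.toNat, by omega⟩
      · exact ⟨(-z - 1).toNat, by omega⟩
    · exact ⟨k, by simp [triZ]⟩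
    · refine ⟨k, ?_⟩
      rw [triZ]
      push_cast
      congr 1
      ring
  have hn : n = a * x.natAbs ^ 2 + b * y.natAbs ^ 2 + c * (k * (k + 1) / 2) := by
    zify
    rw [h, hk, sq_abs, sq_abs]
    push_cast
    rfl
  have hx := Nat.le_mul_of_pos_left (x.natAbs ^ 2) ha
  have hy := Nat.le_mul_of_pos_left (y.natAbs ^ 2) hb
  have hT := Nat.le_mul_of_pos_left (k * (k + 1) / 2) hc
  have hk2 : 2 * (k * (k + 1) / 2) = k ^ 2 + k := by
    rw [Nat.mul_div_cancel' (Nat.even_mul_succ_self k).two_dvd]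
    ring
  exact ⟨x.natAbs, key (by omega),
    y.natAbs, key (by omega),
    k, key (by omega), hn⟩

theorem mem_of_forall_exists_eq {a b c : ℕ} (ha : 0 < a) (hb : 0 < b) (hc : 0 < c) (hab : a ≤ b)
    (h : ∀ n : ℕ, ∃ x y z : ℤ, (n : ℤ) = a * x ^ 2 + b * y ^ 2 + c * triZ z) :
    (a, b, c) = (1, 1, 1) ∨ (a, b, c) = (1, 1, 2) ∨ (a, b, c) = (1, 2, 1) ∨
    (a, b, c) = (1, 2, 2) ∨ (a, b, c) = (1, 2, 4) ∨ (a, b, c) = (1, 3, 1) ∨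
    (a, b, c) = (1, 4, 1) ∨ (a, b, c) = (1, 4, 2) ∨ (a, b, c) = (1, 8, 1) ∨
    (a, b, c) = (2, 2, 1) := by
  have rep := fun n => exists_nat_eq_of_eq ha hb hc (h n)
  have unit_coeff : a = 1 ∨ c = 1 := by
    obtain ⟨x, hx, y, hy, k, hk, e⟩ := rep 1 1 1 (by norm_num) (by norm_num)
    interval_cases x <;> interval_cases y <;> interval_cases k <;> omega
  have small_coeffs : a ≤ 2 ∧ (b ≤ 2 ∨ c ≤ 2) := by
    obtain ⟨x, hx, y, hy, k, hk, e⟩ := rep 2 1 2 (by norm_num) (by norm_num)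
    interval_cases x <;> interval_cases y <;> interval_cases k <;> omega
  have c_le_of_b_eq_one : b = 1 → c ≤ 3 := by
    obtain ⟨x, hx, y, hy, k, hk, e⟩ := rep 3 1 2 (by norm_num) (by norm_num)
    interval_cases x <;> interval_cases y <;> interval_cases k <;> omega
  have b_le_of_a_eq_two : a = 2 → b ≤ 4 := by
    obtain ⟨x, hx, y, hy, k, hk, e⟩ := rep 4 2 2 (by norm_num) (by norm_num)
    interval_cases x <;> interval_cases y <;> interval_cases k <;> omega
  have b_c_le_of_a_eq_one : a = 1 → (b = 2 → c ≤ 5) ∧ (c = 2 → b ≤ 5) := by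
    obtain ⟨x, hx, y, hy, k, hk, e⟩ := rep 5 2 3 (by norm_num) (by norm_num)
    interval_cases x <;> interval_cases y <;> interval_cases k <;> omega
  have b_le_of_a_c_eq_one : a = 1 → c = 1 → b ≤ 8 := by
    obtain ⟨x, hx, y, hy, k, hk, e⟩ := rep 8 2 4 (by norm_num) (by norm_num)
    interval_cases x <;> interval_cases y <;> interval_cases k <;> omega
  have hcase : ((a, b, c) = (1, 1, 1) ∨ (a, b, c) = (1, 1, 2) ∨ (a, b, c) = (1, 2, 1) ∨
      (a, b, c) = (1, 2, 2) ∨ (a, b, c) = (1, 2, 4) ∨ (a, b, c) = (1, 3, 1) ∨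
      (a, b, c) = (1, 4, 1) ∨ (a, b, c) = (1, 4, 2) ∨ (a, b, c) = (1, 8, 1) ∨
      (a, b, c) = (2, 2, 1)) ∨
      ((a = 1 ∧ b = 5 ∧ c = 1) ∨ (a = 1 ∧ b = 6 ∧ c = 1) ∨
      (a = 1 ∧ b = 7 ∧ c = 1) ∨ (a = 1 ∧ b = 3 ∧ c = 2) ∨
      (a = 1 ∧ b = 5 ∧ c = 2) ∨ (a = 1 ∧ b = 1 ∧ c = 3) ∨
      (a = 1 ∧ b = 2 ∧ c = 3) ∨ (a = 1 ∧ b = 2 ∧ c = 5) ∨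
      (a = 2 ∧ b = 3 ∧ c = 1) ∨ (a = 2 ∧ b = 4 ∧ c = 1)) := by
    clear h rep
    have hb8 : b ≤ 8 := by omega
    have hc5 : c ≤ 5 := by omega
    have ha2 := small_coeffs.1
    interval_cases a <;> interval_cases b <;> interval_cases c <;> simp_all
  refine hcase.resolve_right fun hcase => ?_
  rcases hcase with ⟨rfl, rfl, rfl⟩ | ⟨rfl, rfl, rfl⟩ | ⟨rfl, rfl, rfl⟩ | ⟨rfl, rfl, rfl⟩ |
    ⟨rfl, rfl, rfl⟩ | ⟨rfl, rfl, rfl⟩ | ⟨rfl, rfl, rfl⟩ | ⟨rfl, rfl, rfl⟩ | ⟨rfl, rfl, rfl⟩ |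
    ⟨rfl, rfl, rfl⟩
  · exact absurd (rep 13 3 5 (by norm_num) (by norm_num)) (by decide)
  · exact absurd (rep 47 6 9 (by norm_num) (by norm_num)) (by decide)
  · exact absurd (rep 20 4 6 (by norm_num) (by norm_num)) (by decide)
  · exact absurd (rep 8 2 4 (by norm_num) (by norm_num)) (by decide)
  · exact absurd (rep 19 4 6 (by norm_num) (by norm_num)) (by decide)
  · exact absurd (rep 6 2 3 (by norm_num) (by norm_num)) (by decide)
  · exact absurd (rep 23 4 6 (by norm_num) (by norm_num)) (by decide)
  · exact absurd (rep 10 3 4 (by norm_num) (by norm_num)) (by decide)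
  · exact absurd (rep 7 2 3 (by norm_num) (by norm_num)) (by decide)
  · exact absurd (rep 20 4 6 (by norm_num) (by norm_num)) (by decide)

end Necessity

/-- Classification of the universal forms `a·x² + b·y² + c·t_z` with `a ≤ b`. -/
theorem universal_two_squares_one_triangular (a b c : ℕ)
    (ha : 0 < a) (hb : 0 < b) (hc : 0 < c) (hab : a ≤ b) :
    (∀ n : ℕ, ∃ x y z : ℤ,
        (n : ℤ) = a * x ^ 2 + b * y ^ 2 + c * triZ z) ↔
      (a, b, c) = (1, 1, 1) ∨ (a, b, c) = (1, 1, 2) ∨ (a, b, c) = (1, 2, 1) ∨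
      (a, b, c) = (1, 2, 2) ∨ (a, b, c) = (1, 2, 4) ∨ (a, b, c) = (1, 3, 1) ∨
      (a, b, c) = (1, 4, 1) ∨ (a, b, c) = (1, 4, 2) ∨ (a, b, c) = (1, 8, 1) ∨
      (a, b, c) = (2, 2, 1) := by
  exact ⟨mem_of_forall_exists_eq ha hb hc hab, exists_eq_of_mem⟩
end
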